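/- For every integer r ≥ 2 there exist constants 0 < c₀ ≤ c₁ and a function c, defined on the primes, with c₀ ≤ c(N) ≤ c₁ for all primes N, such that for every ε > 0 and every choice of p = p(N) ∈ [0,1] the following holds as N → ∞ through the primes: if p(N) ≥ (1+ε)·c(N)·N^{−1/2} for all primes N, then Pr((ℤ_N)_{p(N)} is r-Schur) → 1; and if p(N) ≤ (1−ε)·c(N)·N^{−1/2} for all primes N, then Pr((ℤ_N)_{p(N)} is r-Schur) → 0. -/

import Mathlib

open Filter

open Classical in
/-- The probability that the binomial random subset of the finite set `X`,
in which each element is retained independently with probability `p`,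
satisfies the predicate `P`. -/
noncomputable def probSub {α : Type*} (X : Finset α) (p : ℝ) (P : Finset α → Prop) : ℝ :=
  ∑ S ∈ X.powerset, if P S then p ^ S.card * (1 - p) ^ (X.card - S.card) else 0

/-- The finset of all elements of `ℤ_N` (equal to `univ` for `N > 0`). -/
def zmodAll (N : ℕ) : Finset (ZMod N) :=
  (Finset.range N).image fun i : ℕ => (i : ZMod N)

/-- `Y ⊆ ℤ_N` is `r`-Schur: every colouring of `ℤ_N` with `r` colours admits a
monochromatic Schur triple inside `Y`, i.e. three pairwise distinct elements
`a, b, d ∈ Y` with `a + b = d`, all of the same colour. -/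
def IsSchur (r N : ℕ) (Y : Finset (ZMod N)) : Prop :=
  ∀ c : ZMod N → Fin r, ∃ a b d : ZMod N, a ∈ Y ∧ b ∈ Y ∧ d ∈ Y ∧
    a ≠ b ∧ a ≠ d ∧ b ≠ d ∧ a + b = d ∧ c a = c b ∧ c b = c d

set_option linter.unusedSectionVars false

namespace SchurThreshold

section Expectation
open Finset

variable {α : Type*} [DecidableEq α]

/-- The real-valued indicator of a proposition. -/
noncomputable def ind (P : Prop) : ℝ := by
  classical exact if P then 1 else 0

lemma ind_pos {P : Prop} (h : P) : ind P = 1 := by simp [ind, h]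
lemma ind_neg {P : Prop} (h : ¬P) : ind P = 0 := by simp [ind, h]
lemma ind_nonneg (P : Prop) : 0 ≤ ind P := by
  by_cases h : P <;> simp [ind, h]
lemma ind_le_one (P : Prop) : ind P ≤ 1 := by
  by_cases h : P <;> simp [ind, h]
lemma ind_mono {P Q : Prop} (h : P → Q) : ind P ≤ ind Q := by
  by_cases hP : P
  · rw [ind_pos hP, ind_pos (h hP)]
  · rw [ind_neg hP]; exact ind_nonneg Q
lemma ind_and (P Q : Prop) : ind (P ∧ Q) = ind P * ind Q := by
  by_cases hP : P <;> by_cases hQ : Q <;> simp [ind, hP, hQ]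
lemma ind_or_le (P Q : Prop) : ind (P ∨ Q) ≤ ind P + ind Q := by
  by_cases hP : P <;> by_cases hQ : Q <;> simp [ind, hP, hQ]
lemma ind_not (P : Prop) : ind (¬P) = 1 - ind P := by
  by_cases hP : P <;> simp [ind, hP]

/-- Expectation of `F` over the binomial random subset of `X` with density `p`. -/
noncomputable def Ex (X : Finset α) (p : ℝ) (F : Finset α → ℝ) : ℝ :=
  ∑ S ∈ X.powerset, p ^ #S * (1 - p) ^ (#X - #S) * F S

/-- Probability of `P` over the binomial random subset of `X` with density `p`. -/
noncomputable def Pr (X : Finset α) (p : ℝ) (P : Finset α → Prop) : ℝ :=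
  Ex X p fun S => ind (P S)

lemma probSub_eq_Pr (X : Finset α) (p : ℝ) (P : Finset α → Prop) : probSub X p P = Pr X p P := by
  unfold probSub Pr Ex
  refine sum_congr rfl fun S _ => ?_
  by_cases h : P S <;> simp [ind, h]

lemma Ex_empty (p : ℝ) (F : Finset α → ℝ) : Ex ∅ p F = F ∅ := by simp [Ex]

lemma Ex_congr {X : Finset α} {p : ℝ} {F G : Finset α → ℝ} (h : ∀ S ⊆ X, F S = G S) :
    Ex X p F = Ex X p G :=
  sum_congr rfl fun S hS => by rw [h S (mem_powerset.1 hS)]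

lemma Ex_insert {a : α} {X : Finset α} (ha : a ∉ X) (p : ℝ) (F : Finset α → ℝ) :
    Ex (insert a X) p F = p * Ex X p (fun S => F (insert a S)) + (1 - p) * Ex X p F := by
  unfold Ex
  rw [powerset_insert, sum_union, add_comm, sum_image, mul_sum, mul_sum]
  · congr 1
    · refine sum_congr rfl fun S hS => ?_
      have hS' := mem_powerset.1 hS
      rw [card_insert_of_notMem ha, card_insert_of_notMem (fun h => ha (hS' h)), Nat.add_sub_add_right]
      ring
    · refine sum_congr rfl fun S hS => ?_
      have hS' := card_le_card (mem_powerset.1 hS)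
      rw [card_insert_of_notMem ha, Nat.succ_sub hS', pow_succ]
      ring
  · intro S hS T hT h
    have hS' := mem_powerset.1 hS
    have hT' := mem_powerset.1 hT
    have := congrArg (fun U => U.erase a) h
    simpa [erase_insert (fun h => ha (hS' h)), erase_insert (fun h => ha (hT' h))] using this
  · rw [Finset.disjoint_left]
    intro S hS hS2
    obtain ⟨T, _, rfl⟩ := mem_image.1 hS2
    exact ha (mem_powerset.1 hS (mem_insert_self a T))

lemma Ex_add (X : Finset α) (p : ℝ) (F G : Finset α → ℝ) :
    Ex X p (fun S => F S + G S) = Ex X p F + Ex X p G := by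
  simp [Ex, mul_add, sum_add_distrib]

lemma Ex_sub (X : Finset α) (p : ℝ) (F G : Finset α → ℝ) :
    Ex X p (fun S => F S - G S) = Ex X p F - Ex X p G := by
  simp [Ex, mul_sub, sum_sub_distrib]

lemma Ex_const_mul (X : Finset α) (p c : ℝ) (F : Finset α → ℝ) :
    Ex X p (fun S => c * F S) = c * Ex X p F := by
  simp only [Ex, mul_sum]
  exact sum_congr rfl fun S _ => by ring

lemma Ex_sum {ι : Type*} (X : Finset α) (p : ℝ) (s : Finset ι) (F : ι → Finset α → ℝ) :
    Ex X p (fun S => ∑ i ∈ s, F i S) = ∑ i ∈ s, Ex X p (F i) := by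
  simp only [Ex, mul_sum]
  exact sum_comm

lemma Ex_const (X : Finset α) (p c : ℝ) : Ex X p (fun _ => c) = c := by
  induction X using Finset.induction_on with
  | empty => simp [Ex_empty]
  | insert a X ha ih => rw [Ex_insert ha, ih]; ring

lemma Ex_mono {X : Finset α} {p : ℝ} (h0 : 0 ≤ p) (h1 : p ≤ 1) {F G : Finset α → ℝ}
    (h : ∀ S ⊆ X, F S ≤ G S) : Ex X p F ≤ Ex X p G :=
  sum_le_sum fun S hS => mul_le_mul_of_nonneg_left (h S (mem_powerset.1 hS))
    (mul_nonneg (pow_nonneg h0 _) (pow_nonneg (sub_nonneg.2 h1) _))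

lemma Ex_nonneg {X : Finset α} {p : ℝ} (h0 : 0 ≤ p) (h1 : p ≤ 1) {F : Finset α → ℝ}
    (h : ∀ S ⊆ X, 0 ≤ F S) : 0 ≤ Ex X p F := by
  have := Ex_mono h0 h1 (F := fun _ => 0) h
  rwa [Ex_const] at this

lemma Ex_le_of_le {X : Finset α} {p : ℝ} (h0 : 0 ≤ p) (h1 : p ≤ 1) {F : Finset α → ℝ} {c : ℝ}
    (h : ∀ S ⊆ X, F S ≤ c) : Ex X p F ≤ c := by
  have := Ex_mono h0 h1 (G := fun _ => c) h
  rwa [Ex_const] at this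

lemma Pr_mono {X : Finset α} {p : ℝ} (h0 : 0 ≤ p) (h1 : p ≤ 1) {P Q : Finset α → Prop}
    (h : ∀ S ⊆ X, P S → Q S) : Pr X p P ≤ Pr X p Q :=
  Ex_mono h0 h1 fun S hS => ind_mono (h S hS)

lemma Pr_nonneg {X : Finset α} {p : ℝ} (h0 : 0 ≤ p) (h1 : p ≤ 1) (P : Finset α → Prop) :
    0 ≤ Pr X p P := Ex_nonneg h0 h1 fun _ _ => ind_nonneg _

lemma Pr_le_one {X : Finset α} {p : ℝ} (h0 : 0 ≤ p) (h1 : p ≤ 1) (P : Finset α → Prop) :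
    Pr X p P ≤ 1 := Ex_le_of_le h0 h1 fun _ _ => ind_le_one _

lemma Pr_or_le {X : Finset α} {p : ℝ} (h0 : 0 ≤ p) (h1 : p ≤ 1) (P Q : Finset α → Prop) :
    Pr X p (fun S => P S ∨ Q S) ≤ Pr X p P + Pr X p Q := by
  unfold Pr
  rw [← Ex_add]
  exact Ex_mono h0 h1 fun S _ => ind_or_le _ _

lemma Pr_not (X : Finset α) (p : ℝ) (P : Finset α → Prop) :
    Pr X p (fun S => ¬ P S) = 1 - Pr X p P := by
  unfold Pr
  simp only [ind_not]
  rw [Ex_sub, Ex_const]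

lemma Pr_exists_le {ι : Type*} {X : Finset α} {p : ℝ} (h0 : 0 ≤ p) (h1 : p ≤ 1) (s : Finset ι)
    (P : ι → Finset α → Prop) :
    Pr X p (fun S => ∃ i ∈ s, P i S) ≤ ∑ i ∈ s, Pr X p (P i) := by
  unfold Pr
  rw [← Ex_sum]
  refine Ex_mono h0 h1 fun S _ => ?_
  by_cases h : ∃ i ∈ s, P i S
  · obtain ⟨i, hi, hP⟩ := h
    rw [ind_pos ⟨i, hi, hP⟩, ← ind_pos hP]
    exact single_le_sum (f := fun i => ind (P i S)) (fun _ _ => ind_nonneg _) hi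
  · rw [ind_neg h]
    exact sum_nonneg fun _ _ => ind_nonneg _

lemma Pr_le_Ex {X : Finset α} {p : ℝ} (h0 : 0 ≤ p) (h1 : p ≤ 1) {P : Finset α → Prop}
    {F : Finset α → ℝ} (hF : ∀ S ⊆ X, 0 ≤ F S) (h : ∀ S ⊆ X, P S → 1 ≤ F S) :
    Pr X p P ≤ Ex X p F := by
  refine Ex_mono h0 h1 fun S hS => ?_
  by_cases hP : P S
  · rw [ind_pos hP]; exact h S hS hP
  · rw [ind_neg hP]; exact hF S hS

/-- Markov's inequality. -/
lemma Pr_mul_le_Ex {X : Finset α} {p t : ℝ} (h0 : 0 ≤ p) (h1 : p ≤ 1) (ht : 0 < t)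
    {P : Finset α → Prop} {F : Finset α → ℝ} (hF : ∀ S ⊆ X, 0 ≤ F S)
    (h : ∀ S ⊆ X, P S → t ≤ F S) : Pr X p P * t ≤ Ex X p F := by
  have := Pr_le_Ex h0 h1 (P := P) (F := fun S => t⁻¹ * F S)
    (fun S hS => mul_nonneg (inv_nonneg.2 ht.le) (hF S hS))
    (fun S hS hP => by rw [inv_mul_eq_div, le_div_iff₀ ht, one_mul]; exact h S hS hP)
  rw [Ex_const_mul, inv_mul_eq_div, le_div_iff₀ ht] at this
  exact this

lemma Ex_union (X : Finset α) (p q : ℝ) (F : Finset α → ℝ) :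
    Ex X (p + q - p * q) F = Ex X p fun S => Ex X q fun T => F (S ∪ T) := by
  induction X using Finset.induction_on generalizing F with
  | empty => simp [Ex_empty]
  | insert a X ha ih =>
    simp only [Ex_insert ha, ih]
    simp only [Ex_add, Ex_const_mul, insert_union, union_insert, insert_idem]
    ring

lemma Pr_subset_disjoint {X T M : Finset α} (p : ℝ) (hT : T ⊆ X) (hM : M ⊆ X) (hd : Disjoint T M) :
    Pr X p (fun S => T ⊆ S ∧ Disjoint S M) = p ^ #T * (1 - p) ^ #M := by
  induction X using Finset.induction_on generalizing T M with
  | empty =>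
    rw [subset_empty] at hT hM
    subst hT hM
    simp [Pr, Ex_empty, ind]
  | insert a X ha ih =>
    unfold Pr at ih ⊢
    rw [Ex_insert ha]
    by_cases haT : a ∈ T
    · have haM : a ∉ M := Finset.disjoint_left.1 hd haT
      have hM' : M ⊆ X := (subset_insert_iff_of_notMem haM).1 hM
      have hT' : T.erase a ⊆ X := by rwa [← subset_insert_iff]
      have e1 : Ex X p (fun S => ind (T ⊆ insert a S ∧ Disjoint (insert a S) M)) =
          p ^ #(T.erase a) * (1 - p) ^ #M := by
        rw [← ih hT' hM' (hd.mono_left (erase_subset _ _))]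
        refine Ex_congr fun S _ => ?_
        simp [subset_insert_iff, haM]
      have e2 : Ex X p (fun S => ind (T ⊆ S ∧ Disjoint S M)) = 0 := by
        rw [← Ex_const X p 0]
        refine Ex_congr fun S hS => ind_neg fun h => ha (hS (h.1 haT))
      rw [e1, e2, ← card_erase_add_one haT]
      ring
    · have hT' : T ⊆ X := (subset_insert_iff_of_notMem haT).1 hT
      by_cases haM : a ∈ M
      · have hM' : M.erase a ⊆ X := by rwa [← subset_insert_iff]
        have e1 : Ex X p (fun S => ind (T ⊆ insert a S ∧ Disjoint (insert a S) M)) = 0 := by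
          rw [← Ex_const X p 0]
          refine Ex_congr fun S hS => ind_neg fun h => ?_
          exact Finset.disjoint_left.1 h.2 (mem_insert_self a S) haM
        have e2 : Ex X p (fun S => ind (T ⊆ S ∧ Disjoint S M)) =
            p ^ #T * (1 - p) ^ #(M.erase a) := by
          rw [← ih hT' hM' (hd.mono_right (erase_subset _ _))]
          refine Ex_congr fun S hS => ?_
          have : a ∉ S := fun h => ha (hS h)
          congr 2
          apply propext
          rw [← disjoint_erase_comm, erase_eq_of_notMem this]
        rw [e1, e2, ← card_erase_add_one haM]
        ring
      · have hM' : M ⊆ X := (subset_insert_iff_of_notMem haM).1 hM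
        have e1 : Ex X p (fun S => ind (T ⊆ insert a S ∧ Disjoint (insert a S) M)) =
            p ^ #T * (1 - p) ^ #M := by
          rw [← ih hT' hM' hd]
          refine Ex_congr fun S _ => ?_
          simp [subset_insert_iff_of_notMem haT, haM]
        rw [e1, ih hT' hM' hd]
        ring

lemma Pr_subset {X T : Finset α} (p : ℝ) (hT : T ⊆ X) :
    Pr X p (fun S => T ⊆ S) = p ^ #T := by
  have := Pr_subset_disjoint p hT (empty_subset X) (disjoint_empty_right T)
  simpa using this

/-- Union bound over fingerprints `T` that force the random set to avoid `M T`. -/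
lemma Pr_fingerprint_le {ι : Type*} {X : Finset α} {p : ℝ} (h0 : 0 ≤ p) (h1 : p ≤ 1)
    (𝒯 : Finset ι) (T : ι → Finset α) (h𝒯 : ∀ c ∈ 𝒯, T c ⊆ X) (M : ι → Finset α)
    (hM : ∀ c ∈ 𝒯, M c ⊆ X ∧ Disjoint (T c) (M c)) (m : ℕ) (hm : ∀ c ∈ 𝒯, m ≤ #(M c))
    {P : Finset α → Prop} (hP : ∀ S ⊆ X, P S → ∃ c ∈ 𝒯, T c ⊆ S ∧ Disjoint S (M c)) :
    Pr X p P ≤ (∑ c ∈ 𝒯, p ^ #(T c)) * (1 - p) ^ m := by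
  refine (Pr_mono h0 h1 hP).trans ((Pr_exists_le h0 h1 𝒯 _).trans ?_)
  rw [sum_mul]
  refine sum_le_sum fun c hc => ?_
  rw [Pr_subset_disjoint p (h𝒯 c hc) (hM c hc).1 (hM c hc).2]
  exact mul_le_mul_of_nonneg_left (pow_le_pow_of_le_one (by linarith) (by linarith) (hm c hc))
    (pow_nonneg h0 _)

lemma sum_pow_card_le (X : Finset α) {q l : ℝ} (hq : 0 ≤ q) (hl : 0 < l) (hl1 : l ≤ 1) (t : ℕ) :
    ∑ T ∈ X.powerset with #T ≤ t, q ^ #T ≤ (l⁻¹) ^ t * Real.exp (l * q * #X) := by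
  have h1 : ∑ T ∈ X.powerset with #T ≤ t, q ^ #T ≤
      ∑ T ∈ X.powerset, (l⁻¹) ^ t * ((l * q) ^ #T * 1 ^ (#X - #T)) := by
    refine (sum_le_sum fun T hT => ?_).trans
      (sum_le_sum_of_subset_of_nonneg (filter_subset _ _) fun _ _ _ => by positivity)
    have ht := (mem_filter.1 hT).2
    rw [one_pow, mul_one, mul_pow, ← mul_assoc]
    refine le_mul_of_one_le_left (pow_nonneg hq _) ?_
    rw [inv_pow, inv_mul_eq_div, le_div_iff₀ (pow_pos hl _), one_mul]
    exact pow_le_pow_of_le_one hl.le hl1 ht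
  refine h1.trans ?_
  rw [← mul_sum, sum_pow_mul_eq_add_pow]
  refine mul_le_mul_of_nonneg_left ?_ (by positivity)
  rw [mul_comm (l * q) (#X : ℝ), Real.exp_nat_mul]
  exact pow_le_pow_left₀ (by positivity) (Real.add_one_le_exp _) _

/-- Russo's formula. -/
lemma hasDerivAt_Ex (X : Finset α) (F : Finset α → ℝ) (p : ℝ) :
    HasDerivAt (fun p => Ex X p F)
      (∑ i ∈ X, Ex X p fun S => F (insert i S) - F (S.erase i)) p := by
  induction X using Finset.induction_on generalizing F with
  | empty => simpa [Ex_empty] using hasDerivAt_const p (F ∅)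
  | insert a X ha ih =>
    simp only [Ex_insert ha]
    have h1 := ((hasDerivAt_id p).mul (ih fun S => F (insert a S))).add
      (((hasDerivAt_const p (1 : ℝ)).sub (hasDerivAt_id p)).mul (ih F))
    refine h1.congr_deriv ?_
    rw [sum_insert ha]
    have e1 : Ex X p (fun S => F (insert a (insert a S)) - F ((insert a S).erase a)) =
        Ex X p (fun S => F (insert a S)) - Ex X p F := by
      rw [← Ex_sub]
      refine Ex_congr fun S hS => ?_
      rw [insert_idem, erase_insert fun h => ha (hS h)]
    have e2 : Ex X p (fun S => F (insert a S) - F (S.erase a)) =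
        Ex X p (fun S => F (insert a S)) - Ex X p F := by
      rw [← Ex_sub]
      refine Ex_congr fun S hS => ?_
      rw [erase_eq_of_notMem fun h => ha (hS h)]
    have e3 : ∑ i ∈ X, (p * Ex X p (fun S => F (insert i (insert a S)) - F ((insert a S).erase i)) +
          (1 - p) * Ex X p (fun S => F (insert i S) - F (S.erase i))) =
        p * ∑ i ∈ X, Ex X p (fun S => F (insert a (insert i S)) - F (insert a (S.erase i))) +
        (1 - p) * ∑ i ∈ X, Ex X p (fun S => F (insert i S) - F (S.erase i)) := by
      rw [mul_sum, mul_sum, ← sum_add_distrib]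
      refine sum_congr rfl fun i hi => ?_
      have hia : a ≠ i := fun h => ha (h ▸ hi)
      congr 2
      refine Ex_congr fun S _ => ?_
      rw [Finset.insert_comm, erase_insert_of_ne hia]
    rw [e1, e2, e3]
    simp only [id, Pi.sub_apply]
    ring

lemma Ex_mono_density {X : Finset α} {F : Finset α → ℝ}
    (hF : ∀ S T, S ⊆ T → T ⊆ X → F S ≤ F T) {p q : ℝ} (h0 : 0 ≤ p) (hpq : p ≤ q) (h1 : q ≤ 1) :
    Ex X p F ≤ Ex X q F := by
  refine monotoneOn_of_hasDerivWithinAt_nonneg (D := Set.Icc 0 1) (convex_Icc 0 1)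
    (f := fun p => Ex X p F)
    (f' := fun p => ∑ i ∈ X, Ex X p fun S => F (insert i S) - F (S.erase i))
    (fun x _ => (hasDerivAt_Ex X F x).continuousAt.continuousWithinAt)
    (fun x _ => (hasDerivAt_Ex X F x).hasDerivWithinAt) ?_ ⟨h0, hpq.trans h1⟩
    ⟨h0.trans hpq, h1⟩ hpq
  intro x hx
  rw [interior_Icc] at hx
  exact sum_nonneg fun i hi => Ex_nonneg hx.1.le hx.2.le fun S hS =>
    sub_nonneg.2 (hF _ _ ((erase_subset _ _).trans (subset_insert _ _))
      (insert_subset hi hS))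

lemma Pr_mono_density {X : Finset α} {P : Finset α → Prop}
    (hP : ∀ S T, S ⊆ T → P S → P T) {p q : ℝ} (h0 : 0 ≤ p) (hpq : p ≤ q) (h1 : q ≤ 1) :
    Pr X p P ≤ Pr X q P :=
  Ex_mono_density (fun S T h _ => ind_mono (hP S T h)) h0 hpq h1

lemma Ex_map_equiv [Fintype α] (e : α ≃ α) (p : ℝ) (F : Finset α → ℝ) :
    Ex univ p (fun S => F (S.map e.toEmbedding)) = Ex univ p F := by
  unfold Ex
  simp only [powerset_univ]
  refine Fintype.sum_equiv e.finsetCongr _ _ fun S => ?_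
  simp

lemma continuous_Ex (X : Finset α) (F : Finset α → ℝ) : Continuous fun p => Ex X p F :=
  continuous_iff_continuousAt.2 fun p => (hasDerivAt_Ex X F p).continuousAt

lemma Ex_card_inter (X Y : Finset α) (hY : Y ⊆ X) (p : ℝ) :
    Ex X p (fun S => (#(S ∩ Y) : ℝ)) = p * #Y := by
  have h : ∀ S : Finset α, (#(S ∩ Y) : ℝ) = ∑ y ∈ Y, ind ({y} ⊆ S) := by
    intro S
    rw [card_eq_sum_ones, inter_comm, ← filter_mem_eq_inter, sum_filter]
    push_cast
    refine sum_congr rfl fun y _ => ?_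
    by_cases h : y ∈ S <;> simp [ind, h]
  simp only [h]
  rw [Ex_sum]
  have : ∀ y ∈ Y, Ex X p (fun S => ind ({y} ⊆ S)) = p := fun y hy => by
    have := Pr_subset (X := X) (T := {y}) p (by simpa using hY hy)
    simpa [Pr] using this
  rw [sum_congr rfl this]
  simp [mul_comm]

end Expectation

section Fourier
open Finset

variable {α : Type*} [DecidableEq α]

/-- The value of the `p`-biased character at a coordinate that is present. -/
noncomputable def chiIn (p : ℝ) : ℝ := (1 - p) / √(p * (1 - p))
/-- The value of the `p`-biased character at a coordinate that is absent. -/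
noncomputable def chiOut (p : ℝ) : ℝ := -p / √(p * (1 - p))

/-- The `p`-biased Fourier character indexed by `S`. -/
noncomputable def chi (p : ℝ) (S x : Finset α) : ℝ :=
  ∏ i ∈ S, if i ∈ x then chiIn p else chiOut p

/-- The `p`-biased Fourier coefficient of `f` at `S`. -/
noncomputable def hat (p : ℝ) (X : Finset α) (f : Finset α → ℝ) (S : Finset α) : ℝ :=
  Ex X p fun x => f x * chi p S x

lemma chi_insert_notMem {p : ℝ} {a : α} {S x : Finset α} (haS : a ∉ S) :
    chi p S (insert a x) = chi p S x := by
  refine prod_congr rfl fun i hi => ?_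
  have : i ≠ a := fun h => haS (h ▸ hi)
  simp [this]

lemma chi_insert_insert {p : ℝ} {a : α} {S x : Finset α} (haS : a ∉ S) :
    chi p (insert a S) (insert a x) = chiIn p * chi p S x := by
  rw [← chi_insert_notMem haS, chi, prod_insert haS]
  simp [chi]

lemma chi_insert_of_notMem {p : ℝ} {a : α} {S x : Finset α} (haS : a ∉ S) (hax : a ∉ x) :
    chi p (insert a S) x = chiOut p * chi p S x := by
  rw [chi, prod_insert haS]
  simp [chi, hax]

lemma sq_sigma {p : ℝ} (h0 : 0 < p) (h1 : p < 1) : √(p * (1 - p)) ^ 2 = p * (1 - p) :=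
  Real.sq_sqrt (mul_nonneg h0.le (by linarith))

lemma sigma_pos {p : ℝ} (h0 : 0 < p) (h1 : p < 1) : 0 < √(p * (1 - p)) :=
  Real.sqrt_pos.2 (mul_pos h0 (by linarith))

lemma mul_chiIn {p : ℝ} (h0 : 0 < p) (h1 : p < 1) : p * chiIn p = √(p * (1 - p)) := by
  have := sigma_pos h0 h1
  have h := sq_sigma h0 h1
  rw [chiIn]; field_simp; linarith

lemma mul_chiOut {p : ℝ} (h0 : 0 < p) (h1 : p < 1) :
    (1 - p) * chiOut p = -√(p * (1 - p)) := by
  have := sigma_pos h0 h1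
  have h := sq_sigma h0 h1
  rw [chiOut]; field_simp; linarith

lemma hat_insert_of_subset {p : ℝ} {a : α} {X S : Finset α} (ha : a ∉ X) (hS : S ⊆ X)
    (f : Finset α → ℝ) :
    hat p (insert a X) f S = hat p X (fun x => p * f (insert a x) + (1 - p) * f x) S := by
  unfold hat
  rw [Ex_insert ha, ← Ex_const_mul, ← Ex_const_mul, ← Ex_add]
  refine Ex_congr fun x _ => ?_
  rw [chi_insert_notMem fun h => ha (hS h)]
  ring

lemma hat_insert_insert {p : ℝ} (h0 : 0 < p) (h1 : p < 1) {a : α} {X S : Finset α} (ha : a ∉ X)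
    (hS : S ⊆ X) (f : Finset α → ℝ) :
    hat p (insert a X) f (insert a S) =
      hat p X (fun x => √(p * (1 - p)) * (f (insert a x) - f x)) S := by
  unfold hat
  rw [Ex_insert ha, ← Ex_const_mul, ← Ex_const_mul, ← Ex_add]
  refine Ex_congr fun x hx => ?_
  have haS : a ∉ S := fun h => ha (hS h)
  rw [chi_insert_insert haS, chi_insert_of_notMem haS fun h => ha (hx h)]
  have e1 := mul_chiIn h0 h1
  have e2 := mul_chiOut h0 h1
  linear_combination f (insert a x) * chi p S x * e1 + f x * chi p S x * e2

lemma sum_powerset_insert' {a : α} {X : Finset α} (ha : a ∉ X) (G : Finset α → ℝ) :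
    ∑ S ∈ (insert a X).powerset, G S = ∑ S ∈ X.powerset, (G S + G (insert a S)) := by
  rw [Finset.sum_powerset_insert ha, sum_add_distrib]

theorem parseval {p : ℝ} (h0 : 0 < p) (h1 : p < 1) (X : Finset α) (f : Finset α → ℝ) :
    ∑ S ∈ X.powerset, hat p X f S ^ 2 = Ex X p fun x => f x ^ 2 := by
  induction X using Finset.induction_on generalizing f with
  | empty => simp [hat, Ex_empty, chi]
  | insert a X ha ih =>
    rw [sum_powerset_insert' ha, Ex_insert ha, sum_add_distrib]
    rw [sum_congr rfl fun S hS => by rw [hat_insert_of_subset ha (mem_powerset.1 hS)], ih]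
    rw [sum_congr rfl fun S hS => by rw [hat_insert_insert h0 h1 ha (mem_powerset.1 hS)], ih]
    rw [← Ex_const_mul, ← Ex_const_mul, ← Ex_add, ← Ex_add]
    refine Ex_congr fun x _ => ?_
    have h := sq_sigma h0 h1
    rw [mul_pow, h]
    ring

/-- The noise-damped polynomial with coefficients `c`. -/
noncomputable def poly (p : ℝ) (X : Finset α) (c : Finset α → ℝ) (x : Finset α) : ℝ :=
  ∑ S ∈ X.powerset, (1 / 2) ^ #S * c S * chi p S x

lemma poly_insert_in {p : ℝ} {a : α} {X : Finset α} (ha : a ∉ X) (c : Finset α → ℝ)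
    (x : Finset α) :
    poly p (insert a X) c (insert a x) =
      poly p X c x + chiIn p / 2 * poly p X (fun S => c (insert a S)) x := by
  unfold poly
  rw [sum_powerset_insert' ha, mul_sum, ← sum_add_distrib]
  refine sum_congr rfl fun S hS => ?_
  have haS : a ∉ S := fun h => ha (mem_powerset.1 hS h)
  rw [chi_insert_insert haS, chi_insert_notMem haS, card_insert_of_notMem haS]
  ring

lemma poly_insert_out {p : ℝ} {a : α} {X : Finset α} (ha : a ∉ X) (c : Finset α → ℝ)
    {x : Finset α} (hx : a ∉ x) :
    poly p (insert a X) c x =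
      poly p X c x + chiOut p / 2 * poly p X (fun S => c (insert a S)) x := by
  unfold poly
  rw [sum_powerset_insert' ha, mul_sum, ← sum_add_distrib]
  refine sum_congr rfl fun S hS => ?_
  have haS : a ∉ S := fun h => ha (mem_powerset.1 hS h)
  rw [chi_insert_of_notMem haS hx, card_insert_of_notMem haS]
  ring

/-- The Fourier weight of `c` above `S`. -/
noncomputable def upWeight (X : Finset α) (c : Finset α → ℝ) (S : Finset α) : ℝ :=
  ∑ T ∈ X.powerset with S ⊆ T, c T ^ 2

lemma upWeight_nonneg (X : Finset α) (c : Finset α → ℝ) (S : Finset α) : 0 ≤ upWeight X c S :=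
  sum_nonneg fun _ _ => sq_nonneg _

lemma upWeight_insert {a : α} {X S : Finset α} (ha : a ∉ X) (hS : S ⊆ X) (c : Finset α → ℝ) :
    upWeight (insert a X) c S = upWeight X c S + upWeight X (fun T => c (insert a T)) S := by
  unfold upWeight
  simp only [sum_filter]
  rw [sum_powerset_insert' ha, ← sum_add_distrib]
  refine sum_congr rfl fun T _ => ?_
  simp only [subset_insert_iff_of_notMem fun h => ha (hS h)]

lemma upWeight_insert_insert {a : α} {X S : Finset α} (ha : a ∉ X) (hS : S ⊆ X)
    (c : Finset α → ℝ) :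
    upWeight (insert a X) c (insert a S) = upWeight X (fun T => c (insert a T)) S := by
  unfold upWeight
  simp only [sum_filter]
  rw [sum_powerset_insert' ha]
  refine sum_congr rfl fun T hT => ?_
  have haT : a ∉ T := fun h => ha (mem_powerset.1 hT h)
  have haS : a ∉ S := fun h => ha (hS h)
  have h1 : ¬ insert a S ⊆ T := fun h => haT (h (mem_insert_self _ _))
  have h2 : insert a S ⊆ insert a T ↔ S ⊆ T := insert_subset_insert_iff haS
  simp [h1, h2]

lemma fourth_moment_coordinate {p : ℝ} (h0 : 0 < p) (h1 : p < 1) (a b c e : ℝ) :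
    p * ((a + chiIn p / 2 * b) ^ 2 * (c + chiIn p / 2 * e) ^ 2) +
      (1 - p) * ((a + chiOut p / 2 * b) ^ 2 * (c + chiOut p / 2 * e) ^ 2) ≤
    a ^ 2 * c ^ 2 + a ^ 2 * e ^ 2 + b ^ 2 * c ^ 2 + (p * (1 - p))⁻¹ * (b ^ 2 * e ^ 2) := by
  have hs := sigma_pos h0 h1
  have hsq := sq_sigma h0 h1
  have hq : 0 < 1 - p := by linarith
  have hw : 0 < p * (1 - p) := mul_pos h0 hq
  set s := √(p * (1 - p)) with hsd
  have m1 : p * chiIn p + (1 - p) * chiOut p = 0 := by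
    rw [mul_chiIn h0 h1, mul_chiOut h0 h1]; ring
  have m2 : p * chiIn p ^ 2 + (1 - p) * chiOut p ^ 2 = 1 := by
    rw [chiIn, chiOut, ← hsd, div_pow, div_pow, hsq]; field_simp; ring
  obtain ⟨k, hk⟩ : ∃ k, k = p * chiIn p ^ 3 + (1 - p) * chiOut p ^ 3 := ⟨_, rfl⟩
  have hk' : k = (1 - 2 * p) / s := by
    rw [hk, chiIn, chiOut, ← hsd, div_pow, div_pow, eq_div_iff hs.ne']
    have : s ^ 3 = s * (p * (1 - p)) := by rw [← hsq]; ring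
    rw [this]; field_simp; ring
  have hk2 : k ^ 2 ≤ (p * (1 - p))⁻¹ := by
    rw [hk', div_pow, hsq, inv_eq_one_div]
    gcongr
    nlinarith
  obtain ⟨m, hm⟩ : ∃ m, m = p * chiIn p ^ 4 + (1 - p) * chiOut p ^ 4 := ⟨_, rfl⟩
  have hm2 : m ≤ (p * (1 - p))⁻¹ := by
    have h4 : s ^ 4 = (p * (1 - p)) ^ 2 := by rw [← hsq]; ring
    rw [hm, chiIn, chiOut, ← hsd, div_pow, div_pow, h4, inv_eq_one_div, mul_div, mul_div, ← add_div,
      div_le_div_iff₀ (by positivity) hw]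
    have : p * (1 - p) ^ 4 + (1 - p) * (-p) ^ 4 = (p * (1 - p)) * (1 - 3 * (p * (1 - p))) := by ring
    rw [this]
    nlinarith [mul_pos hw hw, mul_pos (mul_pos hw hw) hw]
  have key : p * ((a + chiIn p / 2 * b) ^ 2 * (c + chiIn p / 2 * e) ^ 2) +
      (1 - p) * ((a + chiOut p / 2 * b) ^ 2 * (c + chiOut p / 2 * e) ^ 2) =
      a ^ 2 * c ^ 2 + (1 / 4) * (a ^ 2 * e ^ 2 + b ^ 2 * c ^ 2 + 4 * (a * b * c * e)) +
      (1 / 4) * k * (a * b * e ^ 2 + b ^ 2 * c * e) + (1 / 16) * m * (b ^ 2 * e ^ 2) := by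
    rw [hk, hm]
    linear_combination (a * c * (a * e + b * c)) * m1 +
      (1 / 4) * (a ^ 2 * e ^ 2 + b ^ 2 * c ^ 2 + 4 * (a * b * c * e)) * m2
  rw [key]
  set w := (p * (1 - p))⁻¹
  have hbe : 0 ≤ b ^ 2 * e ^ 2 := by positivity
  nlinarith [sq_nonneg (a * e - b * c), sq_nonneg (a * e - k / 2 * (b * e)),
    sq_nonneg (b * c - k / 2 * (b * e)), mul_le_mul_of_nonneg_right hk2 hbe,
    mul_le_mul_of_nonneg_right hm2 hbe, sq_nonneg (a * e), sq_nonneg (b * c)]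

theorem fourth_moment_le {p : ℝ} (h0 : 0 < p) (h1 : p < 1) (X : Finset α) (c d : Finset α → ℝ) :
    Ex X p (fun x => poly p X c x ^ 2 * poly p X d x ^ 2) ≤
      ∑ S ∈ X.powerset, (p * (1 - p))⁻¹ ^ #S * (upWeight X c S * upWeight X d S) := by
  induction X using Finset.induction_on generalizing c d with
  | empty => simp [Ex_empty, poly, upWeight, chi]
  | insert a X ha ih =>
    set c1 := fun S => c (insert a S) with hc1
    set d1 := fun S => d (insert a S) with hd1
    have hw : 0 < (p * (1 - p))⁻¹ := inv_pos.2 (mul_pos h0 (by linarith))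
    set w := (p * (1 - p))⁻¹ with hwd
    have step : Ex (insert a X) p (fun x => poly p (insert a X) c x ^ 2 *
        poly p (insert a X) d x ^ 2) ≤
        Ex X p (fun x => poly p X c x ^ 2 * poly p X d x ^ 2) +
        Ex X p (fun x => poly p X c x ^ 2 * poly p X d1 x ^ 2) +
        Ex X p (fun x => poly p X c1 x ^ 2 * poly p X d x ^ 2) +
        w * Ex X p (fun x => poly p X c1 x ^ 2 * poly p X d1 x ^ 2) := by
      rw [Ex_insert ha, ← Ex_const_mul, ← Ex_const_mul, ← Ex_const_mul, ← Ex_add, ← Ex_add,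
        ← Ex_add, ← Ex_add]
      refine Ex_mono h0.le h1.le fun x hx => ?_
      have hax : a ∉ x := fun h => ha (hx h)
      rw [poly_insert_in ha, poly_insert_in ha, poly_insert_out ha _ hax, poly_insert_out ha _ hax]
      exact fourth_moment_coordinate h0 h1 _ _ _ _
    refine step.trans ?_
    have i1 := ih c d
    have i2 := ih c d1
    have i3 := ih c1 d
    have i4 := mul_le_mul_of_nonneg_left (ih c1 d1) hw.le
    refine (add_le_add (add_le_add (add_le_add i1 i2) i3) i4).trans ?_
    rw [sum_powerset_insert' ha, mul_sum, ← sum_add_distrib, ← sum_add_distrib, ← sum_add_distrib]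
    refine sum_le_sum fun S hS => ?_
    have hS' := mem_powerset.1 hS
    rw [upWeight_insert ha hS', upWeight_insert ha hS', upWeight_insert_insert ha hS',
      upWeight_insert_insert ha hS', card_insert_of_notMem fun h => ha (hS' h)]
    have : 0 ≤ w ^ #S * (upWeight X c1 S * upWeight X d1 S) :=
      mul_nonneg (pow_nonneg hw.le _) (mul_nonneg (upWeight_nonneg _ _ _) (upWeight_nonneg _ _ _))
    rw [pow_succ]
    linarith [this]

theorem derivative_weight_le {p : ℝ} (h0 : 0 < p) (h1 : p < 1) {S Y : Finset α}
    (hd : Disjoint S Y) (f : Finset α → ℝ) {M : ℝ}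
    (hM : ∀ U ⊆ S, Ex Y p (fun x => f (U ∪ x) ^ 2) ≤ M) :
    ∑ T ∈ Y.powerset, hat p (S ∪ Y) f (S ∪ T) ^ 2 ≤ (4 * (p * (1 - p))) ^ #S * M := by
  induction S using Finset.induction_on generalizing f M with
  | empty =>
    simp only [empty_union, card_empty, pow_zero, one_mul]
    rw [parseval h0 h1]
    simpa using hM ∅ subset_rfl
  | insert a S ha ih =>
    rw [disjoint_insert_left] at hd
    have ha' : a ∉ S ∪ Y := by simp [ha, hd.1]
    have hw : 0 ≤ p * (1 - p) := mul_nonneg h0.le (by linarith)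
    have e : ∀ T ∈ Y.powerset, hat p (insert a S ∪ Y) f (insert a S ∪ T) ^ 2 =
        hat p (S ∪ Y) (fun x => √(p * (1 - p)) * (f (insert a x) - f x)) (S ∪ T) ^ 2 := by
      intro T hT
      rw [insert_union, insert_union,
        hat_insert_insert h0 h1 ha' (union_subset_union_right (mem_powerset.1 hT))]
    rw [sum_congr rfl e, card_insert_of_notMem ha, pow_succ, mul_assoc]
    refine ih hd.2 _ fun U hU => ?_
    have l1 := hM U (hU.trans (subset_insert _ _))
    have l2 := hM (insert a U) (insert_subset_insert _ hU)
    calc _ ≤ Ex Y p (fun x => (2 * (p * (1 - p))) * f (U ∪ x) ^ 2 +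
            (2 * (p * (1 - p))) * f (insert a U ∪ x) ^ 2) := by
          refine Ex_mono h0.le h1.le fun x _ => ?_
          rw [mul_pow, sq_sigma h0 h1, insert_union]
          nlinarith [mul_nonneg hw (sq_nonneg (f (insert a (U ∪ x)) + f (U ∪ x)))]
      _ ≤ _ := by
          rw [Ex_add, Ex_const_mul, Ex_const_mul]
          nlinarith [mul_le_mul_of_nonneg_left l1 hw, mul_le_mul_of_nonneg_left l2 hw]

lemma Ex_le_two_pow_mul {p : ℝ} (h0 : 0 ≤ p) (h1 : p ≤ 1 / 2) {S Y : Finset α}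
    (hd : Disjoint S Y) {F : Finset α → ℝ} (hF : ∀ x, 0 ≤ F x) :
    Ex Y p F ≤ 2 ^ #S * Ex (S ∪ Y) p F := by
  induction S using Finset.induction_on with
  | empty => simp
  | insert a S ha ih =>
    rw [disjoint_insert_left] at hd
    have ha' : a ∉ S ∪ Y := by simp [ha, hd.1]
    rw [insert_union, Ex_insert ha', card_insert_of_notMem ha, pow_succ, mul_assoc]
    refine (ih hd.2).trans (mul_le_mul_of_nonneg_left ?_ (by positivity))
    have n1 : 0 ≤ Ex (S ∪ Y) p F := Ex_nonneg h0 (by linarith) fun x _ => hF x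
    have n2 : 0 ≤ Ex (S ∪ Y) p (fun x => F (insert a x)) :=
      Ex_nonneg h0 (by linarith) fun x _ => hF _
    nlinarith [mul_nonneg h0 n2]

lemma Ex_mul_sq_le {p : ℝ} (h0 : 0 ≤ p) (h1 : p ≤ 1) (X : Finset α) (F G : Finset α → ℝ) :
    Ex X p (fun x => F x * G x) ^ 2 ≤ Ex X p (fun x => F x ^ 2) * Ex X p (fun x => G x ^ 2) := by
  have hw : ∀ S : Finset α, 0 ≤ p ^ #S * (1 - p) ^ (#X - #S) := fun S =>
    mul_nonneg (pow_nonneg h0 _) (pow_nonneg (sub_nonneg.2 h1) _)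
  exact sum_sq_le_sum_mul_sum_of_sq_le_mul _ (fun S _ => mul_nonneg (hw S) (sq_nonneg _))
    (fun S _ => mul_nonneg (hw S) (sq_nonneg _)) fun S _ => le_of_eq (by ring)

/-- Level-`d` inequality for global indicator functions. -/
theorem level_le {p : ℝ} (h0 : 0 < p) (h1 : p ≤ 1 / 2) (X : Finset α) (d : ℕ) {δ θ : ℝ}
    (hθ : 0 ≤ θ) (hδθ : 2 ^ (8 * d) * δ ≤ θ ^ 3) (f : Finset α → ℝ)
    (hf : ∀ x, f x = 0 ∨ f x = 1)
    (hg : ∀ U ⊆ X, #U ≤ d → Ex X p (fun x => f (x ∪ U)) ≤ δ) :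
    ∑ S ∈ X.powerset with #S ≤ d, hat p X f S ^ 2 ≤ θ * Ex X p f := by
  have h1' : p < 1 := by linarith
  have hwpos : 0 < p * (1 - p) := mul_pos h0 (by linarith)
  have hfsq : ∀ x, f x ^ 2 = f x := fun x => by rcases hf x with h | h <;> simp [h]
  have hfnn : ∀ x, 0 ≤ f x := fun x => by rcases hf x with h | h <;> simp [h]
  have hδ : 0 ≤ δ := (Ex_nonneg h0.le h1'.le fun x _ => hfnn _).trans (hg ∅ (empty_subset _) (by simp))
  set W := ∑ S ∈ X.powerset with #S ≤ d, hat p X f S ^ 2 with hW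
  set c : Finset α → ℝ := fun S => if #S ≤ d then 2 ^ #S * hat p X f S else 0 with hc
  set g := poly p X c with hgd
  have hW0 : 0 ≤ W := sum_nonneg fun _ _ => sq_nonneg _
  have hE0 : 0 ≤ Ex X p f := Ex_nonneg h0.le h1'.le fun x _ => hfnn _
  have hWfg : W = Ex X p (fun x => f x * g x) := by
    have : ∀ x, f x * g x = ∑ S ∈ X.powerset,
        (if #S ≤ d then hat p X f S else 0) * (f x * chi p S x) := by
      intro x
      rw [hgd, poly, mul_sum]
      refine sum_congr rfl fun S _ => ?_
      simp only [hc]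
      split_ifs
      · rw [← mul_assoc ((1 / 2 : ℝ) ^ #S), ← mul_pow]; norm_num; ring
      · simp
    simp only [this]
    rw [Ex_sum, hW, sum_filter]
    refine sum_congr rfl fun S _ => ?_
    rw [Ex_const_mul]
    split_ifs
    · rw [sq]; rfl
    · simp
  have hup : ∀ S ∈ X.powerset, #S ≤ d → (p * (1 - p))⁻¹ ^ #S * upWeight X c S ≤ 2 ^ (5 * d) * δ := by
    intro S hS hSd
    have hSX := mem_powerset.1 hS
    have a1 : upWeight X c S ≤ 4 ^ d * ∑ T ∈ (X \ S).powerset, hat p X f (S ∪ T) ^ 2 := by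
      have : upWeight X c S ≤ ∑ T ∈ X.powerset with S ⊆ T, 4 ^ d * hat p X f T ^ 2 := by
        refine sum_le_sum fun T _ => ?_
        simp only [hc]
        split_ifs with h
        · rw [mul_pow, ← pow_mul, mul_comm #T 2, pow_mul]
          norm_num
          exact mul_le_mul_of_nonneg_right (pow_le_pow_right₀ (by norm_num) h) (sq_nonneg _)
        · simp; positivity
      refine this.trans ?_
      rw [mul_sum]
      refine le_of_eq (sum_bij' (fun T _ => T \ S) (fun T _ => S ∪ T) ?_ ?_ ?_ ?_ ?_)
      · intro T hT
        simp only [mem_filter, mem_powerset] at hT ⊢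
        exact sdiff_subset_sdiff hT.1 subset_rfl
      · intro T hT
        simp only [mem_filter, mem_powerset] at hT ⊢
        exact ⟨union_subset hSX (hT.trans sdiff_subset), subset_union_left⟩
      · intro T hT
        simp only [mem_filter, mem_powerset] at hT
        exact union_sdiff_of_subset hT.2
      · intro T hT
        have := mem_powerset.1 hT
        rw [union_sdiff_left]
        exact sdiff_eq_self_of_disjoint ((disjoint_sdiff.mono_right this).symm)
      · intro T hT
        simp only [mem_filter, mem_powerset] at hT
        rw [union_sdiff_of_subset hT.2]
    have a2 := derivative_weight_le h0 h1' (S := S) (Y := X \ S) disjoint_sdiff f (M := 2 ^ d * δ) (by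
      intro U hU
      simp only [hfsq]
      refine (Ex_le_two_pow_mul h0.le h1 (S := S) disjoint_sdiff fun x => hfnn _).trans ?_
      rw [union_sdiff_of_subset hSX]
      have := hg U (hU.trans hSX) ((card_le_card hU).trans hSd)
      simp only [union_comm U]
      refine mul_le_mul (pow_le_pow_right₀ (by norm_num) hSd) this ?_ (by positivity)
      exact Ex_nonneg h0.le h1'.le fun x _ => hfnn _)
    rw [union_sdiff_of_subset hSX] at a2
    have a3 : (p * (1 - p))⁻¹ ^ #S * (4 * (p * (1 - p))) ^ #S ≤ 4 ^ d := by
      rw [← mul_pow]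
      have : (p * (1 - p))⁻¹ * (4 * (p * (1 - p))) = 4 := by
        rw [mul_left_comm, inv_mul_cancel₀ hwpos.ne', mul_one]
      rw [this]
      exact pow_le_pow_right₀ (by norm_num) hSd
    calc (p * (1 - p))⁻¹ ^ #S * upWeight X c S
        ≤ (p * (1 - p))⁻¹ ^ #S * (4 ^ d * ((4 * (p * (1 - p))) ^ #S * (2 ^ d * δ))) := by
          refine mul_le_mul_of_nonneg_left (a1.trans ?_) (by positivity)
          exact mul_le_mul_of_nonneg_left a2 (by positivity)
      _ = ((p * (1 - p))⁻¹ ^ #S * (4 * (p * (1 - p))) ^ #S) * (4 ^ d * (2 ^ d * δ)) := by ring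
      _ ≤ 4 ^ d * (4 ^ d * (2 ^ d * δ)) := by gcongr
      _ = 2 ^ (5 * d) * δ := by
          have : (2 : ℝ) ^ (5 * d) = 4 ^ d * (4 ^ d * 2 ^ d) := by
            rw [← mul_pow, ← mul_pow, pow_mul]; norm_num
          rw [this]; ring
  have hup0 : ∀ S : Finset α, ¬ #S ≤ d → upWeight X c S = 0 := by
    intro S hS
    refine sum_eq_zero fun T hT => ?_
    have := card_le_card (mem_filter.1 hT).2
    simp only [hc]
    rw [if_neg (by omega)]; simp
  have hsumQ : ∑ S ∈ X.powerset with #S ≤ d, upWeight X c S ≤ 2 ^ (3 * d) * W := by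
    calc ∑ S ∈ X.powerset with #S ≤ d, upWeight X c S
        ≤ ∑ S ∈ X.powerset, upWeight X c S :=
          sum_le_sum_of_subset_of_nonneg (filter_subset _ _) fun _ _ _ => upWeight_nonneg _ _ _
      _ = ∑ T ∈ X.powerset, ∑ S ∈ T.powerset, c T ^ 2 := by
          unfold upWeight
          refine sum_comm' ?_
          intro S T
          simp only [mem_powerset, mem_filter]
          exact ⟨fun h => ⟨h.2.2, h.2.1⟩, fun h => ⟨h.1.trans h.2, h.2, h.1⟩⟩
      _ ≤ ∑ T ∈ X.powerset, if #T ≤ d then 2 ^ (3 * d) * hat p X f T ^ 2 else 0 := by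
          refine sum_le_sum fun T _ => ?_
          rw [sum_const, card_powerset, nsmul_eq_mul]
          simp only [hc]
          split_ifs with h
          · push_cast
            have e : (2 : ℝ) ^ #T * (2 ^ #T * hat p X f T) ^ 2 = 2 ^ (3 * #T) * hat p X f T ^ 2 := by
              ring
            rw [e]
            exact mul_le_mul_of_nonneg_right (pow_le_pow_right₀ (by norm_num) (by omega))
              (sq_nonneg _)
          · simp
      _ = 2 ^ (3 * d) * W := by rw [hW, mul_sum, sum_filter]
  have hg4 : Ex X p (fun x => g x ^ 2 * g x ^ 2) ≤ θ ^ 3 * W := by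
    refine (fourth_moment_le h0 h1' X c c).trans ?_
    calc ∑ S ∈ X.powerset, (p * (1 - p))⁻¹ ^ #S * (upWeight X c S * upWeight X c S)
        = ∑ S ∈ X.powerset with #S ≤ d,
            (p * (1 - p))⁻¹ ^ #S * (upWeight X c S * upWeight X c S) := by
          symm
          refine sum_filter_of_ne fun S _ h => ?_
          by_contra hS
          exact h (by rw [hup0 S hS]; simp)
      _ ≤ ∑ S ∈ X.powerset with #S ≤ d, (2 ^ (5 * d) * δ) * upWeight X c S := by
          refine sum_le_sum fun S hS => ?_
          rw [← mul_assoc]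
          exact mul_le_mul_of_nonneg_right (hup S (mem_filter.1 hS).1 (mem_filter.1 hS).2)
            (upWeight_nonneg _ _ _)
      _ ≤ (2 ^ (5 * d) * δ) * (2 ^ (3 * d) * W) := by
          rw [← mul_sum]
          exact mul_le_mul_of_nonneg_left hsumQ (by positivity)
      _ = (2 ^ (8 * d) * δ) * W := by
          have : (2 : ℝ) ^ (8 * d) = 2 ^ (5 * d) * 2 ^ (3 * d) := by rw [← pow_add]; ring_nf
          rw [this]; ring
      _ ≤ _ := mul_le_mul_of_nonneg_right hδθ hW0
  have cs1 : W ^ 2 ≤ Ex X p f * Ex X p (fun x => f x * g x ^ 2) := by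
    have := Ex_mul_sq_le h0.le h1'.le X f (fun x => f x * g x)
    simp only [← mul_assoc, ← sq, hfsq, mul_pow] at this
    rwa [← hWfg] at this
  have cs2 : Ex X p (fun x => f x * g x ^ 2) ^ 2 ≤ Ex X p f * (θ ^ 3 * W) := by
    have := Ex_mul_sq_le h0.le h1'.le X f (fun x => g x ^ 2)
    simp only [hfsq] at this
    refine this.trans (mul_le_mul_of_nonneg_left ?_ hE0)
    exact (Ex_congr fun x _ => by ring).trans_le hg4
  have h4 : W ^ 4 ≤ (θ * Ex X p f) ^ 3 * W := by
    calc W ^ 4 = (W ^ 2) ^ 2 := by ring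
      _ ≤ (Ex X p f * Ex X p (fun x => f x * g x ^ 2)) ^ 2 := pow_le_pow_left₀ (sq_nonneg _) cs1 2
      _ = Ex X p f ^ 2 * Ex X p (fun x => f x * g x ^ 2) ^ 2 := by ring
      _ ≤ Ex X p f ^ 2 * (Ex X p f * (θ ^ 3 * W)) := mul_le_mul_of_nonneg_left cs2 (sq_nonneg _)
      _ = _ := by ring
  rcases hW0.eq_or_lt with h | h
  · rw [← h]; exact mul_nonneg hθ hE0
  · have h3 : W ^ 3 ≤ (θ * Ex X p f) ^ 3 := by
      have : W ^ 3 * W ≤ (θ * Ex X p f) ^ 3 * W := by rw [← pow_succ]; exact h4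
      exact le_of_mul_le_mul_right this h
    exact le_of_pow_le_pow_left₀ (by norm_num) (mul_nonneg hθ hE0) h3

end Fourier

section Boost
open Finset

variable {α : Type*} [DecidableEq α]

lemma hat_insert_eq_sigma_mul {p : ℝ} (h0 : 0 < p) (h1 : p < 1) {X S : Finset α} {i : α}
    (hi : i ∈ X) (hS : S ⊆ X.erase i) (F : Finset α → ℝ) :
    hat p X F (insert i S) =
      √(p * (1 - p)) * hat p X (fun x => F (insert i x) - F (x.erase i)) S := by
  have hni : i ∉ X.erase i := notMem_erase i X
  obtain ⟨Y, hY⟩ : ∃ Y, Y = X.erase i := ⟨_, rfl⟩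
  have hX : X = insert i Y := by rw [hY, insert_erase hi]
  rw [← hY] at hni hS
  subst hX
  rw [hat_insert_insert h0 h1 hni hS, hat_insert_of_subset hni hS]
  unfold hat
  rw [← Ex_const_mul]
  refine Ex_congr fun x hx => ?_
  beta_reduce
  rw [insert_idem, erase_insert fun h => hni (hx h), erase_eq_of_notMem fun h => hni (hx h)]
  ring

lemma hat_add (p : ℝ) (X : Finset α) (f g : Finset α → ℝ) (S : Finset α) :
    hat p X (fun x => f x + g x) S = hat p X f S + hat p X g S := by
  unfold hat
  rw [← Ex_add]
  exact Ex_congr fun x _ => by ring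

/-- A function with bounded total influence and no local boosters has small variance. -/
theorem variance_le_of_no_booster {p : ℝ} (h0 : 0 < p) (h1 : p ≤ 1 / 2) (X : Finset α) (d : ℕ)
    {δ θ C η : ℝ} (hθ : 0 ≤ θ) (hδθ : 2 ^ (8 * d) * δ ≤ θ ^ 3) (F : Finset α → ℝ)
    (h' h'' : α → Finset α → ℝ)
    (hsplit : ∀ i ∈ X, ∀ x ⊆ X, F (insert i x) - F (x.erase i) = h' i x + h'' i x)
    (hh01 : ∀ i ∈ X, ∀ x ⊆ X, h' i x + h'' i x = 0 ∨ h' i x + h'' i x = 1)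
    (h'01 : ∀ i x, h' i x = 0 ∨ h' i x = 1) (h''01 : ∀ i x, h'' i x = 0 ∨ h'' i x = 1)
    (hC : ∑ i ∈ X, p * Ex X p (fun x => F (insert i x) - F (x.erase i)) ≤ C)
    (hη : ∑ i ∈ X, p * Ex X p (h'' i) ≤ η)
    (hno : ∀ i ∈ X, ∀ U ⊆ X, #U ≤ d → Ex X p (fun x => h' i (x ∪ U)) ≤ δ) :
    Ex X p (fun x => F x ^ 2) - Ex X p F ^ 2 ≤ C / (d + 2) + 2 * θ * C + 2 * η := by
  have h1' : p < 1 := by linarith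
  set h : α → Finset α → ℝ := fun i x => F (insert i x) - F (x.erase i) with hh
  have hd2 : (0 : ℝ) < d + 2 := by positivity
  have hempty : hat p X F ∅ = Ex X p F := by simp [hat, chi]
  have hpar := parseval h0 h1' X F
  rw [← sum_erase_add _ _ (empty_mem_powerset X), hempty] at hpar
  set G : Finset α → ℝ := fun T => ((if #T ≤ d + 1 then 1 else 0) + 1 / ((d : ℝ) + 2)) *
    hat p X F T ^ 2 with hG
  have hG0 : ∀ T, 0 ≤ G T := fun T => by
    refine mul_nonneg (add_nonneg ?_ (by positivity)) (sq_nonneg _)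
    split_ifs <;> norm_num
  have s1 : ∑ T ∈ X.powerset.erase ∅, hat p X F T ^ 2 ≤ ∑ T ∈ X.powerset, ∑ i ∈ T, G T := by
    refine (sum_le_sum fun T hT => ?_).trans (sum_le_sum_of_subset_of_nonneg (erase_subset _ _)
      fun T _ _ => sum_nonneg fun _ _ => hG0 T)
    have hT0 : T ≠ ∅ := (mem_erase.1 hT).1
    have hc : 1 ≤ #T := card_pos.2 (nonempty_iff_ne_empty.2 hT0)
    rw [sum_const, nsmul_eq_mul]
    simp only [hG]
    rw [← mul_assoc]
    refine le_mul_of_one_le_left (sq_nonneg _) ?_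
    split_ifs with hle
    · have h1c : (1 : ℝ) ≤ #T := by exact_mod_cast hc
      have : 0 ≤ 1 / ((d : ℝ) + 2) := by positivity
      nlinarith
    · rw [zero_add, mul_one_div, le_div_iff₀ hd2, one_mul]
      have : d + 2 ≤ #T := by omega
      exact_mod_cast this
  have s2 : ∑ T ∈ X.powerset, ∑ i ∈ T, G T = ∑ i ∈ X, ∑ S ∈ (X.erase i).powerset, G (insert i S) := by
    rw [sum_comm' (s' := fun i => X.powerset.filter (i ∈ ·)) (t' := X)]
    · refine sum_congr rfl fun i hi => ?_
      refine sum_bij' (fun T _ => T.erase i) (fun S _ => insert i S) ?_ ?_ ?_ ?_ ?_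
      · intro T hT
        exact mem_powerset.2 (erase_subset_erase _ (mem_powerset.1 (mem_filter.1 hT).1))
      · intro S hS
        refine mem_filter.2 ⟨mem_powerset.2 (insert_subset hi ?_), mem_insert_self _ _⟩
        exact (mem_powerset.1 hS).trans (erase_subset _ _)
      · intro T hT
        exact insert_erase (mem_filter.1 hT).2
      · intro S hS
        exact erase_insert fun hc => notMem_erase i X (mem_powerset.1 hS hc)
      · intro T hT
        rw [insert_erase (mem_filter.1 hT).2]
    · intro T i
      simp only [mem_powerset, mem_filter]
      exact ⟨fun a => ⟨⟨a.1, a.2⟩, a.1 a.2⟩, fun a => a.1⟩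
  have s3 : ∀ i ∈ X, ∑ S ∈ (X.erase i).powerset, G (insert i S) ≤
      (1 / ((d : ℝ) + 2)) * (p * Ex X p (h i)) + 2 * θ * (p * Ex X p (h i)) +
        2 * (p * Ex X p (h'' i)) := by
    intro i hi
    have e1 : ∀ S ∈ (X.erase i).powerset, G (insert i S) =
        (p * (1 - p)) * (((if #S ≤ d then 1 else 0) + 1 / ((d : ℝ) + 2)) * hat p X (h i) S ^ 2) := by
      intro S hS
      have hiS : i ∉ S := fun hc => notMem_erase i X (mem_powerset.1 hS hc)
      simp only [hG]
      rw [hat_insert_eq_sigma_mul h0 h1' hi (mem_powerset.1 hS), mul_pow, sq_sigma h0 h1',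
        card_insert_of_notMem hiS]
      simp only [Nat.add_le_add_iff_right]
      ring
    rw [sum_congr rfl e1, ← mul_sum]
    have hhsq : Ex X p (fun x => h i x ^ 2) = Ex X p (h i) := by
      refine Ex_congr fun x hx => ?_
      have := hsplit i hi x hx
      simp only [hh, this]
      rcases hh01 i hi x hx with a | a <;> rw [a] <;> norm_num
    have Eh0 : 0 ≤ Ex X p (h i) := hhsq ▸ Ex_nonneg h0.le h1'.le fun _ _ => sq_nonneg _
    have Eh'' : 0 ≤ Ex X p (h'' i) := Ex_nonneg h0.le h1'.le fun x _ => by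
      rcases h''01 i x with a | a <;> simp [a]
    have hle : Ex X p (h' i) ≤ Ex X p (h i) := by
      refine Ex_mono h0.le h1'.le fun x hx => ?_
      have := hsplit i hi x hx
      simp only [hh, this]
      rcases h''01 i x with a | a <;> simp [a]
    have b1 : ∑ S ∈ (X.erase i).powerset,
        ((if #S ≤ d then 1 else 0) + 1 / ((d : ℝ) + 2)) * hat p X (h i) S ^ 2 ≤
        (∑ S ∈ X.powerset with #S ≤ d, hat p X (h i) S ^ 2) +
          1 / ((d : ℝ) + 2) * Ex X p (h i) := by
      rw [← hhsq, ← parseval h0 h1', mul_sum, sum_filter, ← sum_add_distrib]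
      refine (sum_le_sum_of_subset_of_nonneg (powerset_mono.2 (erase_subset i X)) ?_).trans
        (sum_le_sum fun S _ => ?_)
      · intro S _ _
        refine mul_nonneg (add_nonneg ?_ (by positivity)) (sq_nonneg _)
        split_ifs <;> norm_num
      · split_ifs <;> linarith
    have b2 : ∑ S ∈ X.powerset with #S ≤ d, hat p X (h i) S ^ 2 ≤
        2 * (θ * Ex X p (h' i)) + 2 * Ex X p (h'' i) := by
      have l1 := level_le h0 h1 X d hθ hδθ (h' i) (h'01 i) (hno i hi)
      have l2 : ∑ S ∈ X.powerset with #S ≤ d, hat p X (h'' i) S ^ 2 ≤ Ex X p (h'' i) := by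
        refine (sum_le_sum_of_subset_of_nonneg (filter_subset _ _) fun _ _ _ => sq_nonneg _).trans ?_
        rw [parseval h0 h1']
        refine Ex_mono h0.le h1'.le fun x _ => ?_
        rcases h''01 i x with a | a <;> simp [a]
      refine le_trans ?_ (add_le_add (mul_le_mul_of_nonneg_left l1 zero_le_two)
        (mul_le_mul_of_nonneg_left l2 zero_le_two))
      rw [mul_sum, mul_sum, ← sum_add_distrib]
      refine sum_le_sum fun S _ => ?_
      have : hat p X (h i) S = hat p X (h' i) S + hat p X (h'' i) S := by
        rw [← hat_add]
        unfold hat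
        refine Ex_congr fun x hx => ?_
        beta_reduce
        rw [← hsplit i hi x hx]
      rw [this]
      nlinarith [sq_nonneg (hat p X (h' i) S - hat p X (h'' i) S)]
    have hpq : p * (1 - p) ≤ p := by nlinarith
    have hpq0 : 0 ≤ p * (1 - p) := mul_nonneg h0.le (by linarith)
    calc p * (1 - p) * _ ≤ p * (1 - p) * (2 * (θ * Ex X p (h' i)) + 2 * Ex X p (h'' i) +
          1 / ((d : ℝ) + 2) * Ex X p (h i)) := mul_le_mul_of_nonneg_left (by linarith) hpq0
      _ ≤ p * (1 - p) * (2 * (θ * Ex X p (h i)) + 2 * Ex X p (h'' i) +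
          1 / ((d : ℝ) + 2) * Ex X p (h i)) := by
            refine mul_le_mul_of_nonneg_left ?_ hpq0
            have := mul_le_mul_of_nonneg_left hle hθ
            linarith
      _ ≤ p * (2 * (θ * Ex X p (h i)) + 2 * Ex X p (h'' i) +
          1 / ((d : ℝ) + 2) * Ex X p (h i)) := mul_le_mul_of_nonneg_right hpq (by positivity)
      _ = _ := by ring
  have s4 := sum_le_sum s3
  simp only [sum_add_distrib, ← mul_sum] at s4 hC hη
  have f1 : 1 / ((d : ℝ) + 2) * (p * ∑ i ∈ X, Ex X p (h i)) ≤ C / (d + 2) := by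
    rw [one_div_mul_eq_div]; gcongr
  have f2 : 2 * θ * (p * ∑ i ∈ X, Ex X p (h i)) ≤ 2 * θ * C :=
    mul_le_mul_of_nonneg_left hC (by positivity)
  linarith [s2 ▸ s1]

end Boost

section Containers
open Finset

variable {V ι : Type} [DecidableEq V] [DecidableEq ι]

/-- Number of edges (indexed by `J`) that contain `S`. -/
def edgeDeg (J : Finset ι) (E : ι → Finset V) (S : Finset V) : ℕ := #{e ∈ J | S ⊆ E e}

lemma edgeDeg_mono {J J' : Finset ι} (h : J' ⊆ J) (E : ι → Finset V) (S : Finset V) :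
    edgeDeg J' E S ≤ edgeDeg J E S :=
  card_le_card (filter_subset_filter _ h)

lemma sum_edgeDeg_singleton (J : Finset ι) (E : ι → Finset V) (G : Finset V)
    (hE : ∀ e ∈ J, E e ⊆ G) : ∑ v ∈ G, edgeDeg J E {v} = ∑ e ∈ J, #(E e) := by
  unfold edgeDeg
  simp only [card_eq_sum_ones, sum_filter, singleton_subset_iff]
  rw [sum_comm]
  refine sum_congr rfl fun e he => ?_
  rw [← sum_filter, filter_mem_eq_inter, inter_eq_right.2 (hE e he)]

/-- `T` carries a family `J'` of edges, each with a marked vertex in `T`, whose links satisfy the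
degree caps and which is large compared to `T`. -/
def Fingerprint (J : Finset ι) (E : ι → Finset V) (c τ M g : ℝ) (T : Finset V)
    (J' : Finset ι) (v : ι → V) : Prop :=
  J' ⊆ J ∧ (∀ e ∈ J', v e ∈ T ∧ v e ∈ E e) ∧
  (∀ S : Finset V, S.Nonempty →
    (edgeDeg J' (fun e => (E e).erase (v e)) S : ℝ) ≤ c * τ ^ #S * M) ∧
  g * #T ≤ #J'

lemma card_le_of_meets {J' J : Finset ι} {E : ι → Finset V} {T : Finset V} {D : ℝ}
    (hJ : J' ⊆ J) (h : ∀ e ∈ J', ∃ v ∈ T, v ∈ E e) (hD : ∀ v, (edgeDeg J E {v} : ℝ) ≤ D) :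
    (#J' : ℝ) ≤ #T * D := by
  have h1 : J' ⊆ T.biUnion fun v => {e ∈ J | {v} ⊆ E e} := by
    intro e he
    obtain ⟨v, hv, hve⟩ := h e he
    exact mem_biUnion.2 ⟨v, hv, mem_filter.2 ⟨hJ he, by simpa using hve⟩⟩
  have h2 : (#J' : ℝ) ≤ ∑ v ∈ T, (edgeDeg J E {v} : ℝ) := by
    exact_mod_cast (card_le_card h1).trans card_biUnion_le
  refine h2.trans ((sum_le_sum fun v _ => hD v).trans ?_)
  rw [sum_const, nsmul_eq_mul]

lemma card_blocked_le {J J' B : Finset ι} {E E' : ι → Finset V} {G : Finset V} {K c τ M : ℝ} {l : ℕ}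
    (hK : 0 < K) (hc : 0 < c) (hτ : 0 < τ)
    (hG : ∀ e ∈ J, E e ⊆ G)
    (hdeg : ∀ S : Finset V, S.Nonempty → (edgeDeg J E S : ℝ) ≤ K * τ ^ (#S - 1) * M)
    (hl : ∀ e ∈ J', #(E' e) ≤ l) (hB : B ⊆ J)
    (hBs : ∀ e ∈ B, ∃ S ⊆ E e, S.Nonempty ∧ c * τ ^ #S * M < edgeDeg J' E' S) :
    (#B : ℝ) * (c * τ) ≤ K * (2 ^ l * #J') := by
  classical
  set 𝒮 : Finset (Finset V) := {S ∈ G.powerset | S.Nonempty ∧ c * τ ^ #S * M < edgeDeg J' E' S}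
  have h1 : B ⊆ 𝒮.biUnion fun S => {e ∈ J | S ⊆ E e} := by
    intro e he
    obtain ⟨S, hS, hne, hsat⟩ := hBs e he
    refine mem_biUnion.2 ⟨S, mem_filter.2 ⟨mem_powerset.2 (hS.trans (hG e (hB he))), hne, hsat⟩,
      mem_filter.2 ⟨hB he, hS⟩⟩
  have h2 : (#B : ℝ) ≤ ∑ S ∈ 𝒮, (edgeDeg J E S : ℝ) := by
    exact_mod_cast (card_le_card h1).trans card_biUnion_le
  have h3 : ∑ S ∈ 𝒮, edgeDeg J' E' S ≤ ∑ e ∈ J', 2 ^ l := by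
    unfold edgeDeg
    simp only [card_eq_sum_ones, sum_filter]
    rw [sum_comm]
    refine sum_le_sum fun e he => ?_
    rw [← sum_filter, ← card_eq_sum_ones]
    calc _ ≤ #(E' e).powerset := card_le_card fun S hS => mem_powerset.2 (mem_filter.1 hS).2
      _ ≤ 2 ^ l := by rw [card_powerset]; exact Nat.pow_le_pow_right (by norm_num) (hl e he)
  calc (#B : ℝ) * (c * τ) ≤ (∑ S ∈ 𝒮, (edgeDeg J E S : ℝ)) * (c * τ) := by gcongr
    _ = ∑ S ∈ 𝒮, (edgeDeg J E S : ℝ) * (c * τ) := sum_mul _ _ _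
    _ ≤ ∑ S ∈ 𝒮, K * (edgeDeg J' E' S : ℝ) := by
        refine sum_le_sum fun S hS => ?_
        obtain ⟨hne, hsat⟩ := (mem_filter.1 hS).2
        have hp : τ ^ #S = τ ^ (#S - 1) * τ := by
          rw [← pow_succ, Nat.sub_add_cancel (card_pos.2 hne)]
        calc (edgeDeg J E S : ℝ) * (c * τ) ≤ K * τ ^ (#S - 1) * M * (c * τ) := by
              gcongr; exact hdeg S hne
          _ = K * (c * τ ^ #S * M) := by rw [hp]; ring
          _ ≤ _ := by gcongr
    _ ≤ K * (2 ^ l * #J') := by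
        rw [← mul_sum]
        gcongr
        have : ∑ S ∈ 𝒮, edgeDeg J' E' S ≤ 2 ^ l * #J' := by
          refine h3.trans (le_of_eq ?_)
          simp [mul_comm]
        exact_mod_cast this

/-- One round of the container algorithm. -/
theorem container_round (l : ℕ) : ∀ K α : ℝ, 0 < K → 0 < α → ∃ δ τ₀ : ℝ, 0 < δ ∧ 0 < τ₀ ∧
    ∀ (V ι : Type) [DecidableEq V] [DecidableEq ι] (J : Finset ι) (E : ι → Finset V) (G : Finset V)
      (n M τ : ℝ), 0 < n → 0 < M → 0 < τ → τ ≤ τ₀ → 1 ≤ τ * n → (#G : ℝ) ≤ n →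
      (∀ e ∈ J, E e ⊆ G ∧ #(E e) = l) →
      (∀ S : Finset V, S.Nonempty → (edgeDeg J E S : ℝ) ≤ K * τ ^ (#S - 1) * M) →
      α * M * n ≤ #J →
      ∃ rem : (Fin l → Finset V) → Finset V, ∀ I : Finset V, (∀ e ∈ J, ¬ E e ⊆ I) →
        ∃ T : Fin l → Finset V, (∀ j, T j ⊆ I ∧ (#(T j) : ℝ) ≤ τ * n) ∧
          Disjoint (rem T) I ∧ rem T ⊆ G ∧ δ * n ≤ #(rem T) := by
  induction l with
  | zero =>
    intro K α hK hα
    refine ⟨1, 1, one_pos, one_pos, ?_⟩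
    intro V ι _ _ J E G n M τ hn hM _ _ _ _ hE _ hJ
    refine ⟨fun _ => ∅, fun I hI => ?_⟩
    have : (0 : ℝ) < #J := lt_of_lt_of_le (by positivity) hJ
    obtain ⟨e, he⟩ := card_pos.1 (by exact_mod_cast this : 0 < #J)
    have h0 : E e = ∅ := card_eq_zero.1 (hE e he).2
    exact absurd (by simp [h0]) (hI e he)
  | succ l ih =>
    intro K α hK hα
    set c : ℝ := 4 * K ^ 2 * 2 ^ (l + 1) / α with hc
    have hc0 : 0 < c := by positivity
    obtain ⟨δ', τ', hδ', hτ', ih⟩ := ih (K + c) (α / 8) (by positivity) (by positivity)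
    refine ⟨min δ' (α / (4 * K)), min τ' (α / (4 * K)), lt_min hδ' (by positivity),
      lt_min hτ' (by positivity), ?_⟩
    intro V ι _ _ J E G n M τ hn hM hτ hττ hτn hGn hE hdeg hJ
    classical
    have hτ1 : τ ≤ τ' := hττ.trans (min_le_left _ _)
    have hτ2 : τ ≤ α / (4 * K) := hττ.trans (min_le_right _ _)
    set g : ℝ := α * M / 4 with hg
    have hg0 : 0 < g := by positivity
    set b : ℕ := ⌊τ * n⌋₊ with hb
    have hb1 : 1 ≤ b := Nat.le_floor (by simpa using hτn)
    have hbτ : (b : ℝ) ≤ τ * n := Nat.floor_le (by positivity)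
    have hb2 : τ * n / 2 ≤ b := by
      have h1 : τ * n < b + 1 := Nat.lt_floor_add_one _
      have h2 : (1 : ℝ) ≤ b := by exact_mod_cast hb1
      linarith
    set Good : Finset V → Prop := fun T => ∃ J' v, Fingerprint J E (K + c) τ M g T J' v with hGood
    set Sel : Finset V → Finset V → Prop := fun I T => T ⊆ I ∧ Good T ∧ #T ≤ b ∧
      ∀ T', T' ⊆ I → Good T' → #T' ≤ b → #T' ≤ #T with hSel
    have hsel : ∀ I : Finset V, ∃ T, Sel I T := by
      intro I
      have hne : ({T ∈ I.powerset | Good T ∧ #T ≤ b}).Nonempty := by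
        refine ⟨∅, mem_filter.2 ⟨empty_mem_powerset _, ?_, by simp⟩⟩
        by_cases hne : Nonempty V
        · obtain ⟨v0⟩ := hne
          refine ⟨∅, fun _ => v0, empty_subset _, by simp, fun S _ => ?_, by simp⟩
          simp [edgeDeg]; positivity
        · exfalso
          have hG0 : #G = 0 := by
            rw [card_eq_zero]; exact eq_empty_of_forall_notMem fun v => (hne ⟨v⟩).elim
          have : (0 : ℝ) < #J := lt_of_lt_of_le (by positivity) hJ
          obtain ⟨e, he⟩ := card_pos.1 (by exact_mod_cast this : 0 < #J)
          have := card_le_card (hE e he).1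
          have := (hE e he).2
          omega
      obtain ⟨T, hT, hmax⟩ := exists_max_image _ card hne
      simp only [mem_filter, mem_powerset] at hT hmax
      exact ⟨T, hT.1, hT.2.1, hT.2.2, fun T' a b c => hmax T' ⟨a, b, c⟩⟩
    have main : ∀ T₀ : Finset V, ∃ rem : (Fin l → Finset V) → Finset V, ∀ I : Finset V,
        (∀ e ∈ J, ¬ E e ⊆ I) → Sel I T₀ → ∃ T : Fin l → Finset V,
          (∀ j, T j ⊆ I ∧ (#(T j) : ℝ) ≤ τ * n) ∧
          Disjoint (rem T) I ∧ rem T ⊆ G ∧ min δ' (α / (4 * K)) * n ≤ #(rem T) := by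
      intro T₀
      by_cases hgood : Good T₀
      swap
      · exact ⟨fun _ => ∅, fun I _ hs => absurd hs.2.1 hgood⟩
      obtain ⟨J', v, hJ', hv, hcap, hsize⟩ := hgood
      by_cases hTb : #T₀ = b
      · obtain ⟨rem, hrem⟩ := ih V ι J' (fun e => (E e).erase (v e)) G n (τ * M) τ hn (by positivity)
          hτ hτ1 hτn hGn
          (fun e he => ⟨(erase_subset _ _).trans (hE e (hJ' he)).1, by
            rw [card_erase_of_mem (hv e he).2, (hE e (hJ' he)).2]; rfl⟩)
          (fun S hS => by
            refine (hcap S hS).trans (le_of_eq ?_)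
            have hp : τ ^ #S = τ ^ (#S - 1) * τ := by
              rw [← pow_succ, Nat.sub_add_cancel (card_pos.2 hS)]
            rw [hp]; ring)
          (by
            refine le_trans ?_ hsize
            rw [hTb, hg]
            calc α / 8 * (τ * M) * n = α * M / 4 * (τ * n / 2) := by ring
              _ ≤ _ := by gcongr)
        refine ⟨rem, fun I hI hs => ?_⟩
        obtain ⟨T, h1, h2, h3, h4⟩ := hrem I fun e he hsub => hI e (hJ' he) (by
          rw [← insert_erase (hv e he).2]
          exact insert_subset (hs.1 (hv e he).1) hsub)
        refine ⟨T, h1, h2, h3, le_trans ?_ h4⟩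
        gcongr
        exact min_le_left _ _
      · set E' : ι → Finset V := fun e => (E e).erase (v e) with hE'
        set A : Finset ι := {e ∈ J | Disjoint (E e) T₀ ∧
          ∀ S ⊆ E e, S.Nonempty → (edgeDeg J' E' S : ℝ) ≤ c * τ ^ #S * M} with hA
        set R : Finset V := {u ∈ G | g ≤ edgeDeg A E {u}} with hR
        refine ⟨fun _ => R, fun I hI hs => ?_⟩
        have hTlt : #T₀ < b := lt_of_le_of_ne hs.2.2.1 hTb
        refine ⟨fun _ => ∅, fun j => ⟨empty_subset _, by simp; positivity⟩, ?_, filter_subset _ _, ?_⟩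
        · rw [Finset.disjoint_left]
          intro u hu huI
          have hdu := (mem_filter.1 hu).2
          have huT : u ∉ T₀ := by
            intro huT
            have hpos : (0 : ℝ) < edgeDeg A E {u} := hg0.trans_le hdu
            obtain ⟨e, he⟩ := card_pos.1 (by exact_mod_cast hpos : 0 < edgeDeg A E {u})
            have he1 := mem_filter.1 he
            exact Finset.disjoint_left.1 (mem_filter.1 he1.1).2.1 (by simpa using he1.2) huT
          set Au : Finset ι := {e ∈ A | {u} ⊆ E e} with hAu
          have hAuJ : Au ⊆ J := (filter_subset _ _).trans (filter_subset _ _)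
          have hdisj : Disjoint J' Au := by
            rw [Finset.disjoint_left]
            intro e he heA
            have := (mem_filter.1 (mem_filter.1 heA).1).2.1
            exact Finset.disjoint_left.1 this (hv e he).2 (hv e he).1
          have hgoodu : Good (insert u T₀) := by
            refine ⟨J' ∪ Au, fun e => if e ∈ Au then u else v e, union_subset hJ' hAuJ, ?_, ?_, ?_⟩
            · intro e he
              by_cases heA : e ∈ Au
              · simp only [heA, if_true]
                exact ⟨mem_insert_self _ _, by simpa using (mem_filter.1 heA).2⟩
              · simp only [heA, if_false]
                have := hv e ((mem_union.1 he).resolve_right heA)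
                exact ⟨mem_insert_of_mem this.1, this.2⟩
            · intro S hS
              set v' : ι → V := fun e => if e ∈ Au then u else v e with hv'
              have hsplit : edgeDeg (J' ∪ Au) (fun e => (E e).erase (v' e)) S ≤
                  edgeDeg J' E' S + #{e ∈ Au | S ⊆ (E e).erase u} := by
                unfold edgeDeg
                rw [filter_union]
                refine (card_union_le _ _).trans (add_le_add ?_ ?_)
                · refine card_le_card fun e he => ?_
                  have := mem_filter.1 he
                  have hn : e ∉ Au := Finset.disjoint_left.1 hdisj this.1
                  simp only [hv', hn, if_false] at this
                  exact mem_filter.2 this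
                · refine card_le_card fun e he => ?_
                  have := mem_filter.1 he
                  have hn : e ∈ Au := this.1
                  simp only [hv', hn, if_true] at this
                  exact mem_filter.2 ⟨hn, this.2⟩
              by_cases hex : ({e ∈ Au | S ⊆ (E e).erase u}).Nonempty
              · obtain ⟨e, he⟩ := hex
                have he1 := mem_filter.1 he
                have heA := (mem_filter.1 (mem_filter.1 he1.1).1).2.2 S
                  (he1.2.trans (erase_subset _ _)) hS
                have huS : u ∉ S := fun h => notMem_erase u (E e) (he1.2 h)
                have hb' : #{e ∈ Au | S ⊆ (E e).erase u} ≤ edgeDeg J E (insert u S) := by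
                  refine card_le_card fun f hf => ?_
                  have hf1 := mem_filter.1 hf
                  have hf2 := mem_filter.1 hf1.1
                  exact mem_filter.2 ⟨hAuJ hf1.1, insert_subset (by simpa using hf2.2)
                    (hf1.2.trans (erase_subset _ _))⟩
                have hb2 := hdeg (insert u S) (insert_nonempty _ _)
                rw [card_insert_of_notMem huS, Nat.add_sub_cancel] at hb2
                calc (edgeDeg (J' ∪ Au) (fun e => (E e).erase (v' e)) S : ℝ)
                    ≤ edgeDeg J' E' S + (#{e ∈ Au | S ⊆ (E e).erase u} : ℝ) := by
                      exact_mod_cast hsplit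
                  _ ≤ c * τ ^ #S * M + K * τ ^ #S * M := by
                      refine add_le_add heA (le_trans ?_ hb2)
                      exact_mod_cast hb'
                  _ = _ := by ring
              · rw [not_nonempty_iff_eq_empty] at hex
                rw [hex, card_empty, add_zero] at hsplit
                exact le_trans (by exact_mod_cast hsplit) (hcap S hS)
            · rw [card_insert_of_notMem huT, card_union_of_disjoint hdisj]
              push_cast
              have : g ≤ #Au := hdu
              linarith
          have := hs.2.2.2 (insert u T₀) (insert_subset huI hs.1) hgoodu
            (by rw [card_insert_of_notMem huT]; omega)
          rw [card_insert_of_notMem huT] at this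
          omega
        · have hdeg1 : ∀ u, (edgeDeg J E {u} : ℝ) ≤ K * M := fun u => by
            simpa using hdeg {u} (singleton_nonempty u)
          have hTn : (#T₀ : ℝ) ≤ τ * n := le_trans (by exact_mod_cast hs.2.2.1) hbτ
          have hJ'card : (#J' : ℝ) ≤ τ * n * (K * M) :=
            (card_le_of_meets hJ' (fun e he => ⟨v e, hv e he⟩) hdeg1).trans (by gcongr)
          have hm : (#{e ∈ J | ¬ Disjoint (E e) T₀} : ℝ) ≤ τ * n * (K * M) := by
            refine (card_le_of_meets (filter_subset _ _) (fun e he => ?_) hdeg1).trans (by gcongr)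
            obtain ⟨x, hx1, hx2⟩ := not_disjoint_iff.1 (mem_filter.1 he).2
            exact ⟨x, hx2, hx1⟩
          have hτnK : τ * n * (K * M) ≤ α / 4 * (M * n) := by
            calc τ * n * (K * M) ≤ α / (4 * K) * n * (K * M) := by gcongr
              _ = _ := by field_simp
          set Bk : Finset ι := {e ∈ J | ∃ S ⊆ E e, S.Nonempty ∧ c * τ ^ #S * M < edgeDeg J' E' S}
            with hBk
          have hB := card_blocked_le (l := l + 1) (E' := E') hK hc0 hτ (fun e he => (hE e he).1) hdeg
            (J' := J') (B := Bk)
            (fun e he => (card_le_card (erase_subset _ _)).trans_eq (hE e (hJ' he)).2)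
            (filter_subset _ _) (fun e he => (mem_filter.1 he).2)
          have hB2 : (#Bk : ℝ) ≤ α / 4 * (M * n) := by
            have h1 : (#Bk : ℝ) * (c * τ) ≤ α / 4 * (M * n) * (c * τ) := by
              refine hB.trans ?_
              calc K * (2 ^ (l + 1) * #J') ≤ K * (2 ^ (l + 1) * (τ * n * (K * M))) := by gcongr
                _ = α / 4 * (M * n) * (c * τ) := by rw [hc]; field_simp
            exact le_of_mul_le_mul_right h1 (by positivity)
          have hcov : J ⊆ A ∪ ({e ∈ J | ¬ Disjoint (E e) T₀} ∪ Bk) := by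
            intro e he
            by_cases h1 : Disjoint (E e) T₀
            · by_cases h2 : ∃ S ⊆ E e, S.Nonempty ∧ c * τ ^ #S * M < edgeDeg J' E' S
              · exact mem_union_right _ (mem_union_right _ (mem_filter.2 ⟨he, h2⟩))
              · push Not at h2
                exact mem_union_left _ (mem_filter.2 ⟨he, h1, h2⟩)
            · exact mem_union_right _ (mem_union_left _ (mem_filter.2 ⟨he, h1⟩))
          have hAcard : α / 2 * (M * n) ≤ #A := by
            have h1 : (#J : ℝ) ≤ #A + (#{e ∈ J | ¬ Disjoint (E e) T₀} + #Bk) := by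
              exact_mod_cast (card_le_card hcov).trans ((card_union_le _ _).trans
                (Nat.add_le_add_left (card_union_le _ _) _))
            linarith
          have hsum := sum_edgeDeg_singleton A E G fun e he => (hE e (mem_filter.1 he).1).1
          have hA1 : (#A : ℝ) ≤ ∑ u ∈ G, (edgeDeg A E {u} : ℝ) := by
            have : #A ≤ ∑ u ∈ G, edgeDeg A E {u} := by
              rw [hsum, card_eq_sum_ones]
              refine sum_le_sum fun e he => ?_
              rw [(hE e (mem_filter.1 he).1).2]; omega
            exact_mod_cast this
          have hA2 : ∑ u ∈ G, (edgeDeg A E {u} : ℝ) ≤ #R * (K * M) + n * g := by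
            rw [← sum_filter_add_sum_filter_not G (fun u => g ≤ edgeDeg A E {u})]
            refine add_le_add ?_ ?_
            · refine (sum_le_sum fun u _ => ?_).trans (by rw [sum_const, nsmul_eq_mul])
              refine le_trans ?_ (hdeg1 u)
              exact_mod_cast edgeDeg_mono (filter_subset _ _) E {u}
            · calc _ ≤ ∑ u ∈ G with ¬ g ≤ edgeDeg A E {u}, g :=
                    sum_le_sum fun u hu => (not_le.1 (mem_filter.1 hu).2).le
                _ ≤ n * g := by
                    rw [sum_const, nsmul_eq_mul]
                    gcongr
                    refine le_trans ?_ hGn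
                    exact_mod_cast card_le_card (filter_subset _ _)
          have hfin : α / (4 * K) * n * (K * M) ≤ #R * (K * M) := by
            have e1 : α / (4 * K) * n * (K * M) = α / 4 * (M * n) := by field_simp
            have e2 : n * g = α / 4 * (M * n) := by rw [hg]; ring
            rw [e1]; rw [e2] at hA2; linarith
          have := le_of_mul_le_mul_right hfin (by positivity)
          refine le_trans ?_ this
          gcongr
          exact min_le_right _ _
    choose rem hrem using main
    refine ⟨fun T => rem (T 0) (fun j => T j.succ), fun I hI => ?_⟩
    obtain ⟨T₀, hT₀⟩ := hsel I
    obtain ⟨T, h1, h2⟩ := hrem T₀ I hI hT₀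
    refine ⟨Fin.cons T₀ T, fun j => ?_, by simpa using h2⟩
    refine Fin.cases ?_ (fun j => ?_) j
    · exact ⟨hT₀.1, le_trans (by exact_mod_cast hT₀.2.2.1) hbτ⟩
    · simpa using h1 j

/-- Hypergraph container theorem. -/
theorem exists_containers (l : ℕ) (hl : 1 ≤ l) (K η : ℝ) (hK : 0 < K) (hη : 0 < η) :
    ∃ (k : ℕ) (τ₀ : ℝ), 0 < τ₀ ∧
    ∀ (V ι : Type) [DecidableEq V] [DecidableEq ι] (J : Finset ι) (E : ι → Finset V) (G : Finset V)
      (n M τ : ℝ), 0 < n → 0 < M → 0 < τ → τ ≤ τ₀ → 1 ≤ τ * n → (#G : ℝ) ≤ n →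
      (∀ e ∈ J, E e ⊆ G ∧ #(E e) = l) →
      (∀ S : Finset V, S.Nonempty → (edgeDeg J E S : ℝ) ≤ K * τ ^ (#S - 1) * M) →
      ∃ cont : (Fin k → Finset V) → Finset V, ∀ I ⊆ G, (∀ e ∈ J, ¬ E e ⊆ I) →
        ∃ T : Fin k → Finset V, (∀ j, T j ⊆ I ∧ (#(T j) : ℝ) ≤ τ * n) ∧
          I ⊆ cont T ∧ (#{e ∈ J | E e ⊆ cont T} : ℝ) ≤ η * M * n := by
  obtain ⟨δ, τ₀, hδ, hτ₀, hround⟩ := container_round l K η hK hη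
  obtain ⟨m, hm⟩ := exists_nat_ge (1 / δ)
  refine ⟨l * m, τ₀, hτ₀, ?_⟩
  intro V ι _ _ J E G n M τ hn hM hτ hττ hτn hGn hE hdeg
  have key : ∀ m : ℕ, ∀ G' ⊆ G, (#G' : ℝ) ≤ m * (δ * n) →
      ∃ cont : (Fin (l * m) → Finset V) → Finset V, ∀ I ⊆ G', (∀ e ∈ J, ¬ E e ⊆ I) →
        ∃ T : Fin (l * m) → Finset V, (∀ j, T j ⊆ I ∧ (#(T j) : ℝ) ≤ τ * n) ∧
          I ⊆ cont T ∧ (#{e ∈ J | E e ⊆ cont T} : ℝ) ≤ η * M * n := by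
    intro m
    induction m with
    | zero =>
      intro G' _ hc
      have hG' : G' = ∅ := by
        rw [← card_eq_zero]
        have : (#G' : ℝ) ≤ 0 := by simpa using hc
        exact_mod_cast le_antisymm this (by positivity)
      refine ⟨fun _ => ∅, fun I hI _ => ⟨fun _ => ∅, fun j => ⟨empty_subset _, by simp; positivity⟩,
        hG' ▸ hI, ?_⟩⟩
      have : ({e ∈ J | E e ⊆ ∅} : Finset ι) = ∅ := by
        refine filter_eq_empty_iff.2 fun e he h => ?_
        have := (hE e he).2
        rw [subset_empty.1 h, card_empty] at this
        omega
      rw [this]; simp; positivity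
    | succ m ih =>
      intro G' hG' hc
      by_cases hsmall : (#{e ∈ J | E e ⊆ G'} : ℝ) ≤ η * M * n
      · exact ⟨fun _ => G', fun I hI _ => ⟨fun _ => ∅,
          fun j => ⟨empty_subset _, by simp; positivity⟩, hI, hsmall⟩⟩
      · obtain ⟨rem, hrem⟩ := hround V ι {e ∈ J | E e ⊆ G'} E G' n M τ hn hM hτ hττ hτn
          (le_trans (by exact_mod_cast card_le_card hG') hGn)
          (fun e he => ⟨(mem_filter.1 he).2, (hE e (mem_filter.1 he).1).2⟩)
          (fun S hS => le_trans (by exact_mod_cast edgeDeg_mono (filter_subset _ _) E S) (hdeg S hS))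
          (not_le.1 hsmall).le
        have hT : ∀ T₁ : Fin l → Finset V, ∃ cont : (Fin (l * m) → Finset V) → Finset V,
            (rem T₁ ⊆ G' ∧ δ * n ≤ #(rem T₁)) → ∀ I ⊆ G' \ rem T₁, (∀ e ∈ J, ¬ E e ⊆ I) →
            ∃ T : Fin (l * m) → Finset V, (∀ j, T j ⊆ I ∧ (#(T j) : ℝ) ≤ τ * n) ∧
              I ⊆ cont T ∧ (#{e ∈ J | E e ⊆ cont T} : ℝ) ≤ η * M * n := by
          intro T₁
          by_cases h : rem T₁ ⊆ G' ∧ δ * n ≤ #(rem T₁)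
          · obtain ⟨cont, hcont⟩ := ih (G' \ rem T₁) (sdiff_subset.trans hG') (by
              rw [cast_card_sdiff h.1]
              push_cast at hc
              linarith [h.2])
            exact ⟨cont, fun _ => hcont⟩
          · exact ⟨fun _ => ∅, fun h' => absurd h' h⟩
        choose cont hcont using hT
        refine ⟨fun T => cont (fun j => T (Fin.natAdd (l * m) j)) (fun j => T (Fin.castAdd l j)),
          fun I hI hind => ?_⟩
        obtain ⟨T₁, h1, h2, h3, h4⟩ := hrem I fun e he => hind e (mem_filter.1 he).1
        obtain ⟨T₂, g1, g2, g3⟩ := hcont T₁ ⟨h3, h4⟩ I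
          (subset_sdiff.2 ⟨hI, h2.symm⟩) hind
        refine ⟨Fin.append T₂ T₁, fun j => ?_, ?_, ?_⟩
        · refine Fin.addCases (fun i => ?_) (fun i => ?_) j
          · rw [Fin.append_left]; exact g1 i
          · rw [Fin.append_right]; exact h1 i
        · simpa using g2
        · simpa using g3
  refine key m G subset_rfl (hGn.trans ?_)
  rw [div_le_iff₀ hδ] at hm
  nlinarith

end Containers

section Roth
open Finset SimpleGraph TripartiteFromTriangles

variable {F : Type*} [Field F] [Fintype F] [DecidableEq F]

/-- Triangle indices encoding the dilates of `X`. -/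
def rothTriangles (X : Finset F) (b₁ b₃ : F) : Finset (F × F × F) :=
  (univ ×ˢ X).image fun z => (z.1 + b₃ * z.2, z.1, z.1 + b₁ * z.2)

lemma mem_rothTriangles {X : Finset F} {b₁ b₃ a b c : F} :
    (a, b, c) ∈ rothTriangles X b₁ b₃ ↔ ∃ x ∈ X, a = b + b₃ * x ∧ c = b + b₁ * x := by
  simp only [rothTriangles, mem_image, mem_product, mem_univ, true_and, Prod.exists, Prod.mk.injEq]
  constructor
  · rintro ⟨b', x, hx, h1, rfl, h3⟩
    exact ⟨x, hx, h1.symm, h3.symm⟩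
  · rintro ⟨x, hx, h1, h3⟩
    exact ⟨b, x, hx, h1.symm, rfl, h3.symm⟩

lemma explicitDisjoint_rothTriangles (X : Finset F) {b₁ b₂ b₃ : F} (h1 : b₁ ≠ 0) (h2 : b₂ ≠ 0)
    (h3 : b₃ ≠ 0) (h : b₁ + b₂ = b₃) : ExplicitDisjoint (rothTriangles X b₁ b₃) where
  inj₀ a b c a' := by
    rw [mem_rothTriangles, mem_rothTriangles]
    rintro ⟨x, -, rfl, rfl⟩ ⟨y, -, rfl, hy⟩
    have : x = y := mul_left_cancel₀ h1 (add_left_cancel hy)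
    rw [this]
  inj₁ a b c b' := by
    rw [mem_rothTriangles, mem_rothTriangles]
    rintro ⟨x, -, rfl, rfl⟩ ⟨y, -, hy, hy'⟩
    have : b₂ * x = b₂ * y := by
      subst h
      linear_combination hy - hy'
    have := mul_left_cancel₀ h2 this
    subst this
    exact add_right_cancel hy
  inj₂ a b c c' := by
    rw [mem_rothTriangles, mem_rothTriangles]
    rintro ⟨x, -, rfl, rfl⟩ ⟨y, -, hy, rfl⟩
    have : x = y := mul_left_cancel₀ h3 (add_left_cancel hy)
    rw [this]

/-- Supersaturation for a translation- and dilation-invariant equation in three variables. -/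
theorem exists_many_solutions (δ : ℝ) (hδ : 0 < δ) : ∃ ρ : ℝ, 0 < ρ ∧
    ∀ (F : Type) [Field F] [Fintype F] [DecidableEq F] (X : Finset F) (b₁ b₂ b₃ : F),
      b₁ ≠ 0 → b₂ ≠ 0 → b₃ ≠ 0 → b₁ + b₂ = b₃ → δ * Fintype.card F ≤ #X →
      ρ * (Fintype.card F : ℝ) ^ 2 ≤
        #{t ∈ X ×ˢ X ×ˢ X | b₁ * t.1 + b₂ * t.2.1 = b₃ * t.2.2} := by
  refine ⟨27 * triangleRemovalBound (δ / 9), ?_, ?_⟩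
  · exact mul_pos (by norm_num) (triangleRemovalBound_pos (by linarith))
  intro F _ _ _ X b₁ b₂ b₃ h1 h2 h3 h hX
  set n := Fintype.card F with hn
  have hnpos : (0 : ℝ) < n := by exact_mod_cast Fintype.card_pos
  have := explicitDisjoint_rothTriangles X h1 h2 h3 h
  have hcard : #(rothTriangles X b₁ b₃) = n * #X := by
    rw [rothTriangles, card_image_of_injective, card_product, card_univ]
    rintro ⟨b, x⟩ ⟨b', x'⟩ hxx
    simp only [Prod.mk.injEq] at hxx
    obtain ⟨e1, rfl, -⟩ := hxx
    have : x = x' := mul_left_cancel₀ h3 (add_left_cancel e1)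
    rw [this]
  have hfar : (graph (rothTriangles X b₁ b₃)).FarFromTriangleFree (δ / 9) := by
    apply farFromTriangleFree
    rw [hcard]
    push_cast
    rw [← hn]
    nlinarith [mul_le_mul_of_nonneg_left hX hnpos.le]
  have hcl := hfar.le_card_cliqueFinset
  set Q := {t ∈ X ×ˢ X ×ˢ X | b₁ * t.1 + b₂ * t.2.1 = b₃ * t.2.2} with hQ
  have hsub : (graph (rothTriangles X b₁ b₃)).cliqueFinset 3 ⊆
      ((univ : Finset F) ×ˢ Q).image
        fun z => toTriangle (z.1 + b₃ * z.2.2.2, z.1, z.1 + b₁ * z.2.1) := by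
    intro s hs
    rw [mem_cliqueFinset_iff, is3Clique_iff] at hs
    obtain ⟨x, y, z, hxy, hxz, hyz, rfl⟩ := hs
    obtain ⟨a, b, c, habc, hab, hac, hbc⟩ := graph_triple hxy hxz hyz
    obtain ⟨c', hc'⟩ := Graph.in₀₁_iff.1 hab
    obtain ⟨b', hb'⟩ := Graph.in₀₂_iff.1 hac
    obtain ⟨a', ha'⟩ := Graph.in₁₂_iff.1 hbc
    rw [mem_rothTriangles] at hc' hb' ha'
    obtain ⟨x3, hx3, e3, -⟩ := hc'
    obtain ⟨x2, hx2, e2, e2'⟩ := hb'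
    obtain ⟨x1, hx1, -, e1⟩ := ha'
    rw [mem_image]
    refine ⟨(b, x1, x2, x3), ?_, ?_⟩
    · simp only [hQ, mem_product, mem_univ, true_and, mem_filter]
      refine ⟨⟨hx1, hx2, hx3⟩, ?_⟩
      subst h
      linear_combination e2' - e1 - e2 + e3
    · rw [← habc, e3, e1]
      rfl
  have hle := (card_le_card hsub).trans card_image_le
  rw [card_product, card_univ, ← hn] at hle
  have hc3 : (Fintype.card (F ⊕ F ⊕ F) : ℝ) = 3 * n := by
    rw [Fintype.card_sum, Fintype.card_sum]
    push_cast
    ring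
  rw [hc3] at hcl
  have hle' : (#((graph (rothTriangles X b₁ b₃)).cliqueFinset 3) : ℝ) ≤ n * #Q := by
    exact_mod_cast hle
  have : n * (27 * triangleRemovalBound (δ / 9) * (n : ℝ) ^ 2) ≤ n * #Q := by
    calc _ = triangleRemovalBound (δ / 9) * (3 * (n : ℝ)) ^ 3 := by ring
      _ ≤ _ := hcl.trans hle'
  exact le_of_mul_le_mul_left this hnpos

end Roth

section Schur
open Finset

/-- Ramsey's theorem for triangles in many colours. -/
lemma exists_mono_triangle {κ : Type*} [DecidableEq κ] (k : ℕ) : ∃ R : ℕ, ∀ (s : Finset ℕ)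
    (K : Finset κ) (c : ℕ → ℕ → κ), #K ≤ k → R ≤ #s →
    (∀ i ∈ s, ∀ j ∈ s, i < j → c i j ∈ K) →
    ∃ i j l, i < j ∧ j < l ∧ i ∈ s ∧ j ∈ s ∧ l ∈ s ∧ c i j = c j l ∧ c i j = c i l := by
  induction k with
  | zero =>
    refine ⟨2, fun s K c hK hs hc => ?_⟩
    obtain ⟨i, hi, j, hj, hij⟩ := one_lt_card.1 hs
    rw [Nat.le_zero, card_eq_zero] at hK
    subst hK
    rcases lt_or_gt_of_ne hij with h | h
    · simpa using hc i hi j hj h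
    · simpa using hc j hj i hi h
  | succ k ih =>
    obtain ⟨R, hR⟩ := ih
    refine ⟨(k + 1) * R + 2, fun s K c hK hs hc => ?_⟩
    have hne : s.Nonempty := card_pos.1 (by omega)
    set v := s.min' hne with hv
    have hvs : v ∈ s := min'_mem s hne
    have hlt : ∀ j ∈ s.erase v, v < j := fun j hj =>
      lt_of_le_of_ne (min'_le s j (mem_of_mem_erase hj)) (ne_of_mem_erase hj).symm
    have hcard : #K * R < #(s.erase v) := by
      rw [card_erase_of_mem hvs]
      have : #K * R ≤ (k + 1) * R := Nat.mul_le_mul_right _ hK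
      omega
    obtain ⟨y, hy, hyR⟩ := exists_lt_card_fiber_of_mul_lt_card_of_maps_to
      (f := fun j => c v j)
      (fun j hj => hc v hvs j (mem_of_mem_erase hj) (hlt j hj)) hcard
    set s' := {j ∈ s.erase v | c v j = y} with hs'
    have hs's : ∀ j ∈ s', j ∈ s ∧ v < j ∧ c v j = y := fun j hj => by
      rw [hs', mem_filter] at hj
      exact ⟨mem_of_mem_erase hj.1, hlt j hj.1, hj.2⟩
    by_cases hex : ∃ i ∈ s', ∃ j ∈ s', i < j ∧ c i j = y
    · obtain ⟨i, hi, j, hj, hij, hc'⟩ := hex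
      refine ⟨v, i, j, (hs's i hi).2.1, hij, hvs, (hs's i hi).1, (hs's j hj).1, ?_, ?_⟩
      · rw [(hs's i hi).2.2, hc']
      · rw [(hs's i hi).2.2, (hs's j hj).2.2]
    · push Not at hex
      obtain ⟨i, j, l, hij, hjl, hi, hj, hl, h1, h2⟩ := hR s' (K.erase y) c
        (by rw [card_erase_of_mem hy]; omega) hyR.le
        (fun i hi j hj hij => mem_erase.2 ⟨hex i hi j hj hij,
          hc i (hs's i hi).1 j (hs's j hj).1 hij⟩)
      exact ⟨i, j, l, hij, hjl, (hs's i hi).1, (hs's j hj).1, (hs's l hl).1, h1, h2⟩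

/-- Schur's theorem with distinct summands. -/
theorem exists_schur_bound (r : ℕ) : ∃ S : ℕ, ∀ f : ℕ → Fin r,
    ∃ a b, 0 < a ∧ a < b ∧ a + b ≤ S ∧ f a = f b ∧ f a = f (a + b) := by
  obtain ⟨R, hR⟩ := exists_mono_triangle (κ := Fin r) r
  refine ⟨3 ^ R, fun f => ?_⟩
  obtain ⟨i, j, l, hij, hjl, -, -, hl, h1, h2⟩ := hR (range R) univ (fun i j => f (3 ^ j - 3 ^ i))
    (by simp) (by simp) (fun _ _ _ _ _ => mem_univ _)
  have e1 : 3 ^ i < 3 ^ j := Nat.pow_lt_pow_right (by norm_num) hij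
  have e2 : 3 ^ (j + 1) ≤ 3 ^ l := Nat.pow_le_pow_right (by norm_num) hjl
  have e3 : 3 ^ l ≤ 3 ^ R := Nat.pow_le_pow_right (by norm_num) (mem_range.1 hl).le
  have e4 : 0 < 3 ^ i := by positivity
  rw [pow_succ] at e2
  have e5 : 3 ^ j - 3 ^ i + (3 ^ l - 3 ^ j) = 3 ^ l - 3 ^ i := by omega
  refine ⟨3 ^ j - 3 ^ i, 3 ^ l - 3 ^ j, by omega, by omega, by omega, h1, ?_⟩
  rw [e5]
  exact h2

end Schur

section Supersaturation
open Finset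

/-- Three pairwise distinct elements, one of which is the sum of the other two. -/
def Tri {F : Type*} [Add F] (a b c : F) : Prop :=
  a ≠ b ∧ a ≠ c ∧ b ≠ c ∧ (a + b = c ∨ a + c = b ∨ b + c = a)

/-- The colouring `φ` has no monochromatic Schur triple inside `Y`. -/
def Proper {F κ : Type*} [Add F] (φ : F → κ) (Y : Finset F) : Prop :=
  ∀ a ∈ Y, ∀ b ∈ Y, ∀ c ∈ Y, Tri a b c → ¬(φ a = φ b ∧ φ b = φ c)

lemma Proper.mono {F κ : Type*} [Add F] {φ : F → κ} {Y Y' : Finset F} (h : Proper φ Y)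
    (hY : Y' ⊆ Y) : Proper φ Y' :=
  fun a ha b hb c hc => h a (hY ha) b (hY hb) c (hY hc)

lemma isSchur_iff {r N : ℕ} {Y : Finset (ZMod N)} :
    IsSchur r N Y ↔ ¬∃ φ : ZMod N → Fin r, Proper φ Y := by
  constructor
  · rintro h ⟨φ, hφ⟩
    obtain ⟨a, b, d, ha, hb, hd, h1, h2, h3, h4, h5, h6⟩ := h φ
    exact hφ a ha b hb d hd ⟨h1, h2, h3, Or.inl h4⟩ ⟨h5, h6⟩
  · intro h φ
    by_contra hc
    refine h ⟨φ, ?_⟩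
    rintro a ha b hb c hc' ⟨h1, h2, h3, h4 | h4 | h4⟩ ⟨h5, h6⟩
    · exact hc ⟨a, b, c, ha, hb, hc', h1, h2, h3, h4, h5, h6⟩
    · exact hc ⟨a, c, b, ha, hc', hb, h2, h1, h3.symm, h4, h5.trans h6, h6.symm⟩
    · exact hc ⟨b, c, a, hb, hc', ha, h3, h1.symm, h2.symm, h4, h6, (h5.trans h6).symm⟩

lemma IsSchur.mono {r N : ℕ} {Y Y' : Finset (ZMod N)} (h : IsSchur r N Y) (hY : Y ⊆ Y') :
    IsSchur r N Y' := by
  rw [isSchur_iff] at *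
  exact fun ⟨φ, hφ⟩ => h ⟨φ, hφ.mono hY⟩

variable {F : Type*} [Field F] [Fintype F] [DecidableEq F]

/-- Pairs of summands generating nondegenerate Schur triples. -/
def schurPairs (F : Type*) [Field F] [Fintype F] [DecidableEq F] : Finset (F × F) :=
  {z | z.1 ≠ z.2 ∧ z.1 ≠ 0 ∧ z.2 ≠ 0}

/-- The Schur triple generated by a pair of summands. -/
def schurEdge (z : F × F) : Finset F := {z.1, z.2, z.1 + z.2}

lemma card_schurEdge {z : F × F} (hz : z ∈ schurPairs F) : #(schurEdge z) = 3 := by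
  simp only [schurPairs, mem_filter, mem_univ, true_and] at hz
  rw [schurEdge, card_eq_three]
  exact ⟨_, _, _, hz.1, by simpa using hz.2.2, by simpa using hz.2.1, rfl⟩

lemma not_schurEdge_subset {κ : Type*} [DecidableEq κ] {φ : F → κ} {Y : Finset F} (h : Proper φ Y)
    (i : κ) {z : F × F} (hz : z ∈ schurPairs F) : ¬schurEdge z ⊆ {y ∈ Y | φ y = i} := by
  simp only [schurPairs, mem_filter, mem_univ, true_and] at hz
  intro hs
  have h1 := hs (show z.1 ∈ schurEdge z by simp [schurEdge])
  have h2 := hs (show z.2 ∈ schurEdge z by simp [schurEdge])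
  have h3 := hs (show z.1 + z.2 ∈ schurEdge z by simp [schurEdge])
  rw [mem_filter] at h1 h2 h3
  exact h _ h1.1 _ h2.1 _ h3.1 ⟨hz.1, by simpa using hz.2.2, by simpa using hz.2.1, Or.inl rfl⟩
    ⟨h1.2.trans h2.2.symm, h2.2.trans h3.2.symm⟩

lemma card_filter_le_of_injOn {α β : Type*} [DecidableEq β] (s : Finset α) (P : α → Prop)
    [DecidablePred P] (f : α → β) (t : Finset β) (hf : ∀ a ∈ s, P a → f a ∈ t)
    (hinj : ∀ a ∈ s, P a → ∀ b ∈ s, P b → f a = f b → a = b) : #{a ∈ s | P a} ≤ #t := by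
  refine card_le_card_of_injOn f (fun a ha => ?_) (fun a ha b hb h => ?_)
  · rw [mem_coe, mem_filter] at ha
    exact hf a ha.1 ha.2
  · rw [mem_coe, mem_filter] at ha hb
    exact hinj a ha.1 ha.2 b hb.1 hb.2 h

/-- A family of `r` sets covering almost all of the field contains many Schur triples. -/
theorem exists_many_mono_schurEdges (r : ℕ) : ∃ η γ : ℝ, 0 < η ∧ 0 < γ ∧ ∃ N₀ : ℕ,
    ∀ (N : ℕ) [Fact N.Prime], N₀ ≤ N → ∀ C : Fin r → Finset (ZMod N),
      (#(univ \ univ.biUnion C) : ℝ) < γ * N →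
      ∃ i, η * N * N < #{z ∈ schurPairs (ZMod N) | schurEdge z ⊆ C i} := by
  obtain ⟨S, hS⟩ := exists_schur_bound r
  obtain ⟨ρ, hρ, hroth⟩ := exists_many_solutions (1 / (2 * ((S + 1) ^ 2 * (r + 1)))) (by positivity)
  obtain ⟨N₁, hN₁⟩ := exists_nat_gt (6 / ρ)
  refine ⟨ρ / 2, 1 / (2 * (S + 1)), by positivity, by positivity, max (S + 1) N₁, ?_⟩
  intro N _ hN C hC
  have hNS : S < N := (le_max_left _ _).trans hN
  have hNρ : 6 < ρ * N := by
    rw [div_lt_iff₀' hρ] at hN₁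
    have : (N₁ : ℝ) ≤ N := by exact_mod_cast (le_max_right _ _).trans hN
    nlinarith
  have hNpos : (0 : ℝ) < N := by exact_mod_cast (show 0 < N by omega)
  have hcast : ∀ j : ℕ, 0 < j → j ≤ S → (j : ZMod N) ≠ 0 := fun j hj hjS h => by
    rw [ZMod.natCast_eq_zero_iff] at h
    exact absurd (Nat.le_of_dvd hj h) (by omega)
  set D := univ \ univ.biUnion C with hD
  set Bad := (Icc 1 S).biUnion fun j : ℕ => {x : ZMod N | x * j ∈ D} with hBad
  have hbadj : ∀ j ∈ Icc 1 S, #{x : ZMod N | x * (j : ZMod N) ∈ D} ≤ #D := fun j hj => by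
    rw [mem_Icc] at hj
    refine card_filter_le_of_injOn _ _ (fun x => x * (j : ZMod N)) D (fun _ _ h => h) ?_
    intro a _ _ b _ _ h
    exact mul_right_cancel₀ (hcast j hj.1 hj.2) h
  have hBadc : (#Bad : ℝ) ≤ N / 2 := by
    have h1 : #Bad ≤ S * #D := by
      refine (card_biUnion_le_card_mul _ _ _ hbadj).trans ?_
      simp
    have h2 : (#Bad : ℝ) ≤ S * #D := by exact_mod_cast h1
    have h3 : (S : ℝ) * #D ≤ S * (1 / (2 * (S + 1)) * N) :=
      mul_le_mul_of_nonneg_left hC.le (by positivity)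
    have h4 : (S : ℝ) * (1 / (2 * (S + 1)) * N) ≤ N / 2 := by
      rw [show (S : ℝ) * (1 / (2 * (S + 1)) * N) = (S / (S + 1)) * (N / 2) by field_simp]
      refine mul_le_of_le_one_left (by positivity) ?_
      rw [div_le_one (by positivity)]
      linarith
    linarith
  set X := univ \ Bad with hX
  have hXc : (N : ℝ) / 2 ≤ #X := by
    rw [hX, card_sdiff_of_subset (subset_univ _), card_univ, ZMod.card, Nat.cast_sub]
    · linarith
    · simpa [ZMod.card] using card_le_univ Bad
  have hXmem : ∀ x ∈ X, ∃ t : ℕ × ℕ × Fin r, t ∈ range (S + 1) ×ˢ range (S + 1) ×ˢ univ ∧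
      0 < t.1 ∧ t.1 < t.2.1 ∧ t.1 + t.2.1 ≤ S ∧ x * t.1 ∈ C t.2.2 ∧ x * t.2.1 ∈ C t.2.2 ∧
      x * (t.1 + t.2.1 : ℕ) ∈ C t.2.2 := by
    intro x hx
    have hx' : ∀ j : ℕ, 1 ≤ j → j ≤ S → ∃ i, x * (j : ZMod N) ∈ C i := by
      intro j hj1 hj2
      rw [hX, Finset.mem_sdiff] at hx
      by_contra hcon
      push Not at hcon
      refine hx.2 (mem_biUnion.2 ⟨j, mem_Icc.2 ⟨hj1, hj2⟩, ?_⟩)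
      simp [hD, hcon]
    by_cases hS1 : 1 ≤ S
    · obtain ⟨i0, -⟩ := hx' 1 le_rfl hS1
      have : ∀ j : ℕ, ∃ i, 1 ≤ j → j ≤ S → x * (j : ZMod N) ∈ C i := fun j => by
        by_cases h : 1 ≤ j ∧ j ≤ S
        · obtain ⟨i, hi⟩ := hx' j h.1 h.2
          exact ⟨i, fun _ _ => hi⟩
        · exact ⟨i0, fun h1 h2 => absurd ⟨h1, h2⟩ h⟩
      choose f hf using this
      obtain ⟨a, b, ha, hab, habS, h1, h2⟩ := hS f
      refine ⟨(a, b, f a), ?_, ha, hab, habS, hf a (by omega) (by omega), ?_, ?_⟩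
      · simp only [mem_product, mem_range, mem_univ, and_true]
        omega
      · rw [h1]
        exact hf b (by omega) (by omega)
      · rw [h2]
        exact hf (a + b) (by omega) (by omega)
    · exfalso
      by_cases hr : Nonempty (Fin r)
      · obtain ⟨a, b, ha, hab, habS, -⟩ := hS fun _ => hr.some
        omega
      · have hem : univ.biUnion C = ∅ := by
          ext y
          simp only [mem_biUnion, mem_univ, true_and, notMem_empty, iff_false]
          rintro ⟨i, -⟩
          exact hr ⟨i⟩
        rw [hD, hem, sdiff_empty, card_univ, ZMod.card] at hC
        have h0 : S = 0 := by omega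
        rw [h0] at hC
        norm_num at hC
        linarith
  have hXne : X.Nonempty := by
    rw [← card_pos]
    have : (0 : ℝ) < #X := by linarith [half_pos hNpos]
    exact_mod_cast this
  have : Nonempty (ℕ × ℕ × Fin r) := ⟨(hXmem _ hXne.choose_spec).choose⟩
  choose! t ht using hXmem
  obtain ⟨y, -, hy⟩ := exists_le_card_fiber_of_nsmul_le_card_of_maps_to
    (s := X) (t := range (S + 1) ×ˢ range (S + 1) ×ˢ univ) (f := t)
    (b := (1 / (2 * ((S + 1) ^ 2 * (r + 1))) : ℝ) * N) (fun x hx => (ht x hx).1)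
    ⟨_, (ht _ hXne.choose_spec).1⟩ (by
      rw [card_product, card_product, card_range, card_univ, Fintype.card_fin, nsmul_eq_mul]
      push_cast
      refine le_trans ?_ hXc
      rw [show ((S : ℝ) + 1) * ((S + 1) * r) * (1 / (2 * ((S + 1) ^ 2 * (r + 1))) * N) =
        (r / (r + 1)) * (N / 2) by field_simp]
      refine mul_le_of_le_one_left (by positivity) ?_
      rw [div_le_one (by positivity)]
      linarith)
  set X' := {x ∈ X | t x = y} with hX'
  have hX'p : ∀ x ∈ X', 0 < y.1 ∧ y.1 < y.2.1 ∧ y.1 + y.2.1 ≤ S ∧ x * y.1 ∈ C y.2.2 ∧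
      x * y.2.1 ∈ C y.2.2 ∧ x * (y.1 + y.2.1 : ℕ) ∈ C y.2.2 := fun x hx => by
    rw [hX', mem_filter] at hx
    have := (ht x hx.1).2
    rwa [hx.2] at this
  have hX'ne : X'.Nonempty := by
    rw [← card_pos]
    have : (0 : ℝ) < #X' := lt_of_lt_of_le (by positivity) hy
    exact_mod_cast this
  obtain ⟨a, b, i⟩ := y
  obtain ⟨x₀, hx₀⟩ := hX'ne
  obtain ⟨ha, hab, habS, -⟩ := hX'p x₀ hx₀
  dsimp only at ha hab habS hX'p
  have ha0 := hcast a ha (by omega)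
  have hb0 := hcast b (by omega) (by omega)
  have hab0 := hcast (a + b) (by omega) habS
  have hsol := hroth (ZMod N) X' a b (a + b : ℕ) ha0 hb0 hab0 (by push_cast; rfl)
    (by rw [ZMod.card]; exact hy)
  rw [ZMod.card] at hsol
  set Q := {t ∈ X' ×ˢ X' ×ˢ X' | (a : ZMod N) * t.1 + b * t.2.1 = (a + b : ℕ) * t.2.2} with hQ
  refine ⟨i, ?_⟩
  set G := {z ∈ schurPairs (ZMod N) | schurEdge z ⊆ C i} with hG
  set U : Finset (ZMod N × ZMod N) := G ∪ (univ.image (fun z => (z, z)) ∪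
    (univ.image (fun z => (0, z)) ∪ univ.image (fun z => (z, 0)))) with hU
  have hQU : #Q ≤ #U := by
    refine card_filter_le_of_injOn _ _ (fun t => ((a : ZMod N) * t.1, (b : ZMod N) * t.2.1)) U ?_ ?_
    · rintro ⟨x1, x2, x3⟩ hx hsol
      simp only [mem_product] at hx
      dsimp only at hsol
      have c1 := (hX'p x1 hx.1).2.2.2.1
      have c2 := (hX'p x2 hx.2.1).2.2.2.2.1
      have c3 := (hX'p x3 hx.2.2).2.2.2.2.2
      rw [mul_comm] at c1 c2 c3
      by_cases hz : ((a : ZMod N) * x1, (b : ZMod N) * x2) ∈ schurPairs (ZMod N)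
      · refine mem_union_left _ (mem_filter.2 ⟨hz, ?_⟩)
        intro w hw
        simp only [schurEdge, mem_insert, mem_singleton] at hw
        rcases hw with rfl | rfl | rfl
        · exact c1
        · exact c2
        · rw [hsol]
          exact c3
      · refine mem_union_right _ ?_
        simp only [schurPairs, mem_filter, mem_univ, true_and, not_and_or, not_not] at hz
        simp only [mem_union, mem_image, mem_univ, true_and, Prod.mk.injEq]
        rcases hz with h | h | h
        · exact Or.inl ⟨_, rfl, h⟩
        · exact Or.inr (Or.inl ⟨_, h.symm, rfl⟩)
        · exact Or.inr (Or.inr ⟨_, rfl, h.symm⟩)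
    · rintro ⟨x1, x2, x3⟩ - h1 ⟨y1, y2, y3⟩ - h2 h
      simp only [Prod.mk.injEq] at h
      dsimp only at h1 h2
      have e1 := mul_left_cancel₀ ha0 h.1
      have e2 := mul_left_cancel₀ hb0 h.2
      have e3 : x3 = y3 := by
        apply mul_left_cancel₀ hab0
        rw [← h1, ← h2, h.1, h.2]
      rw [e1, e2, e3]
  have hUc : #U ≤ #G + 3 * N := by
    have himg : ∀ f : ZMod N → ZMod N × ZMod N, #(univ.image f) ≤ N := fun f =>
      card_image_le.trans (by rw [card_univ, ZMod.card])
    have e1 := himg fun z => (z, z)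
    have e2 := himg fun z => (0, z)
    have e3 := himg fun z => (z, 0)
    have e4 : #U ≤ #G + #(univ.image (fun z : ZMod N => (z, z)) ∪
      (univ.image (fun z => (0, z)) ∪ univ.image (fun z => (z, 0)))) := card_union_le _ _
    have e5 := card_union_le (univ.image (fun z : ZMod N => (z, z)))
      (univ.image (fun z => (0, z)) ∪ univ.image (fun z => (z, 0)))
    have e6 := card_union_le (univ.image (fun z : ZMod N => ((0 : ZMod N), z)))
      (univ.image (fun z => (z, 0)))
    omega
  have hfin : (#Q : ℝ) ≤ #G + 3 * N := by exact_mod_cast hQU.trans hUc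
  nlinarith

end Supersaturation

section OneStatement
open Finset

lemma inv_pow_mul_exp_mul_pow_le {l p x : ℝ} (hl : 0 < l) (h1 : p ≤ 1) (t m : ℕ) :
    (l⁻¹) ^ t * Real.exp x * (1 - p) ^ m ≤ Real.exp (t * Real.log l⁻¹ + x - p * m) := by
  have e1 : (l⁻¹) ^ t = Real.exp (t * Real.log l⁻¹) := by
    rw [← Real.log_pow, Real.exp_log (by positivity)]
  have e2 : (1 - p) ^ m ≤ Real.exp (-(p * m)) := by
    have h : (1 - p) ≤ Real.exp (-p) := by linarith [Real.add_one_le_exp (-p)]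
    refine (pow_le_pow_left₀ (by linarith) h m).trans_eq ?_
    rw [← Real.exp_nat_mul]
    ring_nf
  rw [sub_eq_add_neg (_ + x), Real.exp_add, Real.exp_add, e1]
  exact mul_le_mul_of_nonneg_left e2 (by positivity)

variable {F : Type} [Field F] [Fintype F] [DecidableEq F]

lemma edgeDeg_schur_singleton_le (v : F) :
    edgeDeg (schurPairs F) schurEdge {v} ≤ 3 * Fintype.card F := by
  have himg : ∀ f : F → F × F, #(univ.image f) ≤ Fintype.card F := fun f =>
    card_image_le.trans (by rw [card_univ])
  have e1 := himg fun z => (v, z)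
  have e2 := himg fun z => (z, v)
  have e3 := himg fun z => (z, v - z)
  have hsub : {e ∈ schurPairs F | {v} ⊆ schurEdge e} ⊆ univ.image (fun z => (v, z)) ∪
      (univ.image (fun z => (z, v)) ∪ univ.image (fun z => (z, v - z))) := by
    rintro ⟨a, b⟩ hz
    simp only [mem_filter, schurEdge, singleton_subset_iff, mem_insert, mem_singleton] at hz
    simp only [mem_union, mem_image, mem_univ, true_and, Prod.mk.injEq]
    rcases hz.2 with rfl | rfl | rfl
    · exact Or.inl ⟨b, rfl, rfl⟩
    · exact Or.inr (Or.inl ⟨a, rfl, rfl⟩)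
    · exact Or.inr (Or.inr ⟨a, rfl, by ring⟩)
  have e4 := (card_le_card hsub).trans (card_union_le _ _)
  have e5 := card_union_le (univ.image (fun z : F => (z, v))) (univ.image (fun z => (z, v - z)))
  unfold edgeDeg
  omega

lemma edgeDeg_schur_le {S : Finset F} {u v : F} (hu : u ∈ S) (hv : v ∈ S) (huv : u ≠ v) :
    edgeDeg (schurPairs F) schurEdge S ≤ 6 := by
  have hsub : {e ∈ schurPairs F | S ⊆ schurEdge e} ⊆
      {(u, v), (v, u), (u, v - u), (v, u - v), (v - u, u), (u - v, v)} := by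
    rintro ⟨a, b⟩ hz
    simp only [mem_filter] at hz
    have h1 := hz.2 hu
    have h2 := hz.2 hv
    simp only [schurEdge, mem_insert, mem_singleton] at h1 h2
    simp only [mem_insert, mem_singleton, Prod.mk.injEq]
    rcases h1 with rfl | rfl | rfl <;> rcases h2 with rfl | rfl | rfl <;> simp at huv ⊢
  exact (card_le_card hsub).trans card_le_six

lemma edgeDeg_schur_le_pow (τ : ℝ) (hτ : 0 ≤ τ) (hτ1 : τ ≤ 1) (hτN : τ ^ 2 * Fintype.card F = 1)
    (S : Finset F) (hS : S.Nonempty) :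
    (edgeDeg (schurPairs F) schurEdge S : ℝ) ≤ 6 * τ ^ (#S - 1) * Fintype.card F := by
  have hpos : (0 : ℝ) ≤ Fintype.card F := by positivity
  by_cases h0 : edgeDeg (schurPairs F) schurEdge S = 0
  · rw [h0, Nat.cast_zero]
    positivity
  obtain ⟨z, hz⟩ := card_pos.1 (Nat.pos_of_ne_zero h0)
  rw [mem_filter] at hz
  have hS3 := card_le_card hz.2
  rw [card_schurEdge hz.1] at hS3
  have hS1 := hS.card_pos
  by_cases hS2 : #S = 1
  · obtain ⟨v, rfl⟩ := card_eq_one.1 hS2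
    have : (edgeDeg (schurPairs F) schurEdge {v} : ℝ) ≤ 3 * Fintype.card F := by
      exact_mod_cast edgeDeg_schur_singleton_le v
    rw [card_singleton]
    norm_num
    linarith
  · obtain ⟨u, hu, v, hv, huv⟩ := one_lt_card.1 (show 1 < #S by omega)
    have h6 : (edgeDeg (schurPairs F) schurEdge S : ℝ) ≤ 6 := by
      exact_mod_cast edgeDeg_schur_le hu hv huv
    have : τ ^ 2 ≤ τ ^ (#S - 1) := pow_le_pow_of_le_one hτ hτ1 (by omega)
    nlinarith [mul_le_mul_of_nonneg_right this hpos]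

/-- The number of codes with a prescribed union, weighted by the probability of that union. -/
lemma sum_codes_le {α ι : Type*} [DecidableEq α] [Fintype α] [Fintype ι] [DecidableEq ι] {p : ℝ}
    (h0 : 0 ≤ p) (t : ℕ) (𝒯 : Finset (ι → Finset α)) (h𝒯 : ∀ c ∈ 𝒯, #(univ.biUnion c) ≤ t) :
    ∑ c ∈ 𝒯, p ^ #(univ.biUnion c) ≤
      ∑ T ∈ (univ : Finset α).powerset with #T ≤ t, (2 ^ Fintype.card ι * p) ^ #T := by
  rw [← sum_fiberwise_of_maps_to (s := 𝒯) (g := fun c => univ.biUnion c)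
    (t := {T ∈ (univ : Finset α).powerset | #T ≤ t})
    (fun c hc => mem_filter.2 ⟨mem_powerset.2 (subset_univ _), h𝒯 c hc⟩)]
  refine sum_le_sum fun T _ => ?_
  have hcount : #{c ∈ 𝒯 | univ.biUnion c = T} ≤ (2 ^ Fintype.card ι) ^ #T := by
    calc _ ≤ #(Fintype.piFinset fun _ : ι => T.powerset) := by
          refine card_le_card fun c hc => ?_
          rw [mem_filter] at hc
          rw [Fintype.mem_piFinset]
          intro i
          rw [mem_powerset, ← hc.2]
          exact subset_biUnion_of_mem c (mem_univ i)
      _ = _ := by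
          rw [Fintype.card_piFinset, prod_const, card_powerset, card_univ, ← pow_mul, ← pow_mul,
            mul_comm]
  calc ∑ c ∈ 𝒯 with univ.biUnion c = T, p ^ #(univ.biUnion c)
      = ∑ c ∈ 𝒯 with univ.biUnion c = T, p ^ #T :=
        sum_congr rfl fun c hc => by rw [(mem_filter.1 hc).2]
    _ = #{c ∈ 𝒯 | univ.biUnion c = T} * p ^ #T := by rw [sum_const, nsmul_eq_mul]
    _ ≤ ((2 ^ Fintype.card ι) ^ #T) * p ^ #T :=
        mul_le_mul_of_nonneg_right (by exact_mod_cast hcount) (by positivity)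
    _ = _ := by rw [mul_pow]

theorem exists_upper_density (r : ℕ) : ∃ c₁ : ℝ, 0 < c₁ ∧ ∃ N₀ : ℕ, ∀ (N : ℕ) [Fact N.Prime],
    N₀ ≤ N → c₁ / √N ≤ 1 ∧ 3 / 4 ≤ Pr (univ : Finset (ZMod N)) (c₁ / √N) (IsSchur r N) := by
  obtain ⟨η, γ, hη, hγ, N₁, hsup⟩ := exists_many_mono_schurEdges r
  obtain ⟨k, τ₀, hτ₀, hcont⟩ := exists_containers 3 (by norm_num) 6 η (by norm_num) hη
  set l : ℝ := min 1 (γ / (2 * 2 ^ (r * k))) with hl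
  have hl0 : 0 < l := lt_min one_pos (by positivity)
  have hl1 : l ≤ 1 := min_le_left _ _
  have hl2 : l * 2 ^ (r * k) ≤ γ / 2 := by
    calc l * 2 ^ (r * k) ≤ γ / (2 * 2 ^ (r * k)) * 2 ^ (r * k) :=
          mul_le_mul_of_nonneg_right (min_le_right _ _) (by positivity)
      _ = _ := by field_simp
  have hlog : 0 ≤ Real.log l⁻¹ := Real.log_nonneg ((one_le_inv₀ hl0).2 hl1)
  set c₁ := 2 * (r * k * Real.log l⁻¹ + 2) / γ with hc₁
  have hc₁0 : 0 < c₁ := by positivity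
  have hc₁γ : c₁ * γ = 2 * (r * k * Real.log l⁻¹ + 2) := by
    rw [hc₁]
    field_simp
  obtain ⟨N₂, hN₂⟩ := exists_nat_gt (max (max (c₁ ^ 2) ((1 / τ₀) ^ 2)) 1)
  refine ⟨c₁, hc₁0, max N₁ N₂, ?_⟩
  intro N _ hN
  have hNN₁ : N₁ ≤ N := (le_max_left _ _).trans hN
  have hNN₂ : (N₂ : ℝ) ≤ N := by exact_mod_cast (le_max_right _ _).trans hN
  have hNa : c₁ ^ 2 < N := lt_of_le_of_lt ((le_max_left _ _).trans (le_max_left _ _)) (hN₂.trans_le hNN₂)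
  have hNb : (1 / τ₀) ^ 2 < N := lt_of_le_of_lt ((le_max_right _ _).trans (le_max_left _ _)) (hN₂.trans_le hNN₂)
  have hNc : 1 < (N : ℝ) := lt_of_le_of_lt (le_max_right _ _) (hN₂.trans_le hNN₂)
  have hNpos : (0 : ℝ) < N := by linarith
  set s := √(N : ℝ) with hs
  have hs0 : 0 < s := Real.sqrt_pos.2 hNpos
  have hss : s * s = N := Real.mul_self_sqrt hNpos.le
  have hs1 : 1 ≤ s := Real.one_le_sqrt.2 hNc.le
  have hsc : c₁ ≤ s := Real.le_sqrt_of_sq_le hNa.le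
  have hsτ : 1 / τ₀ ≤ s := Real.le_sqrt_of_sq_le hNb.le
  set p := c₁ / s with hp
  have hp0 : 0 ≤ p := by positivity
  have hp1 : p ≤ 1 := (div_le_one hs0).2 hsc
  refine ⟨hp1, ?_⟩
  obtain ⟨cont, hcont⟩ := hcont (ZMod N) (ZMod N × ZMod N) (schurPairs (ZMod N)) schurEdge univ
    N N (1 / s) hNpos hNpos (by positivity) (by rw [div_le_iff₀ hs0]; rwa [div_le_iff₀' hτ₀] at hsτ)
    (by rw [← hss]; field_simp; exact hs1) (by simp [ZMod.card])
    (fun e he => ⟨subset_univ _, card_schurEdge he⟩)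
    (fun S hS => by
      have := edgeDeg_schur_le_pow (F := ZMod N) (1 / s) (by positivity)
        ((div_le_one hs0).2 hs1) (by rw [ZMod.card, ← hss]; field_simp) S hS
      rwa [ZMod.card] at this)
  set Cov : (Fin r × Fin k → Finset (ZMod N)) → Finset (ZMod N) :=
    fun c => univ.biUnion fun i => cont fun j => c (i, j) with hCov
  set t := ⌊(r * k : ℝ) * s⌋₊ with ht
  set m := ⌈γ * N⌉₊ with hm
  set 𝒯 : Finset (Fin r × Fin k → Finset (ZMod N)) :=
    {c | #(univ.biUnion c) ≤ t ∧ univ.biUnion c ⊆ Cov c ∧ m ≤ #(univ \ Cov c)} with h𝒯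
  have hbound : Pr univ p (fun Z : Finset (ZMod N) => ¬ IsSchur r N Z) ≤
      (∑ c ∈ 𝒯, p ^ #(univ.biUnion c)) * (1 - p) ^ m := by
    refine Pr_fingerprint_le hp0 hp1 𝒯 (fun c => univ.biUnion c) (fun _ _ => subset_univ _)
      (fun c => univ \ Cov c) ?_ m ?_ ?_
    · intro c hc
      simp only [h𝒯, mem_filter, mem_univ, true_and] at hc
      exact ⟨subset_univ _, disjoint_sdiff.mono_left hc.2.1⟩
    · intro c hc
      simp only [h𝒯, mem_filter, mem_univ, true_and] at hc
      exact hc.2.2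
    · intro Z _ hZ
      rw [isSchur_iff, not_not] at hZ
      obtain ⟨φ, hφ⟩ := hZ
      have := fun i : Fin r => hcont {y ∈ Z | φ y = i} (subset_univ _)
        (fun e he => not_schurEdge_subset hφ i he)
      choose T hT1 hT2 hT3 using this
      have hZc : Z ⊆ Cov fun ij => T ij.1 ij.2 := fun z hz =>
        mem_biUnion.2 ⟨φ z, mem_univ _, hT2 (φ z) (mem_filter.2 ⟨hz, rfl⟩)⟩
      have hUZ : (univ.biUnion fun ij : Fin r × Fin k => T ij.1 ij.2) ⊆ Z :=
        biUnion_subset.2 fun ij _ => (hT1 ij.1 ij.2).1.trans (filter_subset _ _)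
      refine ⟨fun ij => T ij.1 ij.2, ?_, hUZ, disjoint_sdiff.mono_left hZc⟩
      simp only [h𝒯, mem_filter, mem_univ, true_and]
      refine ⟨?_, hUZ.trans hZc, ?_⟩
      · refine Nat.le_floor ?_
        have h1 : (#(univ.biUnion fun ij : Fin r × Fin k => T ij.1 ij.2) : ℝ) ≤
            ∑ ij : Fin r × Fin k, (#(T ij.1 ij.2) : ℝ) := by
          exact_mod_cast card_biUnion_le
        refine h1.trans ((sum_le_card_nsmul _ _ s fun ij _ => ?_).trans ?_)
        · refine (hT1 ij.1 ij.2).2.trans_eq ?_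
          rw [← hss]
          field_simp
        · rw [nsmul_eq_mul]
          simp [card_univ]
      · refine Nat.ceil_le.2 ?_
        by_contra hcon
        obtain ⟨i, hi⟩ := hsup N hNN₁ (fun i => cont (T i)) (not_le.1 hcon)
        exact absurd hi (not_lt.2 (hT3 i))
  have hsum : Pr univ p (fun Z : Finset (ZMod N) => ¬ IsSchur r N Z) ≤ Real.exp (-2) := by
    refine hbound.trans ?_
    have h1 := (sum_codes_le hp0 t 𝒯 (fun c hc => by
      simp only [h𝒯, mem_filter, mem_univ, true_and] at hc
      exact hc.1)).trans (sum_pow_card_le (univ : Finset (ZMod N))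
        (q := 2 ^ Fintype.card (Fin r × Fin k) * p) (by positivity) hl0 hl1 t)
    refine (mul_le_mul_of_nonneg_right h1 (by
      exact pow_nonneg (by linarith) _)).trans
      ((inv_pow_mul_exp_mul_pow_le hl0 hp1 t m).trans (Real.exp_le_exp.2 ?_))
    rw [Fintype.card_prod, Fintype.card_fin, Fintype.card_fin, card_univ, ZMod.card]
    have ht' : (t : ℝ) * Real.log l⁻¹ ≤ r * k * s * Real.log l⁻¹ :=
      mul_le_mul_of_nonneg_right (Nat.floor_le (by positivity)) hlog
    have hm' : p * (γ * N) ≤ p * m := mul_le_mul_of_nonneg_left (Nat.le_ceil _) hp0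
    have hpN : p * N = c₁ * s := by
      rw [hp, ← hss]
      field_simp
    have h2 : l * (2 ^ (r * k) * p) * N ≤ γ / 2 * (c₁ * s) := by
      rw [← hpN]
      calc l * (2 ^ (r * k) * p) * N = l * 2 ^ (r * k) * (p * N) := by ring
        _ ≤ _ := mul_le_mul_of_nonneg_right hl2 (by positivity)
    have h3 : p * (γ * N) = c₁ * γ * s := by
      rw [show p * (γ * N) = p * N * γ by ring, hpN]
      ring
    rw [h3] at hm'
    have h4 : γ / 2 * (c₁ * s) = c₁ * γ * s / 2 := by ring
    rw [h4] at h2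
    rw [hc₁γ] at h2 hm'
    nlinarith
  have hexp : Real.exp (-2) ≤ 1 / 4 := by
    have h1 : (4 : ℝ) ≤ Real.exp 2 := by
      have := Real.add_one_le_exp (1 : ℝ)
      rw [show (2 : ℝ) = 1 + 1 by norm_num, Real.exp_add]
      nlinarith
    rw [Real.exp_neg, one_div]
    exact inv_anti₀ (by norm_num) h1
  rw [Pr_not] at hsum
  linarith

end OneStatement

section ListColouring
open Finset

variable {α κ k : Type*} [Fintype α] [DecidableEq α] [DecidableEq κ] [Field k]

/-- `σ` is a proper colouring of `W` from the lists `L`. -/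
def ListColours (𝓗 : Finset (Finset α)) (L : α → Finset κ) (W : Finset α) (σ : α → κ) : Prop :=
  (∀ a ∈ W, σ a ∈ L a) ∧ ∀ e ∈ 𝓗, e ⊆ W → ∀ i, ¬ ∀ a ∈ e, σ a = i

/-- `W` has a proper colouring from the lists `L`. -/
def ListColourable (𝓗 : Finset (Finset α)) (L : α → Finset κ) (W : Finset α) : Prop :=
  ∃ σ, ListColours 𝓗 L W σ

/-- The lists `L` admit no further propagation along edges inside `W`. -/
def Unstuck (𝓗 : Finset (Finset α)) (L : α → Finset κ) (W : Finset α) : Prop :=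
  ∀ e ∈ 𝓗, e ⊆ W → ∀ i, (∀ a ∈ e, i ∈ L a) → ∀ a ∈ e, ∀ b ∈ e, #(L a) = 1 → #(L b) = 1 → a = b

/-- The edges inside `W` which can become monochromatic. -/
noncomputable def usefulEdges (𝓗 : Finset (Finset α)) (L : α → Finset κ) (W : Finset α) : Finset (Finset α) := by
  classical exact {e ∈ 𝓗 | e ⊆ W ∧ ∃ i, ∀ a ∈ e, i ∈ L a}

lemma mem_usefulEdges {𝓗 : Finset (Finset α)} {L : α → Finset κ} {W e : Finset α} :
    e ∈ usefulEdges 𝓗 L W ↔ e ∈ 𝓗 ∧ e ⊆ W ∧ ∃ i, ∀ a ∈ e, i ∈ L a := by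
  simp [usefulEdges]

/-- A minimal set which is not colourable from short lists. -/
structure Critical (𝓗 : Finset (Finset α)) (L : α → Finset κ) (W : Finset α) : Prop where
  card_edge : ∀ e ∈ 𝓗, #e = 3
  nonempty : ∀ a ∈ W, (L a).Nonempty
  card_le : ∀ a ∈ W, #(L a) ≤ 2
  unstuck : Unstuck 𝓗 L W
  not_colourable : ¬ ListColourable 𝓗 L W
  minimal : ∀ U, U ⊂ W → ListColourable 𝓗 L U

/-- The rank of the vectors of the edges inside `U`. -/
noncomputable def rk (v : Finset α → α → k) (𝓗 : Finset (Finset α)) (U : Finset α) : ℕ :=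
  Module.finrank k (Submodule.span k (v '' {e | e ∈ 𝓗 ∧ e ⊆ U}))

variable {v : Finset α → α → k} {𝓗 : Finset (Finset α)} {L : α → Finset κ} {W : Finset α}

lemma rk_lt (hv : ∀ e ∈ 𝓗, ∀ a, v e a ≠ 0 ↔ a ∈ e) {U U' e : Finset α} (h : U ⊆ U') (he : e ∈ 𝓗)
    (heU : e ⊆ U') {a : α} (ha : a ∈ e) (haU : a ∉ U) : rk v 𝓗 U < rk v 𝓗 U' := by
  refine Submodule.finrank_lt_finrank_of_lt (lt_of_le_of_ne
    (Submodule.span_mono (Set.image_mono fun _ he => ⟨he.1, he.2.trans h⟩)) fun heq => ?_)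
  have hmem : v e ∈ Submodule.span k (v '' {e | e ∈ 𝓗 ∧ e ⊆ U}) := by
    rw [heq]
    exact Submodule.subset_span ⟨e, ⟨he, heU⟩, rfl⟩
  have hle : Submodule.span k (v '' {e | e ∈ 𝓗 ∧ e ⊆ U}) ≤
      LinearMap.ker (LinearMap.proj a : (α → k) →ₗ[k] k) := by
    rw [Submodule.span_le]
    rintro _ ⟨f, ⟨hf, hfU⟩, rfl⟩
    rw [SetLike.mem_coe, LinearMap.mem_ker, LinearMap.proj_apply]
    by_contra hne
    exact haU (hfU ((hv f hf a).1 hne))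
  have := hle hmem
  rw [LinearMap.mem_ker, LinearMap.proj_apply] at this
  exact (hv e he a).2 ha this

lemma card_le_rk {C : Finset (Finset α)} {U : Finset α} (hC : ∀ e ∈ C, e ∈ 𝓗 ∧ e ⊆ U)
    (hi : LinearIndepOn k v (C : Set (Finset α))) : #C ≤ rk v 𝓗 U := by
  have h1 : Module.finrank k (Submodule.span k (v '' (C : Set (Finset α)))) = #C := by
    have h2 := finrank_span_eq_card hi
    have h3 : Set.range (fun x : (C : Set (Finset α)) => v x) = v '' (C : Set (Finset α)) := by
      ext; simp
    rw [h3] at h2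
    rw [h2]
    simp
  rw [← h1]
  exact Submodule.finrank_mono (Submodule.span_mono (Set.image_mono fun e he => hC e he))

lemma ListColourable.mono {U : Finset α} (h : ListColourable 𝓗 L W) (hU : U ⊆ W) :
    ListColourable 𝓗 L U := by
  obtain ⟨σ, h1, h2⟩ := h
  exact ⟨σ, fun a ha => h1 a (hU ha), fun e he heU => h2 e he (heU.trans hU)⟩

/-- A choice of colours from the lists of a critical set makes some useful edge monochromatic. -/
lemma Critical.exists_mono (hW : Critical 𝓗 L W) {σ : α → κ} (hσ : ∀ a ∈ W, σ a ∈ L a) :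
    ∃ e ∈ usefulEdges 𝓗 L W, ∃ i, ∀ a ∈ e, σ a = i := by
  by_contra hcon
  push Not at hcon
  refine hW.not_colourable ⟨σ, hσ, fun e he heW i hi => ?_⟩
  obtain ⟨a, ha, hne⟩ := hcon e
    (mem_usefulEdges.2 ⟨he, heW, i, fun a ha => hi a ha ▸ hσ a (heW ha)⟩) i
  exact hne (hi a ha)

lemma Critical.card_useful (hW : Critical 𝓗 L W) {e : Finset α} (he : e ∈ usefulEdges 𝓗 L W) :
    #e = 3 := hW.card_edge e (mem_usefulEdges.1 he).1

/-- Recolouring one vertex of a critical set produces a useful edge through that vertex, whose other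
vertices carry the new colour. -/
lemma Critical.exists_edge (hW : Critical 𝓗 L W) {x : α} (hx : x ∈ W) {σ : α → κ}
    (hσ : ListColours 𝓗 L (W.erase x) σ) {i : κ} (hi : i ∈ L x) :
    ∃ e ∈ usefulEdges 𝓗 L W, x ∈ e ∧ ∀ a ∈ e, a ≠ x → σ a = i := by
  obtain ⟨e, he, j, hj⟩ := hW.exists_mono (σ := Function.update σ x i) (fun a ha => by
    by_cases h : a = x
    · subst h
      simpa using hi
    · rw [Function.update_of_ne h]
      exact hσ.1 a (mem_erase.2 ⟨h, ha⟩))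
  have hxe : x ∈ e := by
    by_contra hxe
    obtain ⟨he1, he2, -⟩ := mem_usefulEdges.1 he
    refine hσ.2 e he1 (fun a ha => mem_erase.2 ⟨fun h => hxe (h ▸ ha), he2 ha⟩) j fun a ha => ?_
    rw [← hj a ha, Function.update_of_ne (fun h : a = x => hxe (h ▸ ha))]
  refine ⟨e, he, hxe, fun a ha hax => ?_⟩
  have h1 := hj a ha
  have h2 := hj x hxe
  rw [Function.update_of_ne hax] at h1
  rw [Function.update_self] at h2
  rw [h1, h2]

lemma Critical.exists_useful (hW : Critical 𝓗 L W) {x : α} (hx : x ∈ W) :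
    ∃ e ∈ usefulEdges 𝓗 L W, x ∈ e := by
  obtain ⟨σ, hσ⟩ := hW.minimal _ (erase_ssubset hx)
  obtain ⟨i, hi⟩ := hW.nonempty x hx
  obtain ⟨e, he, hxe, -⟩ := hW.exists_edge hx hσ hi
  exact ⟨e, he, hxe⟩

lemma Critical.exists_two_useful (hW : Critical 𝓗 L W) {x : α} (hx : x ∈ W) (hL : #(L x) ≠ 1) :
    ∃ e ∈ usefulEdges 𝓗 L W, ∃ f ∈ usefulEdges 𝓗 L W, x ∈ e ∧ x ∈ f ∧ ∀ a ∈ e, a ∈ f → a = x := by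
  obtain ⟨σ, hσ⟩ := hW.minimal _ (erase_ssubset hx)
  have hpos := (hW.nonempty x hx).card_pos
  obtain ⟨i, hi, j, hj, hij⟩ := one_lt_card.1 (show 1 < #(L x) by omega)
  obtain ⟨e, he, hxe, he'⟩ := hW.exists_edge hx hσ hi
  obtain ⟨f, hf, hxf, hf'⟩ := hW.exists_edge hx hσ hj
  refine ⟨e, he, f, hf, hxe, hxf, fun a hae haf => ?_⟩
  by_contra hax
  exact hij ((he' a hae hax).symm.trans (hf' a haf hax))

lemma Critical.exists_connecting (hW : Critical 𝓗 L W) {U : Finset α} (hU : U ⊂ W)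
    (hne : U.Nonempty) : ∃ e ∈ usefulEdges 𝓗 L W, (∃ a ∈ e, a ∈ U) ∧ ¬ e ⊆ U := by
  obtain ⟨σ, hσ⟩ := hW.minimal U hU
  obtain ⟨τ, hτ⟩ := hW.minimal (W \ U) (by
    refine ⟨sdiff_subset, fun h => ?_⟩
    obtain ⟨u, hu⟩ := hne
    exact (Finset.mem_sdiff.1 (h (hU.1 hu))).2 hu)
  obtain ⟨e, he, i, hi⟩ := hW.exists_mono (σ := fun a => if a ∈ U then σ a else τ a) (fun a ha => by
    by_cases h : a ∈ U
    · simpa [h] using hσ.1 a h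
    · simpa [h] using hτ.1 a (Finset.mem_sdiff.2 ⟨ha, h⟩))
  obtain ⟨he1, he2, -⟩ := mem_usefulEdges.1 he
  refine ⟨e, he, ?_, fun h => ?_⟩
  · by_contra hcon
    push Not at hcon
    refine hτ.2 e he1 (fun a ha => Finset.mem_sdiff.2 ⟨he2 ha, hcon a ha⟩) i fun a ha => ?_
    rw [← hi a ha, if_neg (hcon a ha)]
  · refine hσ.2 e he1 h i fun a ha => ?_
    rw [← hi a ha, if_pos (h ha)]

lemma Critical.growth (hW : Critical 𝓗 L W) (hv : ∀ e ∈ 𝓗, ∀ a, v e a ≠ 0 ↔ a ∈ e) (c : ℕ)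
    {U : Finset α} (hU : U ⊂ W) (hne : U.Nonempty) (hUc : #U ≤ 2 * rk v 𝓗 U + c) :
    #W + 1 ≤ 2 * rk v 𝓗 W + c := by
  classical
  obtain ⟨U, hUmem, hmax⟩ := exists_max_image
    {U ∈ W.powerset | U ⊂ W ∧ U.Nonempty ∧ #U ≤ 2 * rk v 𝓗 U + c} (fun U => #U)
    ⟨U, mem_filter.2 ⟨mem_powerset.2 hU.1, hU, hne, hUc⟩⟩
  rw [mem_filter] at hUmem
  obtain ⟨-, hU, hne, hUc⟩ := hUmem
  have hext : ∀ U', U ⊂ U' → U' ⊆ W → #U' ≤ 2 * rk v 𝓗 U' + c → U' = W := by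
    intro U' h1 h2 h3
    by_contra hne'
    have := hmax U' (mem_filter.2 ⟨mem_powerset.2 h2, lt_of_le_of_ne h2 hne', hne.mono h1.1, h3⟩)
    exact absurd (card_lt_card h1) (not_lt.2 this)
  obtain ⟨e, he, ⟨a, hae, haU⟩, heU⟩ := hW.exists_connecting hU hne
  obtain ⟨he1, he2, j, hj⟩ := mem_usefulEdges.1 he
  have he3 := hW.card_useful he
  obtain ⟨y, hye, hyU⟩ := not_subset.1 heU
  have hlt := rk_lt hv (subset_union_left (s₁ := U) (s₂ := e)) he1 subset_union_right hye hyU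
  have hss : U ⊂ U ∪ e := ⟨subset_union_left, fun h => hyU (h (mem_union_right _ hye))⟩
  have hUe : U ∪ e ⊆ W := union_subset hU.1 he2
  have hcard : #(U ∪ e) = #U + #(e \ U) := by
    rw [← union_sdiff_self_eq_union, card_union_of_disjoint disjoint_sdiff]
  have hsd : #(e \ U) ≤ 2 := by
    have h1 : e \ U ⊆ e.erase a := fun b hb => by
      rw [Finset.mem_sdiff] at hb
      exact mem_erase.2 ⟨fun h => hb.2 (h ▸ haU), hb.1⟩
    have := card_le_card h1
    rw [card_erase_of_mem hae] at this
    omega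
  have hWeq := hext (U ∪ e) hss hUe (by omega)
  by_cases h1 : #(e \ U) ≤ 1
  · rw [hWeq] at hcard hlt
    omega
  have h2 : #(e \ U) = 2 := by omega
  obtain ⟨y, z, hyz, heyz⟩ := card_eq_two.1 h2
  have hmy : y ∈ e \ U := by rw [heyz]; simp
  have hmz : z ∈ e \ U := by rw [heyz]; simp
  rw [Finset.mem_sdiff] at hmy hmz
  have key : ∀ y z, y ≠ z → y ∈ e → y ∉ U → z ∈ e → z ∉ U → #(L y) ≠ 1 → e \ U = {y, z} →
      #W + 1 ≤ 2 * rk v 𝓗 W + c := by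
    intro y z hyz hy hyU hz hzU hLy heyz
    obtain ⟨f, hf, g, hg, hyf, hyg, hfg⟩ := hW.exists_two_useful (he2 hy) hLy
    have hWsub : ∀ b ∈ W, b ∈ U ∨ b = y ∨ b = z := by
      intro b hb
      rw [← hWeq, ← union_sdiff_self_eq_union, heyz, mem_union] at hb
      simpa only [mem_insert, mem_singleton] using hb
    obtain ⟨h, hh, hyh, hzh⟩ : ∃ h ∈ usefulEdges 𝓗 L W, y ∈ h ∧ z ∉ h := by
      by_cases hzf : z ∈ f
      · exact ⟨g, hg, hyg, fun hzg => hyz (hfg z hzf hzg).symm⟩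
      · exact ⟨f, hf, hyf, hzf⟩
    obtain ⟨hh1, hh2, -⟩ := mem_usefulEdges.1 hh
    have hhs : h ⊆ insert y U := fun b hb => by
      rcases hWsub b (hh2 hb) with h' | h' | h'
      · exact mem_insert_of_mem h'
      · rw [h']
        exact mem_insert_self _ _
      · exact absurd (h' ▸ hb) hzh
    have hr1 := rk_lt hv (subset_insert y U) hh1 hhs hyh hyU
    have hr2 := rk_lt hv (U := insert y U) (insert_subset (he2 hy) hU.1) he1 he2 hz (by
      rw [mem_insert, not_or]
      exact ⟨hyz.symm, hzU⟩)
    have : #W = #U + 2 := by rw [← hWeq, hcard, h2]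
    omega
  by_cases hLy : #(L y) = 1
  · have hLz : #(L z) ≠ 1 := fun hLz => hyz (hW.unstuck e he1 he2 j hj y hmy.1 z hmz.1 hLy hLz)
    exact key z y hyz.symm hmz.1 hmz.2 hmy.1 hmy.2 hLz (by rw [heyz, pair_comm])
  · exact key y z hyz hmy.1 hmy.2 hmz.1 hmz.2 hLy heyz

lemma Critical.set_nonempty [Nonempty κ] (hW : Critical 𝓗 L W) : W.Nonempty := by
  rw [nonempty_iff_ne_empty]
  rintro rfl
  refine hW.not_colourable ⟨fun _ => Classical.arbitrary κ, by simp, fun e he heW => ?_⟩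
  have := hW.card_edge e he
  rw [subset_empty.1 heW] at this
  simp at this

lemma Critical.exists_nonsingle [Nonempty κ] (hW : Critical 𝓗 L W) : ∃ y ∈ W, #(L y) ≠ 1 := by
  obtain ⟨x, hx⟩ := hW.set_nonempty
  obtain ⟨e, he, -⟩ := hW.exists_useful hx
  obtain ⟨he1, he2, j, hj⟩ := mem_usefulEdges.1 he
  obtain ⟨a, ha, b, hb, hab⟩ := one_lt_card.1 (show 1 < #e by rw [hW.card_useful he]; omega)
  by_cases hLa : #(L a) = 1
  · exact ⟨b, he2 hb, fun hLb => hab (hW.unstuck e he1 he2 j hj a ha b hb hLa hLb)⟩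
  · exact ⟨a, he2 ha, hLa⟩

lemma Critical.five_le_card [Nonempty κ] (hW : Critical 𝓗 L W) : 5 ≤ #W := by
  obtain ⟨y, hy, hLy⟩ := hW.exists_nonsingle
  obtain ⟨e, he, f, hf, hye, hyf, hef⟩ := hW.exists_two_useful hy hLy
  have h1 : #(e ∩ f) = 1 := card_eq_one.2 ⟨y, by
    ext a
    rw [mem_inter, mem_singleton]
    exact ⟨fun h => hef a h.1 h.2, fun h => h ▸ ⟨hye, hyf⟩⟩⟩
  have h2 := card_union_add_card_inter e f
  have h3 := card_le_card (union_subset (mem_usefulEdges.1 he).2.1 (mem_usefulEdges.1 hf).2.1)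
  have h4 := hW.card_useful he
  have h5 := hW.card_useful hf
  omega

lemma Critical.card_le_two_mul_rk [Nonempty κ] (hW : Critical 𝓗 L W)
    (hv : ∀ e ∈ 𝓗, ∀ a, v e a ≠ 0 ↔ a ∈ e) : #W ≤ 2 * rk v 𝓗 W := by
  obtain ⟨x, hx⟩ := hW.set_nonempty
  have h5 := hW.five_le_card
  have := hW.growth hv 1 (U := {x}) ⟨singleton_subset_iff.2 hx, fun h => by
    have := card_le_card h
    rw [card_singleton] at this
    omega⟩ (singleton_nonempty x) (by rw [card_singleton]; omega)
  omega

lemma exists_critical {B : Finset α} (h3 : ∀ e ∈ 𝓗, #e = 3) (hne : ∀ a ∈ B, (L a).Nonempty)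
    (hun : Unstuck 𝓗 L B) (hB : ¬ ListColourable 𝓗 L B) :
    ∃ W ⊆ B, ∃ L' : α → Finset κ, (∀ a, L' a ⊆ L a) ∧ Critical 𝓗 L' W := by
  have htrim : ∀ a, ∃ s ⊆ L a, #s = min 2 #(L a) := fun a =>
    exists_subset_card_eq (min_le_right _ _)
  choose L' hL' hcard using htrim
  have hB' : ¬ ListColourable 𝓗 L' B := fun ⟨σ, h1, h2⟩ => hB ⟨σ, fun a ha => hL' a (h1 a ha), h2⟩
  obtain ⟨W, hWB, hW⟩ := exists_minimal_le_of_wellFoundedLT (fun U => ¬ ListColourable 𝓗 L' U) B hB'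
  refine ⟨W, hWB, L', hL', h3, fun a ha => ?_, fun a _ => ?_, ?_, hW.prop, fun U hU => ?_⟩
  · rw [← card_pos, hcard]
    have := (hne a (hWB ha)).card_pos
    omega
  · rw [hcard]
    omega
  · intro e he heW i hi a ha b hb h1 h2
    rw [hcard] at h1 h2
    exact hun e he (heW.trans hWB) i (fun a ha => hL' a (hi a ha)) a ha b hb (by omega) (by omega)
  · by_contra hcon
    exact hU.2 (hW.le_of_le hcon hU.1)

/-- A set which is not colourable from nonempty unstuck lists contains a set of large rank. -/
theorem exists_card_le_two_mul_rk [Nonempty κ] {B : Finset α} (h3 : ∀ e ∈ 𝓗, #e = 3)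
    (hv : ∀ e ∈ 𝓗, ∀ a, v e a ≠ 0 ↔ a ∈ e) (hne : ∀ a ∈ B, (L a).Nonempty)
    (hun : Unstuck 𝓗 L B) (hB : ¬ ListColourable 𝓗 L B) :
    ∃ W ⊆ B, W.Nonempty ∧ #W ≤ 2 * rk v 𝓗 W := by
  obtain ⟨W, hWB, L', -, hW⟩ := exists_critical h3 hne hun hB
  exact ⟨W, hWB, hW.set_nonempty, hW.card_le_two_mul_rk hv⟩

end ListColouring

section TightCritical
open Finset

variable {α κ k : Type*} [Fintype α] [DecidableEq α] [DecidableEq κ] [Field k]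
  {v : Finset α → α → k} {𝓗 : Finset (Finset α)} {L : α → Finset κ} {W : Finset α}

lemma Critical.exists_two_colours (hW : Critical 𝓗 L W) {y : α} (hy : y ∈ W) (hLy : #(L y) ≠ 1) :
    ∃ i j, i ≠ j ∧ L y = {i, j} := by
  have h1 := hW.card_le y hy
  have h2 := (hW.nonempty y hy).card_pos
  exact card_eq_two.1 (by omega)

/-- The vertices with two colours are at most as many as the useful edges. -/
lemma Critical.card_nonsingle_le (hW : Critical 𝓗 L W) :
    #{a ∈ W | #(L a) ≠ 1} ≤ #(usefulEdges 𝓗 L W) := by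
  classical
  by_contra hcon
  push Not at hcon
  set Y := {a ∈ W | #(L a) ≠ 1} with hY
  set 𝓔 := usefulEdges 𝓗 L W with h𝓔
  have hYm : ∀ y ∈ Y, y ∈ W ∧ #(L y) ≠ 1 := fun y hy => by simpa [hY] using hy
  have htwo : ∀ y : Y, ∃ i j, i ≠ j ∧ L y = {i, j} := fun y =>
    hW.exists_two_colours (hYm y y.2).1 (hYm y y.2).2
  choose t o hto hL using htwo
  have hcol : ∀ e : 𝓔, ∃ i, ∀ a ∈ e.1, i ∈ L a := fun e => (mem_usefulEdges.1 e.2).2.2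
  choose c hc using hcol
  let sg : 𝓔 → Y → ℝ := fun e y => if y.1 ∈ e.1 then (if c e = t y then 1 else -1) else 0
  let T : (Y → ℝ) →ₗ[ℝ] (𝓔 → ℝ) := Matrix.mulVecLin (Matrix.of sg)
  have hker : LinearMap.ker T ≠ ⊥ := by
    apply LinearMap.ker_ne_bot_of_finrank_lt
    simpa using hcon
  obtain ⟨x, hx, hx0⟩ := (Submodule.ne_bot_iff _).1 hker
  have hxe : ∀ e : 𝓔, ∑ y : Y, sg e y * x y = 0 := fun e => by
    have := congrFun (LinearMap.mem_ker.1 hx) e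
    simpa [T, Matrix.mulVec, dotProduct] using this
  obtain ⟨y₀, hy₀⟩ := Function.ne_iff.1 hx0
  obtain ⟨σ, hσ⟩ := hW.minimal {a ∈ W | ∀ h : a ∈ Y, x ⟨a, h⟩ = 0} (by
    refine ⟨filter_subset _ _, fun h => ?_⟩
    have := (mem_filter.1 (h (hYm y₀ y₀.2).1)).2 y₀.2
    exact hy₀ this)
  let τ : α → κ := fun a => if h : ∃ h : a ∈ Y, x ⟨a, h⟩ ≠ 0 then
    (if 0 < x ⟨a, h.1⟩ then t ⟨a, h.1⟩ else o ⟨a, h.1⟩) else σ a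
  have hτ : ∀ y : Y, x y ≠ 0 → τ y = if 0 < x y then t y else o y := fun y hy => by
    have : ∃ h : y.1 ∈ Y, x ⟨y.1, h⟩ ≠ 0 := ⟨y.2, hy⟩
    simp only [τ, dif_pos this]
  have hτσ : ∀ a, (∀ h : a ∈ Y, x ⟨a, h⟩ = 0) → τ a = σ a := fun a ha => by
    have : ¬ ∃ h : a ∈ Y, x ⟨a, h⟩ ≠ 0 := fun ⟨h, hne⟩ => hne (ha h)
    simp only [τ, dif_neg this]
  obtain ⟨e, he, i, hi⟩ := hW.exists_mono (σ := τ) (fun a ha => by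
    by_cases h : ∀ h : a ∈ Y, x ⟨a, h⟩ = 0
    · rw [hτσ a h]
      exact hσ.1 a (mem_filter.2 ⟨ha, h⟩)
    · push Not at h
      obtain ⟨haY, hne⟩ := h
      rw [hτ ⟨a, haY⟩ hne]
      have := hL ⟨a, haY⟩
      dsimp only at this
      rw [this]
      split_ifs <;> simp)
  obtain ⟨he1, he2, -⟩ := mem_usefulEdges.1 he
  by_cases hsub : ∀ a ∈ e, ∀ h : a ∈ Y, x ⟨a, h⟩ = 0
  · refine hσ.2 e he1 (fun a ha => mem_filter.2 ⟨he2 ha, hsub a ha⟩) i fun a ha => ?_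
    rw [← hτσ a (hsub a ha)]
    exact hi a ha
  · push Not at hsub
    obtain ⟨a, hae, haY, hax⟩ := hsub
    have hsum := hxe ⟨e, he⟩
    have hnz : sg ⟨e, he⟩ ⟨a, haY⟩ * x ⟨a, haY⟩ ≠ 0 := by
      refine mul_ne_zero ?_ hax
      simp only [sg, hae, if_true]
      split_ifs <;> norm_num
    obtain ⟨p, -, hp⟩ := exists_pos_of_sum_zero_of_exists_nonzero _ hsum ⟨⟨a, haY⟩, mem_univ _, hnz⟩
    obtain ⟨n, -, hn⟩ := exists_pos_of_sum_zero_of_exists_nonzero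
      (fun y => -(sg ⟨e, he⟩ y * x y)) (by rw [sum_neg_distrib, hsum, neg_zero])
      ⟨⟨a, haY⟩, mem_univ _, neg_ne_zero.2 hnz⟩
    have hpe : p.1 ∈ e := by
      by_contra h
      simp [sg, h] at hp
    have hne : n.1 ∈ e := by
      by_contra h
      simp [sg, h] at hn
    have hpx : x p ≠ 0 := fun h => by simp [h] at hp
    have hnx : x n ≠ 0 := fun h => by simp [h] at hn
    have h1 : τ p = c ⟨e, he⟩ := by
      rw [hτ p hpx]
      have hcp := hc ⟨e, he⟩ p hpe
      rw [hL p, mem_insert, mem_singleton] at hcp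
      simp only [sg, hpe, if_true] at hp
      by_cases h : c ⟨e, he⟩ = t p
      · rw [if_pos h, one_mul] at hp
        rw [if_pos hp, h]
      · rw [if_neg h] at hp
        rw [if_neg (by linarith)]
        exact (hcp.resolve_left h).symm
    have h2 : τ n ≠ c ⟨e, he⟩ := by
      rw [hτ n hnx]
      simp only [sg, hne, if_true] at hn
      by_cases h : c ⟨e, he⟩ = t n
      · rw [if_pos h, one_mul] at hn
        rw [if_neg (by linarith), h]
        exact (hto n).symm
      · rw [if_neg h] at hn
        rw [if_pos (by linarith)]
        exact Ne.symm h
    exact h2 ((hi n hne).trans ((hi p hpe).symm.trans h1))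

/-- In a critical set some useful edge has no vertex with a single colour, or some vertex with two
colours lies on at least three useful edges. -/
lemma Critical.false_of_degree_le_two [Nonempty κ] (hW : Critical 𝓗 L W)
    (h1 : ∀ e ∈ usefulEdges 𝓗 L W, ∃ s ∈ e, #(L s) = 1)
    (h2 : ∀ y ∈ W, #(L y) ≠ 1 → #{e ∈ usefulEdges 𝓗 L W | y ∈ e} ≤ 2) : False := by
  classical
  set 𝓔 := usefulEdges 𝓗 L W with h𝓔
  let t : 𝓔 → Finset α := fun e => {a ∈ e.1 | #(L a) ≠ 1}
  have ht2 : ∀ e : 𝓔, 2 ≤ #(t e) := fun e => by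
    obtain ⟨he1, he2, j, hj⟩ := mem_usefulEdges.1 e.2
    have hs : #{a ∈ e.1 | #(L a) = 1} ≤ 1 := card_le_one.2 fun a ha b hb => by
      rw [mem_filter] at ha hb
      exact hW.unstuck e.1 he1 he2 j hj a ha.1 b hb.1 ha.2 hb.2
    have := card_filter_add_card_filter_not (s := e.1) (fun a => #(L a) = 1)
    have h3 := hW.card_useful e.2
    change 2 ≤ #{a ∈ e.1 | ¬ #(L a) = 1}
    omega
  have hall : ∀ A : Finset 𝓔, #A ≤ #(A.biUnion t) := fun A => by
    have := card_mul_le_card_mul (s := A) (t := A.biUnion t) (m := 2) (n := 2)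
      (fun (e : 𝓔) a => a ∈ t e) (fun e he => by
        refine (ht2 e).trans (card_le_card fun a ha => ?_)
        exact mem_bipartiteAbove _ |>.2 ⟨mem_biUnion.2 ⟨e, he, ha⟩, ha⟩)
      (fun a ha => by
        obtain ⟨e, -, hae⟩ := mem_biUnion.1 ha
        have hae' := mem_filter.1 hae
        refine le_trans ?_ (h2 a ((mem_usefulEdges.1 e.2).2.1 hae'.1) hae'.2)
        refine card_le_card_of_injOn (fun e => e.1) (fun f hf => ?_) (fun _ _ _ _ h => Subtype.ext h)
        have := (mem_bipartiteBelow _).1 (mem_coe.1 hf)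
        exact mem_coe.2 (mem_filter.2 ⟨f.2, (mem_filter.1 this.2).1⟩))
    omega
  obtain ⟨m, hminj, hm⟩ := (all_card_le_biUnion_card_iff_exists_injective t).1 hall
  have hcol : ∀ e : 𝓔, ∃ i, ∀ a ∈ e.1, i ∈ L a := fun e => (mem_usefulEdges.1 e.2).2.2
  choose c hc using hcol
  have hpick : ∀ a, ∃ i, (a ∈ W → i ∈ L a) ∧ ∀ e, m e = a → i ≠ c e := by
    intro a
    by_cases ha : ∃ e, m e = a
    · obtain ⟨e, rfl⟩ := ha
      have hme := mem_filter.1 (hm e)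
      obtain ⟨i, j, hij, hL⟩ := hW.exists_two_colours ((mem_usefulEdges.1 e.2).2.1 hme.1) hme.2
      by_cases hi : i = c e
      · refine ⟨j, fun _ => by rw [hL]; simp, fun f hf => ?_⟩
        rw [hminj hf, ← hi]
        exact hij.symm
      · refine ⟨i, fun _ => by rw [hL]; simp, fun f hf => ?_⟩
        rwa [hminj hf]
    · by_cases haW : a ∈ W
      · obtain ⟨i, hi⟩ := hW.nonempty a haW
        exact ⟨i, fun _ => hi, fun e he => absurd ⟨e, he⟩ ha⟩
      · exact ⟨Classical.arbitrary κ, fun h => absurd h haW, fun e he => absurd ⟨e, he⟩ ha⟩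
  choose σ hσ hσc using hpick
  obtain ⟨e, he, i, hi⟩ := hW.exists_mono (σ := σ) hσ
  obtain ⟨s, hse, hs1⟩ := h1 e he
  obtain ⟨i₀, hi₀⟩ := card_eq_one.1 hs1
  have e1 : σ s = i₀ := by
    have := hσ s ((mem_usefulEdges.1 he).2.1 hse)
    rwa [hi₀, mem_singleton] at this
  have e2 : c ⟨e, he⟩ = i₀ := by
    have := hc ⟨e, he⟩ s hse
    rwa [hi₀, mem_singleton] at this
  have hme := (mem_filter.1 (hm ⟨e, he⟩)).1
  refine hσc _ ⟨e, he⟩ rfl ?_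
  rw [hi _ hme, ← hi s hse, e1, e2]

/-- In a tight critical set every dependent family of edges contains four edges covering every
vertex exactly twice. -/
lemma Critical.exists_circuit [Nonempty κ] (hW : Critical 𝓗 L W)
    (hv : ∀ e ∈ 𝓗, ∀ a, v e a ≠ 0 ↔ a ∈ e) (hsp : ∀ U ⊆ W, 2 * rk v 𝓗 U ≤ #U)
    {D : Finset (Finset α)} (hD : ∀ e ∈ D, e ∈ 𝓗 ∧ e ⊆ W)
    (hdep : ¬ LinearIndepOn k v (D : Set (Finset α))) :
    ∃ C ⊆ D, #C = 4 ∧ #W = 6 ∧ ∀ w ∈ W, #{e ∈ C | w ∈ e} = 2 := by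
  obtain ⟨C, hCD, hC⟩ := exists_minimal_le_of_wellFoundedLT
    (fun C : Finset (Finset α) => ¬ LinearIndepOn k v (C : Set (Finset α))) D hdep
  have herase : ∀ e ∈ C, LinearIndepOn k v ((C.erase e : Finset (Finset α)) : Set (Finset α)) :=
    fun e he => by
      by_contra h
      exact notMem_erase e C (hC.2 h (erase_subset _ _) he)
  obtain ⟨g, hg, e₀, he₀, hge₀⟩ := not_linearIndepOn_finset_iff.1 hC.1
  have hgne : ∀ e ∈ C, g e ≠ 0 := fun e he h0 => by
    refine not_linearIndepOn_finset_iff.2 ⟨g, ?_, e₀, mem_erase.2 ⟨?_, he₀⟩, hge₀⟩ (herase e he)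
    · rw [← hg, ← add_sum_erase C _ he, h0, zero_smul, zero_add]
    · rintro rfl
      exact hge₀ h0
  have hCW : ∀ e ∈ C, e ∈ 𝓗 ∧ e ⊆ W := fun e he => hD e (hCD he)
  have h3 : ∀ e ∈ C, #e = 3 := fun e he => hW.card_edge e (hCW e he).1
  set V := C.biUnion id with hV
  have hVW : V ⊆ W := biUnion_subset.2 fun e he => (hCW e he).2
  have hdeg : ∀ w ∈ V, 2 ≤ #{e ∈ C | w ∈ e} := by
    intro w hw
    obtain ⟨e, he, hwe⟩ := mem_biUnion.1 hw
    by_contra hlt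
    have hone : {f ∈ C | w ∈ f} = {e} := by
      refine (eq_of_subset_of_card_le (singleton_subset_iff.2 (mem_filter.2 ⟨he, hwe⟩)) ?_).symm
      rw [card_singleton]
      omega
    have hsum : ∑ f ∈ C, g f * v f w = 0 := by
      have := congrFun hg w
      simpa using this
    rw [sum_eq_single_of_mem e he] at hsum
    · exact mul_ne_zero (hgne e he) ((hv e (hCW e he).1 w).2 hwe) hsum
    · intro f hf hfe
      have : w ∉ f := fun hwf => hfe (by
        have : f ∈ ({e} : Finset (Finset α)) := hone ▸ mem_filter.2 ⟨hf, hwf⟩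
        simpa using this)
      rw [not_not.1 (mt (hv f (hCW f hf).1 w).1 this), mul_zero]
  have hcount : ∑ w ∈ V, #{e ∈ C | w ∈ e} = 3 * #C := by
    have h := sum_card_bipartiteAbove_eq_sum_card_bipartiteBelow (s := V) (t := C)
      (fun w e => w ∈ e)
    simp only [bipartiteAbove, bipartiteBelow] at h
    rw [h, sum_congr rfl (g := fun _ => 3), sum_const, smul_eq_mul, mul_comm]
    intro e he
    rw [← h3 e he]
    congr 1
    ext a
    simp only [mem_filter, and_iff_right_iff_imp]
    exact fun ha => mem_biUnion.2 ⟨e, he, ha⟩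
  have h2V : 2 * #V ≤ 3 * #C := by
    rw [← hcount, mul_comm, ← smul_eq_mul]
    exact card_nsmul_le_sum V _ 2 hdeg
  have hrk : #C - 1 ≤ rk v 𝓗 V := by
    rw [← card_erase_of_mem he₀]
    refine card_le_rk (fun e he => ?_) (herase e₀ he₀)
    have := mem_of_mem_erase he
    exact ⟨(hCW e this).1, subset_biUnion_of_mem id this⟩
  have h4V : 4 ≤ #V := by
    obtain ⟨w, hw⟩ : e₀.Nonempty := card_pos.1 (by rw [h3 e₀ he₀]; omega)
    obtain ⟨e, he, hne⟩ := exists_mem_ne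
      (lt_of_lt_of_le one_lt_two (hdeg w (mem_biUnion.2 ⟨e₀, he₀, hw⟩))) e₀
    have heC := (mem_filter.1 he).1
    have hss : e₀ ⊂ e₀ ∪ e := by
      refine ⟨subset_union_left, fun h => hne ?_⟩
      exact eq_of_subset_of_card_le (subset_union_right.trans h) (by rw [h3 e heC, h3 e₀ he₀])
    have h1 := card_lt_card hss
    have h2 : #(e₀ ∪ e) ≤ #V := card_le_card
      (union_subset (subset_biUnion_of_mem id he₀) (subset_biUnion_of_mem id heC))
    rw [h3 e₀ he₀] at h1
    omega
  have h5 := hW.five_le_card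
  have htight := hW.card_le_two_mul_rk hv
  have hspV := hsp V hVW
  have hspW := hsp W Subset.rfl
  rcases hVW.eq_or_ssubset with hEq | hss
  · rw [hEq] at hspV h2V h4V hrk hcount hdeg
    have hC4 : #C = 4 := by omega
    have hW6 : #W = 6 := by omega
    refine ⟨C, hCD, hC4, hW6, fun w hw => ?_⟩
    by_contra hne
    have hlt : ∑ w ∈ W, 2 < ∑ w ∈ W, #{e ∈ C | w ∈ e} :=
      sum_lt_sum hdeg ⟨w, hw, lt_of_le_of_ne (hdeg w hw) (Ne.symm hne)⟩
    rw [hcount, sum_const, hC4, hW6] at hlt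
    norm_num at hlt
  · have hVlt : 2 * rk v 𝓗 V < #V := by
      by_contra hcon
      have := hW.growth hv 0 hss (card_pos.1 (by omega)) (by omega)
      omega
    omega

lemma Critical.false_of_sparse [Nonempty κ] (hW : Critical 𝓗 L W)
    (hv : ∀ e ∈ 𝓗, ∀ a, v e a ≠ 0 ↔ a ∈ e) (hsp : ∀ U ⊆ W, 2 * rk v 𝓗 U ≤ #U) : False := by
  have htight : #W = 2 * rk v 𝓗 W := le_antisymm (hW.card_le_two_mul_rk hv) (hsp W Subset.rfl)
  have hy := hW.card_nonsingle_le
  have hsplit := card_filter_add_card_filter_not (s := W) (fun a => #(L a) = 1)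
  have hE : ∀ e ∈ usefulEdges 𝓗 L W, e ∈ 𝓗 ∧ e ⊆ W := fun e he =>
    ⟨(mem_usefulEdges.1 he).1, (mem_usefulEdges.1 he).2.1⟩
  have hone : ∀ e ∈ usefulEdges 𝓗 L W, #{a ∈ e | #(L a) = 1} ≤ 1 := fun e he => by
    obtain ⟨he1, he2, j, hj⟩ := mem_usefulEdges.1 he
    refine card_le_one.2 fun a ha b hb => ?_
    rw [mem_filter] at ha hb
    exact hW.unstuck e he1 he2 j hj a ha.1 b hb.1 ha.2 hb.2
  have hthree : ∀ e ∈ usefulEdges 𝓗 L W, #{a ∈ e | #(L a) = 1} + #{a ∈ e | ¬ #(L a) = 1} = 3 :=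
    fun e he => by rw [card_filter_add_card_filter_not, hW.card_useful he]
  have hdouble : ∀ P : α → Prop, ∀ [DecidablePred P], ∑ a ∈ {a ∈ W | P a},
      #{e ∈ usefulEdges 𝓗 L W | a ∈ e} = ∑ e ∈ usefulEdges 𝓗 L W, #{a ∈ e | P a} := by
    intro P _
    have h := sum_card_bipartiteAbove_eq_sum_card_bipartiteBelow (s := {a ∈ W | P a})
      (t := usefulEdges 𝓗 L W) (fun w e => w ∈ e)
    simp only [bipartiteAbove, bipartiteBelow] at h
    rw [h]
    refine sum_congr rfl fun e he => ?_
    congr 1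
    ext a
    simp only [mem_filter]
    exact ⟨fun h => ⟨h.2, h.1.2⟩, fun h => ⟨⟨(hE e he).2 h.1, h.2⟩, h.1⟩⟩
  set 𝓔 := usefulEdges 𝓗 L W with h𝓔
  have hs1 : #{a ∈ W | #(L a) = 1} ≤ ∑ a ∈ {a ∈ W | #(L a) = 1}, #{e ∈ 𝓔 | a ∈ e} := by
    rw [card_eq_sum_ones]
    refine sum_le_sum fun a ha => card_pos.2 ?_
    obtain ⟨e, he, hae⟩ := hW.exists_useful (mem_filter.1 ha).1
    exact ⟨e, mem_filter.2 ⟨he, hae⟩⟩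
  have hs2 : ∑ e ∈ 𝓔, #{a ∈ e | #(L a) = 1} ≤ #𝓔 := by
    rw [card_eq_sum_ones]
    exact sum_le_sum hone
  have hy2 : ∀ y ∈ {a ∈ W | ¬ #(L a) = 1}, 2 ≤ #{e ∈ 𝓔 | y ∈ e} := fun y hy => by
    rw [mem_filter] at hy
    obtain ⟨e, he, f, hf, hye, hyf, hef⟩ := hW.exists_two_useful hy.1 hy.2
    have hne : e ≠ f := fun h => by
      have h3 := hW.card_useful he
      have : e ⊆ {y} := fun a ha => mem_singleton.2 (hef a ha (h ▸ ha))
      have := card_le_card this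
      rw [card_singleton] at this
      omega
    exact one_lt_card.2 ⟨e, mem_filter.2 ⟨he, hye⟩, f, mem_filter.2 ⟨hf, hyf⟩, hne⟩
  have hds := hdouble (fun a => #(L a) = 1)
  have hdn := hdouble (fun a => ¬ #(L a) = 1)
  have htot : ∑ e ∈ 𝓔, #{a ∈ e | #(L a) = 1} + ∑ e ∈ 𝓔, #{a ∈ e | ¬ #(L a) = 1} = 3 * #𝓔 := by
    rw [← sum_add_distrib, sum_congr rfl hthree, sum_const, smul_eq_mul, mul_comm]
  change #{a ∈ W | ¬ #(L a) = 1} ≤ _ at hy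
  have h1of : #𝓔 ≤ ∑ e ∈ 𝓔, #{a ∈ e | #(L a) = 1} → ∀ e ∈ 𝓔, ∃ s ∈ e, #(L s) = 1 := by
    intro hle e he
    by_contra hcon
    push Not at hcon
    have hz : #{a ∈ e | #(L a) = 1} = 0 := by
      rw [card_eq_zero, filter_eq_empty_iff]
      exact fun a ha => hcon a ha
    have : ∑ e ∈ 𝓔, #{a ∈ e | #(L a) = 1} < ∑ e ∈ 𝓔, 1 :=
      sum_lt_sum hone ⟨e, he, by omega⟩
    rw [← card_eq_sum_ones] at this
    omega
  by_cases hind : LinearIndepOn k v (𝓔 : Set (Finset α))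
  · have hrk := card_le_rk hE hind
    refine hW.false_of_degree_le_two (h1of (by omega)) fun y hyW hLy => ?_
    by_contra hcon
    have hlt : ∑ a ∈ {a ∈ W | ¬ #(L a) = 1}, 2 < ∑ a ∈ {a ∈ W | ¬ #(L a) = 1}, #{e ∈ 𝓔 | a ∈ e} :=
      sum_lt_sum hy2 ⟨y, mem_filter.2 ⟨hyW, hLy⟩, by rw [← h𝓔] at hcon; omega⟩
    rw [sum_const, smul_eq_mul] at hlt
    omega
  · obtain ⟨C, hC, hC4, hW6, hdeg⟩ := hW.exists_circuit hv hsp hE hind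
    have hEC : 𝓔 = C := by
      refine (Subset.antisymm hC fun f hf => ?_).symm
      by_contra hfC
      obtain ⟨e, he⟩ : C.Nonempty := card_pos.1 (by omega)
      have hfe : f ∉ C.erase e := fun h => hfC (mem_of_mem_erase h)
      have hcard : #(insert f (C.erase e)) = 4 := by
        rw [card_insert_of_notMem hfe, card_erase_of_mem he, hC4]
      have hsub : ∀ g ∈ insert f (C.erase e), g ∈ 𝓗 ∧ g ⊆ W := fun g hg => by
        rcases mem_insert.1 hg with rfl | hg
        · exact hE _ hf
        · exact hE _ (hC (mem_of_mem_erase hg))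
      obtain ⟨C', hC', hC'4, -, hdeg'⟩ := hW.exists_circuit hv hsp hsub (fun hi => by
        have := card_le_rk hsub hi
        omega)
      obtain rfl : C' = insert f (C.erase e) := eq_of_subset_of_card_le hC' (by omega)
      refine hfC ?_
      have : f = e := by
        refine eq_of_subset_of_card_le (fun a ha => ?_) (by rw [hW.card_useful hf, hW.card_useful (hC he)])
        by_contra hae
        have haW := (hE f hf).2 ha
        have d1 := hdeg a haW
        have d2 := hdeg' a haW
        rw [filter_insert, if_pos ha, card_insert_of_notMem (fun h => hfe (mem_filter.1 h).1),
          filter_erase] at d2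
        have hne : e ∉ ({e ∈ C | a ∈ e} : Finset (Finset α)) := fun h => hae (mem_filter.1 h).2
        rw [erase_eq_of_notMem hne] at d2
        omega
      rwa [this]
    clear_value 𝓔
    subst hEC
    have hds' : ∑ a ∈ {a ∈ W | #(L a) = 1}, #{e ∈ 𝓔 | a ∈ e} = #{a ∈ W | #(L a) = 1} * 2 := by
      rw [sum_congr rfl (fun a ha => hdeg a (mem_filter.1 ha).1), sum_const, smul_eq_mul]
    refine hW.false_of_degree_le_two (fun e he => ?_) fun y hyW hLy => ?_
    · exact h1of (by omega) e (by rw [h𝓔]; exact he)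
    · rw [← h𝓔, hdeg y hyW]

/-- Sparse hypergraphs are list colourable from nonempty lists as long as no edge is stuck. -/
theorem listColourable_of_sparse [Nonempty κ] {B : Finset α} (h3 : ∀ e ∈ 𝓗, #e = 3)
    (hv : ∀ e ∈ 𝓗, ∀ a, v e a ≠ 0 ↔ a ∈ e) (hsp : ∀ U ⊆ B, 2 * rk v 𝓗 U ≤ #U)
    (hne : ∀ a ∈ B, (L a).Nonempty) (hun : Unstuck 𝓗 L B) : ListColourable 𝓗 L B := by
  by_contra hB
  obtain ⟨W, hWB, L', -, hW⟩ := exists_critical h3 hne hun hB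
  exact hW.false_of_sparse hv fun U hU => hsp U (hU.trans hWB)

end TightCritical

section Counting
open Finset

variable {F : Type*} [Field F] [Fintype F] [DecidableEq F]

/-- The hypergraph of nondegenerate Schur triples. -/
def schurHyp (F : Type*) [Field F] [Fintype F] [DecidableEq F] : Finset (Finset F) :=
  (schurPairs F).image schurEdge

lemma mem_schurHyp {e : Finset F} : e ∈ schurHyp F ↔ ∃ z ∈ schurPairs F, schurEdge z = e := by
  rw [schurHyp, mem_image]

open Classical in
/-- The linear relation expressed by a Schur triple. -/
noncomputable def schurVec (e : Finset F) : F → F :=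
  if h : ∃ z ∈ schurPairs F, schurEdge z = e then
    Pi.single h.choose.1 1 + Pi.single h.choose.2 1 - Pi.single (h.choose.1 + h.choose.2) 1
  else 0

lemma exists_schurVec {e : Finset F} (he : e ∈ schurHyp F) : ∃ z ∈ schurPairs F,
    schurEdge z = e ∧
      schurVec e = Pi.single z.1 1 + Pi.single z.2 1 - Pi.single (z.1 + z.2) 1 := by
  have h := mem_schurHyp.1 he
  refine ⟨h.choose, h.choose_spec.1, h.choose_spec.2, ?_⟩
  rw [schurVec, dif_pos h]

lemma card_of_mem_schurHyp (e : Finset F) (he : e ∈ schurHyp F) : #e = 3 := by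
  obtain ⟨z, hz, rfl⟩ := mem_schurHyp.1 he
  exact card_schurEdge hz

lemma schurVec_ne_zero_iff (e : Finset F) (he : e ∈ schurHyp F) (a : F) :
    schurVec e a ≠ 0 ↔ a ∈ e := by
  obtain ⟨z, hz, rfl, hv⟩ := exists_schurVec he
  simp only [schurPairs, mem_filter, mem_univ, true_and] at hz
  obtain ⟨h1, h2, h3⟩ := hz
  have h4 : z.1 ≠ z.1 + z.2 := by simpa using h3
  have h5 : z.2 ≠ z.1 + z.2 := by simpa using h2
  rw [hv, schurEdge]
  simp only [mem_insert, mem_singleton, Pi.add_apply, Pi.sub_apply, Pi.single_apply]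
  by_cases ha : a = z.1
  · subst ha
    simp [h1, h4]
  by_cases hb : a = z.2
  · subst hb
    simp [h1.symm, h5]
  by_cases hc : a = z.1 + z.2
  · subst hc
    simp [h2, h3]
  · simp [ha, hb, hc]

lemma tri_mem_schurHyp {a b c : F} (h : Tri a b c) : ({a, b, c} : Finset F) ∈ schurHyp F := by
  obtain ⟨h1, h2, h3, h⟩ := h
  rw [mem_schurHyp]
  rcases h with rfl | rfl | rfl
  · exact ⟨(a, b), by simpa [schurPairs, h1] using And.intro h3 h2, rfl⟩
  · exact ⟨(a, c), by simpa [schurPairs, h2] using And.intro h3.symm h1, by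
      ext x; simp only [schurEdge, mem_insert, mem_singleton]; tauto⟩
  · exact ⟨(b, c), by simpa [schurPairs, h3] using And.intro h2.symm h1.symm, by
      ext x; simp only [schurEdge, mem_insert, mem_singleton]; tauto⟩

lemma exists_tri_of_mem_schurHyp {e : Finset F} (he : e ∈ schurHyp F) :
    ∃ a b c, Tri a b c ∧ e = {a, b, c} := by
  obtain ⟨z, hz, rfl⟩ := mem_schurHyp.1 he
  simp only [schurPairs, mem_filter, mem_univ, true_and] at hz
  exact ⟨z.1, z.2, z.1 + z.2, ⟨hz.1, by simpa using hz.2.2, by simpa using hz.2.1, Or.inl rfl⟩, rfl⟩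

/-- The rank of the Schur relations inside a set. -/
noncomputable def srk (U : Finset F) : ℕ := rk schurVec (schurHyp F) U

lemma ListColours.proper {κ : Type*} {L : F → Finset κ} {Y : Finset F} {σ : F → κ}
    (h : ListColours (schurHyp F) L Y σ) : Proper σ Y := by
  intro a ha b hb c hc ht ⟨h1, h2⟩
  refine h.2 _ (tri_mem_schurHyp ht) ?_ (σ a) ?_
  · intro x hx
    simp only [mem_insert, mem_singleton] at hx
    rcases hx with rfl | rfl | rfl <;> assumption
  · intro x hx
    simp only [mem_insert, mem_singleton] at hx
    rcases hx with rfl | rfl | rfl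
    · rfl
    · exact h1.symm
    · exact (h1.trans h2).symm

/-- The relation pattern of a triple of indices. -/
def pattern (F : Type*) [Field F] {k : ℕ} (t : Fin k × Fin k × Fin k) : Fin k → F :=
  Pi.single t.1 1 + Pi.single t.2.1 1 - Pi.single t.2.2 1

lemma exists_patterns {k m : ℕ} {f : Fin k → F}
    (hm : m ≤ srk (univ.image f)) : ∃ P : Finset (Fin k × Fin k × Fin k), #P = m ∧
      LinearIndepOn F (pattern F) (P : Set (Fin k × Fin k × Fin k)) ∧
      ∀ t ∈ P, f t.1 + f t.2.1 = f t.2.2 := by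
  classical
  set W := univ.image f with hW
  set S : Set (Finset F) := {e | e ∈ schurHyp F ∧ e ⊆ W} with hS
  obtain ⟨b, hbS, -, hspan, hb⟩ := exists_linearIndepOn_extension
    (K := F) (v := schurVec) (linearIndepOn_empty F _) (Set.empty_subset S)
  have hbfin : b.Finite := Set.toFinite b
  have hcard : m ≤ #hbfin.toFinset := by
    have h1 : Module.finrank F (Submodule.span F (schurVec '' b)) = #hbfin.toFinset := by
      have := Fintype.ofFinite b
      have h2 := finrank_span_eq_card hb
      have h3 : Set.range (fun x : b => schurVec (x : Finset F)) = schurVec '' b := by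
        rw [Set.image_eq_range]
      rw [h3] at h2
      rw [h2, ← Set.toFinset_card]
      congr 1
      ext; simp
    rw [← h1]
    refine hm.trans ?_
    rw [srk, rk]
    refine Submodule.finrank_mono (Submodule.span_le.2 hspan)
  obtain ⟨C, hCb, rfl⟩ := exists_subset_card_eq hcard
  have hCb' : (C : Set (Finset F)) ⊆ b := fun e he => hbfin.mem_toFinset.1 (hCb he)
  have ht : ∀ e : C, ∃ t : Fin k × Fin k × Fin k, f t.1 + f t.2.1 = f t.2.2 ∧
      schurVec e.1 = Pi.single (f t.1) 1 + Pi.single (f t.2.1) 1 - Pi.single (f t.2.2) 1 := by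
    intro e
    obtain ⟨he, heW⟩ := hbS (hCb' e.2)
    obtain ⟨z, hz, hze, hv⟩ := exists_schurVec he
    have hmem : ∀ x ∈ e.1, ∃ i, f i = x := fun x hx => by simpa [hW] using heW hx
    obtain ⟨i, hi⟩ := hmem z.1 (by rw [← hze]; simp [schurEdge])
    obtain ⟨j, hj⟩ := hmem z.2 (by rw [← hze]; simp [schurEdge])
    obtain ⟨l, hl⟩ := hmem (z.1 + z.2) (by rw [← hze]; simp [schurEdge])
    exact ⟨(i, j, l), by simp [hi, hj, hl], by simp [hi, hj, hl, hv]⟩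
  choose t hsum hvec using ht
  let Φ : (Fin k → F) →ₗ[F] (F → F) := LinearMap.lsum F (fun _ : Fin k => F) F
    fun i => LinearMap.single F (fun _ : F => F) (f i)
  have hΦ : ∀ i, Φ (Pi.single i 1) = Pi.single (f i) 1 := fun i => by
    simp only [Φ, LinearMap.lsum_apply, LinearMap.sum_apply, LinearMap.comp_apply,
      LinearMap.proj_apply, LinearMap.coe_single]
    rw [sum_eq_single i (fun j _ hj => by simp [hj]) (fun h => absurd (mem_univ i) h)]
    simp
  have hΦt : ∀ e : C, Φ (pattern F (t e)) = schurVec e.1 := fun e => by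
    rw [pattern, map_sub, map_add, hΦ, hΦ, hΦ, hvec]
  have hli : LinearIndependent F (pattern F ∘ t) := by
    refine LinearIndependent.of_comp Φ ?_
    have := hb.mono hCb'
    have heq : (Φ ∘ pattern F ∘ t) = fun e : C => schurVec e.1 := funext hΦt
    rw [heq]
    exact this
  refine ⟨univ.image t, ?_, ?_, ?_⟩
  · rw [card_image_of_injective _ hli.injective.of_comp, card_univ, Fintype.card_coe]
  · have := LinearIndepOn.image_of_comp (s := Set.univ) t (pattern F) (linearIndepOn_univ_iff.2 hli)
    simpa using this
  · intro x hx
    obtain ⟨e, -, rfl⟩ := mem_image.1 hx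
    exact hsum e

lemma card_solutions_mul {k : ℕ} (P : Finset (Fin k × Fin k × Fin k))
    (hP : LinearIndepOn F (pattern F) (P : Set (Fin k × Fin k × Fin k))) :
    #{f : Fin k → F | ∀ t ∈ P, f t.1 + f t.2.1 = f t.2.2} * Fintype.card F ^ #P =
      Fintype.card F ^ k := by
  classical
  let M : Matrix P (Fin k) F := Matrix.of fun t => pattern F t.1
  have hrank : M.rank = #P := by
    rw [LinearIndependent.rank_matrix (M := M) hP]
    simp
  have hmul : ∀ (f : Fin k → F) (t : P), M.mulVecLin f t = f t.1.1 + f t.1.2.1 - f t.1.2.2 := by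
    intro f t
    change (Pi.single t.1.1 1 + Pi.single t.1.2.1 1 - Pi.single t.1.2.2 1 : Fin k → F) ⬝ᵥ f = _
    simp only [sub_dotProduct, add_dotProduct, single_one_dotProduct]
  have hker : #{f : Fin k → F | ∀ t ∈ P, f t.1 + f t.2.1 = f t.2.2} =
      Nat.card (LinearMap.ker M.mulVecLin) := by
    rw [Nat.card_eq_fintype_card, ← Fintype.card_coe]
    refine Fintype.card_congr (Equiv.subtypeEquivRight fun f => ?_)
    rw [mem_filter, LinearMap.mem_ker, funext_iff]
    simp only [hmul, mem_univ, true_and, Pi.zero_apply, sub_eq_zero, Subtype.forall]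
  have hfr := M.mulVecLin.finrank_range_add_finrank_ker
  rw [show Module.finrank F (LinearMap.range M.mulVecLin) = #P from hrank, Module.finrank_fin_fun]
    at hfr
  rw [hker, Module.natCard_eq_pow_finrank (K := F), Nat.card_eq_fintype_card, ← pow_add]
  congr 1
  omega

lemma card_rank_mul_factorial_le (k m : ℕ) :
    #{W : Finset F | #W = k ∧ m ≤ srk W} * k.factorial * Fintype.card F ^ m ≤
      (k ^ 3).choose m * Fintype.card F ^ k := by
  classical
  have h1 : #{W : Finset F | #W = k ∧ m ≤ srk W} * k.factorial ≤
      #{f : Fin k → F | Function.Injective f ∧ m ≤ srk (univ.image f)} := by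
    set 𝓦 : Finset (Finset F) := {W : Finset F | #W = k ∧ m ≤ srk W} with h𝓦
    have hmem : ∀ W : 𝓦, #W.1 = k ∧ m ≤ srk W.1 := fun W => (mem_filter.1 W.2).2
    let en : ∀ W : 𝓦, W.1 ≃ Fin k := fun W => W.1.equivFinOfCardEq (hmem W).1
    have hcard : #(univ : Finset (𝓦 × Equiv.Perm (Fin k))) = #𝓦 * k.factorial := by
      simp [Fintype.card_perm]
    rw [← hcard]
    let g : 𝓦 × Equiv.Perm (Fin k) → Fin k → F := fun x i => ((en x.1).symm (x.2 i)).1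
    have himg : ∀ x, univ.image (g x) = x.1.1 := fun x => by
      ext a
      simp only [mem_image, mem_univ, true_and, g]
      constructor
      · rintro ⟨i, rfl⟩
        exact ((en x.1).symm (x.2 i)).2
      · intro ha
        exact ⟨x.2.symm (en x.1 ⟨a, ha⟩), by simp⟩
    refine card_le_card_of_injOn g (fun x _ => ?_) (fun x _ y _ hxy => ?_)
    · rw [mem_coe, mem_filter]
      refine ⟨mem_univ _, fun i j hij => ?_, ?_⟩
      · simpa [g, Subtype.val_inj] using hij
      · rw [himg]
        exact (hmem x.1).2
    · obtain ⟨W, σ⟩ := x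
      obtain ⟨W', σ'⟩ := y
      have hWW : W = W' := Subtype.ext (by
        have h1 := himg (W, σ)
        have h2 := himg (W', σ')
        rw [hxy] at h1
        exact h1.symm.trans h2)
      subst hWW
      congr 1
      ext1 i
      have := congrFun hxy i
      simpa [g, Subtype.val_inj] using this
  have h2 : #{f : Fin k → F | Function.Injective f ∧ m ≤ srk (univ.image f)} * Fintype.card F ^ m ≤
      (k ^ 3).choose m * Fintype.card F ^ k := by
    set 𝓠 : Finset (Finset (Fin k × Fin k × Fin k)) := {P ∈ powersetCard m univ |
      LinearIndepOn F (pattern F) (P : Set (Fin k × Fin k × Fin k))} with h𝓠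
    have hsub : {f : Fin k → F | Function.Injective f ∧ m ≤ srk (univ.image f)} ⊆
        ((𝓠.biUnion fun P => {f : Fin k → F | ∀ t ∈ P, f t.1 + f t.2.1 = f t.2.2} :
          Finset (Fin k → F)) : Set (Fin k → F)) := by
      intro f hf
      obtain ⟨P, hP1, hP2, hP3⟩ := exists_patterns hf.2
      simp only [coe_biUnion, Set.mem_iUnion]
      refine ⟨P, mem_filter.2 ⟨mem_powersetCard.2 ⟨subset_univ _, hP1⟩, hP2⟩, ?_⟩
      simpa using fun a b c h => hP3 (a, b, c) h
    have hle : #{f : Fin k → F | Function.Injective f ∧ m ≤ srk (univ.image f)} ≤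
        ∑ P ∈ 𝓠, #{f : Fin k → F | ∀ t ∈ P, f t.1 + f t.2.1 = f t.2.2} :=
      (card_le_card fun f hf => hsub (mem_filter.1 hf).2).trans card_biUnion_le
    refine (Nat.mul_le_mul_right _ hle).trans ?_
    rw [sum_mul, sum_congr rfl (g := fun _ => Fintype.card F ^ k), sum_const, smul_eq_mul]
    · refine Nat.mul_le_mul_right _ ((card_filter_le _ _).trans (le_of_eq ?_))
      rw [card_powersetCard, card_univ]
      simp only [Fintype.card_prod, Fintype.card_fin]
      congr 1
      ring
    · intro P hP
      obtain ⟨hP1, hP2⟩ := mem_filter.1 hP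
      rw [← (mem_powersetCard.1 hP1).2]
      exact card_solutions_mul P hP2
  exact (Nat.mul_le_mul_right _ h1).trans h2

lemma Pr_exists_rank_le {p : ℝ} (h0 : 0 ≤ p) (h1 : p ≤ 1) (k m : ℕ) :
    Pr (univ : Finset F) p (fun Z => ∃ W ⊆ Z, #W = k ∧ m ≤ srk W) ≤
      (k ^ 3).choose m / k.factorial * (p ^ k * Fintype.card F ^ k / Fintype.card F ^ m) := by
  have hle : Pr (univ : Finset F) p (fun Z => ∃ W ⊆ Z, #W = k ∧ m ≤ srk W) ≤
      #{W : Finset F | #W = k ∧ m ≤ srk W} * p ^ k := by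
    refine (Pr_mono h0 h1 (Q := fun Z => ∃ W ∈ ({W : Finset F | #W = k ∧ m ≤ srk W} :
      Finset (Finset F)), W ⊆ Z) fun Z _ ⟨W, hWZ, hW⟩ => ⟨W, by simpa using hW, hWZ⟩).trans ?_
    refine (Pr_exists_le h0 h1 _ _).trans (le_of_eq ?_)
    rw [sum_congr rfl (g := fun _ => p ^ k), sum_const, nsmul_eq_mul]
    intro W hW
    rw [Pr_subset p (subset_univ W), (mem_filter.1 hW).2.1]
  refine hle.trans ?_
  have hc : (0 : ℝ) < Fintype.card F := by exact_mod_cast Fintype.card_pos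
  have h := card_rank_mul_factorial_le (F := F) k m
  have h' : (#{W : Finset F | #W = k ∧ m ≤ srk W} : ℝ) * k.factorial * Fintype.card F ^ m ≤
      (k ^ 3).choose m * Fintype.card F ^ k := by exact_mod_cast h
  have hk : (0 : ℝ) < k.factorial := by positivity
  have h'' : (#{W : Finset F | #W = k ∧ m ≤ srk W} : ℝ) ≤
      (k ^ 3).choose m / k.factorial * (Fintype.card F ^ k / Fintype.card F ^ m) := by
    rw [div_mul_div_comm, le_div_iff₀ (by positivity)]
    linarith
  calc _ ≤ (k ^ 3).choose m / k.factorial * ((Fintype.card F : ℝ) ^ k / Fintype.card F ^ m) * p ^ k :=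
        mul_le_mul_of_nonneg_right h'' (by positivity)
    _ = _ := by ring

lemma exists_dense_of_isSchur {r N : ℕ} [Fact N.Prime] (hr : 2 ≤ r) {Z : Finset (ZMod N)}
    (hZ : IsSchur r N Z) : ∃ W ⊆ Z, W.Nonempty ∧ #W ≤ 2 * srk W := by
  have : Nonempty (Fin r) := ⟨⟨0, by omega⟩⟩
  refine exists_card_le_two_mul_rk (L := fun _ => (univ : Finset (Fin r))) card_of_mem_schurHyp
    schurVec_ne_zero_iff (fun _ _ => univ_nonempty) ?_ ?_
  · intro e _ _ i _ a _ b _ h1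
    rw [card_univ, Fintype.card_fin] at h1
    omega
  · rintro ⟨σ, hσ⟩
    exact isSchur_iff.1 hZ ⟨σ, hσ.proper⟩

lemma choose_cube_div_factorial_le (k : ℕ) (hk : 1 ≤ k) :
    ((k ^ 3).choose ((k + 1) / 2) : ℝ) / k.factorial ≤ (2 * Real.exp 2) ^ k := by
  set m := (k + 1) / 2 with hm
  have h1 : ((k ^ 3).choose m : ℝ) ≤ (k ^ 3 : ℝ) ^ m / m.factorial := by
    have := Nat.choose_le_pow_div (α := ℝ) m (k ^ 3)
    push_cast at this
    exact this
  have h2 := Real.pow_div_factorial_le_exp (k : ℝ) (by positivity) m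
  have h3 := Real.pow_div_factorial_le_exp (k : ℝ) (by positivity) k
  have hk1 : (1 : ℝ) ≤ k := by exact_mod_cast hk
  have h4 : ((k : ℝ) ^ 3) ^ m ≤ k * (k ^ m * k ^ k) := by
    rw [← pow_mul, ← pow_add, ← pow_succ']
    exact pow_le_pow_right₀ hk1 (by omega)
  have h5 : (k : ℝ) ≤ 2 ^ k := by exact_mod_cast Nat.lt_two_pow_self.le
  calc ((k ^ 3).choose m : ℝ) / k.factorial ≤ (k ^ 3 : ℝ) ^ m / m.factorial / k.factorial := by
        gcongr
    _ ≤ (k * (k ^ m * k ^ k)) / m.factorial / k.factorial := by gcongr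
    _ = k * ((k ^ m / m.factorial) * (k ^ k / k.factorial)) := by field_simp
    _ ≤ 2 ^ k * (Real.exp k * Real.exp k) := by gcongr
    _ = (2 * Real.exp 2) ^ k := by
        rw [mul_pow, ← Real.exp_add, ← Real.exp_nat_mul]
        ring_nf

/-- Below a constant multiple of `N ^ (-1/2)` the random set is unlikely to be Schur. -/
theorem exists_lower_density (r : ℕ) (hr : 2 ≤ r) : ∃ c₀ : ℝ, 0 < c₀ ∧ c₀ ≤ 1 ∧
    ∀ (N : ℕ) [Fact N.Prime], Pr (univ : Finset (ZMod N)) (c₀ / √N) (IsSchur r N) ≤ 1 / 4 := by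
  have he : (1 : ℝ) ≤ Real.exp 2 := Real.one_le_exp (by norm_num)
  refine ⟨1 / (16 * Real.exp 2), by positivity, ?_, ?_⟩
  · rw [div_le_one (by positivity)]
    linarith
  intro N hN
  set c : ℝ := 1 / (16 * Real.exp 2) with hc
  have hcpos : 0 < c := by positivity
  have hc1 : c ≤ 1 := by
    rw [hc, div_le_one (by positivity)]
    linarith
  have hN1 : (1 : ℝ) ≤ N := by exact_mod_cast hN.out.one_lt.le
  have hs1 : 1 ≤ √(N : ℝ) := Real.one_le_sqrt.2 hN1
  have hss : √(N : ℝ) ^ 2 = N := Real.sq_sqrt (by linarith)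
  have h0 : 0 ≤ c / √N := by positivity
  have h1 : c / √N ≤ 1 := by
    rw [div_le_one (by positivity)]
    linarith
  have hstep : ∀ k ∈ Icc 1 N, Pr (univ : Finset (ZMod N)) (c / √N)
      (fun Z => ∃ W ⊆ Z, #W = k ∧ (k + 1) / 2 ≤ srk W) ≤ (1 / 8) ^ k := by
    intro k hk
    rw [mem_Icc] at hk
    refine (Pr_exists_rank_le h0 h1 k _).trans ?_
    rw [ZMod.card]
    have hNk : (c / √N) ^ k * (N : ℝ) ^ k / N ^ ((k + 1) / 2) ≤ c ^ k := by
      rw [div_le_iff₀ (by positivity), ← mul_pow,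
        show c / √N * N = c * √N by rw [div_mul_eq_mul_div, div_eq_iff (by positivity), mul_assoc, ← sq, hss],
        mul_pow]
      refine mul_le_mul_of_nonneg_left ?_ (by positivity)
      calc √(N : ℝ) ^ k ≤ √(N : ℝ) ^ (2 * ((k + 1) / 2)) := pow_le_pow_right₀ hs1 (by omega)
        _ = _ := by rw [pow_mul, hss]
    calc _ ≤ (2 * Real.exp 2) ^ k * c ^ k :=
          mul_le_mul (choose_cube_div_factorial_le k hk.1) hNk (by positivity) (by positivity)
      _ = (1 / 8) ^ k := by
          rw [← mul_pow, hc]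
          congr 1
          field_simp
          norm_num
  calc Pr (univ : Finset (ZMod N)) (c / √N) (IsSchur r N) ≤ Pr univ (c / √N)
        (fun Z => ∃ k ∈ Icc 1 N, ∃ W ⊆ Z, #W = k ∧ (k + 1) / 2 ≤ srk W) := by
        refine Pr_mono h0 h1 fun Z _ hZ => ?_
        obtain ⟨W, hWZ, hne, hW⟩ := exists_dense_of_isSchur hr hZ
        refine ⟨#W, mem_Icc.2 ⟨hne.card_pos, ?_⟩, W, hWZ, rfl, by omega⟩
        simpa [ZMod.card] using card_le_univ W
    _ ≤ ∑ k ∈ Icc 1 N, Pr univ (c / √N) (fun Z => ∃ W ⊆ Z, #W = k ∧ (k + 1) / 2 ≤ srk W) :=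
        Pr_exists_le h0 h1 _ _
    _ ≤ ∑ k ∈ Icc 1 N, (1 / 8 : ℝ) ^ k := sum_le_sum hstep
    _ ≤ ∑ k ∈ range (N + 1), (1 / 8 : ℝ) ^ k - 1 := by
        rw [range_eq_Ico, sum_eq_sum_Ico_succ_bot (by omega : 0 < N + 1), pow_zero,
          add_sub_cancel_left]
        rfl
    _ ≤ 1 / 4 := by
        have := (summable_geometric_of_lt_one (r := (1 / 8 : ℝ)) (by norm_num)
          (by norm_num)).sum_le_tsum (range (N + 1)) (fun _ _ => by positivity)
        rw [tsum_geometric_of_lt_one (by norm_num) (by norm_num)] at this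
        norm_num at this ⊢
        linarith

/-- The random set contains a small overly dense configuration, or zero. -/
def HasDense (K : ℕ) (Z : Finset F) : Prop :=
  0 ∈ Z ∨ ∃ W ⊆ Z, #W ≤ K ∧ #W < 2 * srk W

lemma HasDense.mono {K : ℕ} {Z Z' : Finset F} (h : HasDense K Z) (hZ : Z ⊆ Z') : HasDense K Z' := by
  rcases h with h | ⟨W, hW, h⟩
  · exact Or.inl (hZ h)
  · exact Or.inr ⟨W, hW.trans hZ, h⟩

/-- Overly dense configurations are unlikely at the threshold. -/
theorem exists_Pr_dense_le (K : ℕ) (κ : ℝ) (hκ : 0 ≤ κ) : ∃ C : ℝ, 0 ≤ C ∧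
    ∀ (N : ℕ) [Fact N.Prime] (p : ℝ), 0 ≤ p → p ≤ 1 → p ≤ κ / √N →
      Pr (univ : Finset (ZMod N)) p (HasDense K) ≤ C / √N := by
  refine ⟨κ + ∑ k ∈ range (K + 1), (k ^ 3).choose (k / 2 + 1) / k.factorial * κ ^ k,
    by positivity, ?_⟩
  intro N hN p h0 h1 hp
  have hN1 : (1 : ℝ) ≤ N := by exact_mod_cast hN.out.one_lt.le
  have hs1 : 1 ≤ √(N : ℝ) := Real.one_le_sqrt.2 hN1
  have hss : √(N : ℝ) ^ 2 = N := Real.sq_sqrt (by linarith)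
  have hstep : ∀ k ∈ range (K + 1), Pr (univ : Finset (ZMod N)) p
      (fun Z => ∃ W ⊆ Z, #W = k ∧ k / 2 + 1 ≤ srk W) ≤
        ((k ^ 3).choose (k / 2 + 1) / k.factorial * κ ^ k) / √N := by
    intro k hk
    refine (Pr_exists_rank_le h0 h1 k _).trans ?_
    rw [ZMod.card, mul_div_assoc _ (κ ^ k)]
    refine mul_le_mul_of_nonneg_left ?_ (by positivity)
    rw [div_le_div_iff₀ (by positivity) (by positivity), ← mul_pow]
    have h2 : p * N ≤ κ * √N := by
      rw [le_div_iff₀ (by positivity)] at hp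
      calc p * N = (p * √N) * √N := by rw [mul_assoc, ← sq, hss]
        _ ≤ κ * √N := by gcongr
    calc (p * N) ^ k * √(N : ℝ) ≤ (κ * √N) ^ k * √N := by gcongr
      _ = κ ^ k * √(N : ℝ) ^ (k + 1) := by ring
      _ ≤ κ ^ k * √(N : ℝ) ^ (2 * (k / 2 + 1)) := by
          gcongr
          omega
      _ = κ ^ k * (N : ℝ) ^ (k / 2 + 1) := by rw [pow_mul, hss]
  have hzero : Pr (univ : Finset (ZMod N)) p (fun Z => 0 ∈ Z) ≤ κ / √N := by
    have := Pr_subset (X := (univ : Finset (ZMod N))) p (subset_univ ({0} : Finset (ZMod N)))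
    simp only [singleton_subset_iff, card_singleton, pow_one] at this
    rw [this]
    exact hp
  calc Pr (univ : Finset (ZMod N)) p (HasDense K) ≤ Pr univ p (fun Z => 0 ∈ Z ∨
        ∃ k ∈ range (K + 1), ∃ W ⊆ Z, #W = k ∧ k / 2 + 1 ≤ srk W) := by
        refine Pr_mono h0 h1 fun Z _ hZ => hZ.imp id ?_
        rintro ⟨W, hWZ, hWK, hW⟩
        exact ⟨#W, mem_range.2 (by omega), W, hWZ, rfl, by omega⟩
    _ ≤ κ / √N + ∑ k ∈ range (K + 1), ((k ^ 3).choose (k / 2 + 1) / k.factorial * κ ^ k) / √N :=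
        (Pr_or_le h0 h1 _ _).trans (add_le_add hzero ((Pr_exists_le h0 h1 _ _).trans
          (sum_le_sum hstep)))
    _ = _ := by rw [add_div, sum_div]

end Counting

section Cover
open Finset

variable {V : Type*} [Fintype V] [DecidableEq V]

/-- If every set of small value can be improved by many elements, then a random set is unlikely
to contain only sets of small value. -/
lemma Pr_greedy_le {q l g Λ m : ℝ} (h0 : 0 ≤ q) (h1 : q ≤ 1) (hl : 0 < l) (hl1 : l ≤ 1)
    (hg : 0 < g) (hΛ : 0 ≤ Λ) (f : Finset V → ℝ) (hf : 0 ≤ f ∅)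
    (hm : ∀ T, f T < Λ → m ≤ #{w | f T + g ≤ f (insert w T)}) :
    Pr univ q (fun R : Finset V => ∀ T ⊆ R, f T < Λ) ≤
      Real.exp (Λ / g * Real.log l⁻¹ + l * q * Fintype.card V - q * m) := by
  classical
  have hlog : 0 ≤ Real.log l⁻¹ := Real.log_nonneg ((one_le_inv₀ hl).2 hl1)
  set t := ⌊Λ / g⌋₊ with ht
  have hcard : ∀ T : Finset V, g * #T ≤ f T → f T < Λ → #T ≤ t := fun T h h' => by
    refine Nat.le_floor ?_
    rw [le_div_iff₀ hg]
    linarith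
  have hmain := Pr_fingerprint_le (X := (univ : Finset V)) h0 h1
    ({T : Finset V | #T ≤ t ∧ f T < Λ} : Finset (Finset V)) id (fun _ _ => subset_univ _)
    (fun T => {w | f T + g ≤ f (insert w T)}) (fun T _ => ⟨subset_univ _, ?_⟩) ⌈m⌉₊
    (fun T hT => Nat.ceil_le.2 (hm T (mem_filter.1 hT).2.2))
    (P := fun R : Finset V => ∀ T ⊆ R, f T < Λ) ?_
  · refine hmain.trans ?_
    have hsum : ∑ T ∈ ({T : Finset V | #T ≤ t ∧ f T < Λ} : Finset (Finset V)), q ^ #(id T) ≤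
        (l⁻¹) ^ t * Real.exp (l * q * #(univ : Finset V)) := by
      refine le_trans ?_ (sum_pow_card_le univ h0 hl hl1 t)
      refine sum_le_sum_of_subset_of_nonneg ?_ fun _ _ _ => by positivity
      intro T hT
      simp only [mem_filter, mem_univ, true_and] at hT
      simp [hT.1]
    refine (mul_le_mul_of_nonneg_right hsum (pow_nonneg (by linarith) _)).trans ?_
    refine (inv_pow_mul_exp_mul_pow_le hl h1 t ⌈m⌉₊).trans (Real.exp_le_exp.2 ?_)
    have e1 : (t : ℝ) * Real.log l⁻¹ ≤ Λ / g * Real.log l⁻¹ :=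
      mul_le_mul_of_nonneg_right (Nat.floor_le (by positivity)) hlog
    have e2 : q * m ≤ q * ⌈m⌉₊ := mul_le_mul_of_nonneg_left (Nat.le_ceil m) h0
    rw [card_univ]
    linarith
  · refine disjoint_left.2 fun w hw hw' => ?_
    have := (mem_filter.1 hw').2
    rw [insert_eq_of_mem (show w ∈ T from hw)] at this
    linarith
  · intro R _ hR
    obtain ⟨T, hT, hmax⟩ := exists_max_image ({T ∈ R.powerset | g * #T ≤ f T} : Finset (Finset V))
      card ⟨∅, by simpa using hf⟩
    rw [mem_filter, mem_powerset] at hT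
    refine ⟨T, by simpa using ⟨hcard T hT.2 (hR T hT.1), hR T hT.1⟩, hT.1,
      disjoint_left.2 fun w hwR hw => ?_⟩
    have hw' := (mem_filter.1 hw).2
    have hwT : w ∉ T := fun h => by
      rw [insert_eq_of_mem h] at hw'
      linarith
    have := hmax (insert w T) (by
      rw [mem_filter, mem_powerset, card_insert_of_notMem hwT]
      refine ⟨insert_subset hwR hT.1, ?_⟩
      push_cast
      linarith [hT.2])
    rw [card_insert_of_notMem hwT] at this
    omega

/-- The values of `h` on the pairs of `E` spanned by `R` and `S`. -/
def cov (E : Finset (V × V)) (h : V → V → V) (R S : Finset V) : Finset V :=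
  {e ∈ E | e.1 ∈ R ∧ e.2 ∈ S}.image fun e => h e.1 e.2

lemma mem_cov {E : Finset (V × V)} {h : V → V → V} {R S : Finset V} {x : V} :
    x ∈ cov E h R S ↔ ∃ u w, (u, w) ∈ E ∧ u ∈ R ∧ w ∈ S ∧ h u w = x := by
  simp only [cov, mem_image, mem_filter, Prod.exists]
  tauto

lemma cov_mono {E : Finset (V × V)} {h : V → V → V} {R S R' S' : Finset V} (hR : R ⊆ R')
    (hS : S ⊆ S') : cov E h R S ⊆ cov E h R' S' := fun x hx => by
  obtain ⟨u, w, h1, h2, h3, h4⟩ := mem_cov.1 hx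
  exact mem_cov.2 ⟨u, w, h1, hR h2, hS h3, h4⟩

/-- Few covered points leave many elements covering many new points. -/
lemma card_useful_ge {ρ : ℝ} (hρ : 0 < ρ) (E : Finset (V × V)) (h : V → V → V)
    (h1 : ∀ u w w', (u, w) ∈ E → (u, w') ∈ E → h u w = h u w' → w = w')
    (h2 : ∀ u u' w, (u, w) ∈ E → (u', w) ∈ E → h u w = h u' w → u = u')
    (R : Finset V) (hR : ∀ u ∈ R, ρ * Fintype.card V / 2 ≤ #{w | (u, w) ∈ E}) (hRne : R.Nonempty)
    (T : Finset V) (hT : (#(cov E h R T) : ℝ) < ρ / 4 * Fintype.card V) :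
    ρ / 8 * Fintype.card V ≤
      #{w | (#(cov E h R T) : ℝ) + ρ / 8 * #R ≤ #(cov E h R (insert w T))} := by
  classical
  set n : ℝ := (Fintype.card V : ℝ) with hn
  set C := cov E h R T with hC
  let d : V → ℕ := fun w => #{u ∈ R | (u, w) ∈ E ∧ h u w ∉ C}
  have hd : ∀ w, #C + d w ≤ #(cov E h R (insert w T)) := by
    intro w
    have hinj : #({u ∈ R | (u, w) ∈ E ∧ h u w ∉ C}.image fun u => h u w) = d w := by
      refine card_image_of_injOn fun u hu u' hu' huu => ?_
      rw [mem_coe, mem_filter] at hu hu'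
      exact h2 u u' w hu.2.1 hu'.2.1 huu
    rw [← hinj, ← card_union_of_disjoint]
    · refine card_le_card (union_subset (cov_mono Subset.rfl (subset_insert _ _)) ?_)
      intro x hx
      obtain ⟨u, hu, rfl⟩ := mem_image.1 hx
      rw [mem_filter] at hu
      exact mem_cov.2 ⟨u, w, hu.2.1, hu.1, mem_insert_self _ _, rfl⟩
    · refine disjoint_left.2 fun x hxC hx => ?_
      obtain ⟨u, hu, rfl⟩ := mem_image.1 hx
      exact (mem_filter.1 hu).2.2 hxC
  have hdR : ∀ w, d w ≤ #R := fun w => card_filter_le _ _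
  have hsum : (ρ / 4 * n) * #R ≤ ∑ w, (d w : ℝ) := by
    have hsw : ∑ w, d w = ∑ u ∈ R, #{w | (u, w) ∈ E ∧ h u w ∉ C} := by
      have := sum_card_bipartiteAbove_eq_sum_card_bipartiteBelow (s := R) (t := (univ : Finset V))
        (fun u w => (u, w) ∈ E ∧ h u w ∉ C)
      simp only [bipartiteAbove, bipartiteBelow] at this
      exact this.symm
    have hu : ∀ u ∈ R, ρ / 4 * n ≤ (#{w | (u, w) ∈ E ∧ h u w ∉ C} : ℝ) := by
      intro u hu
      have e1 := hR u hu
      have e2 : #{w | (u, w) ∈ E} ≤ #{w | (u, w) ∈ E ∧ h u w ∉ C} + #C := by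
        have e3 : #{w | (u, w) ∈ E ∧ h u w ∈ C} ≤ #C :=
          card_filter_le_of_injOn _ _ (h u) C (fun w _ hw => hw.2)
            fun w _ hw w' _ hw' hww => h1 u w w' hw.1 hw'.1 hww
        have e4 := card_filter_add_card_filter_not (s := ({w | (u, w) ∈ E} : Finset V))
          (fun w => h u w ∉ C)
        simp only [filter_filter, not_not] at e4
        omega
      have e5 : (#{w | (u, w) ∈ E} : ℝ) ≤ #{w | (u, w) ∈ E ∧ h u w ∉ C} + #C := by
        exact_mod_cast e2
      linarith
    have := card_nsmul_le_sum R (fun u => (#{w | (u, w) ∈ E ∧ h u w ∉ C} : ℝ)) _ hu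
    rw [nsmul_eq_mul] at this
    have e6 : (∑ w, (d w : ℝ)) = ∑ u ∈ R, (#{w | (u, w) ∈ E ∧ h u w ∉ C} : ℝ) := by
      exact_mod_cast hsw
    linarith
  have hRpos : (0 : ℝ) < #R := by exact_mod_cast hRne.card_pos
  set M : Finset V := {w | ρ / 8 * #R ≤ d w} with hM
  have hup : ∑ w, (d w : ℝ) ≤ #M * #R + n * (ρ / 8 * #R) := by
    have hw : ∀ w, (d w : ℝ) ≤ (if w ∈ M then (#R : ℝ) else 0) + ρ / 8 * #R := by
      intro w
      by_cases hwM : w ∈ M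
      · rw [if_pos hwM]
        have : (d w : ℝ) ≤ #R := by exact_mod_cast hdR w
        have : 0 ≤ ρ / 8 * #R := by positivity
        linarith
      · rw [if_neg hwM]
        have : ¬ ρ / 8 * #R ≤ d w := by simpa [hM] using hwM
        linarith
    refine (sum_le_sum fun w _ => hw w).trans (le_of_eq ?_)
    rw [sum_add_distrib, ← sum_filter, sum_const, sum_const, nsmul_eq_mul, nsmul_eq_mul, card_univ,
      ← hn]
    simp
  have hMle : ρ / 8 * n ≤ #M := by
    have : (ρ / 8 * n) * #R ≤ #M * #R := by linarith
    exact le_of_mul_le_mul_right this hRpos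
  refine hMle.trans (Nat.cast_le.2 (card_le_card fun w hw => ?_))
  rw [mem_filter] at hw ⊢
  refine ⟨mem_univ _, ?_⟩
  have : (#C + d w : ℝ) ≤ #(cov E h R (insert w T)) := by exact_mod_cast hd w
  linarith [hw.2]

set_option maxHeartbeats 1000000 in
/-- Two sparse random rounds cover a positive proportion of a dense linear-type configuration. -/
lemma exists_cover (ρ ε : ℝ) (hρ : 0 < ρ) (hρ1 : ρ ≤ 1) (hε : 0 < ε) :
    ∃ δ > 0, ∃ c > 0, ∃ N₀ : ℕ, ∀ (V : Type) [Fintype V] [DecidableEq V] (N : ℕ),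
      Fintype.card V = N → N₀ ≤ N → ∀ (E : Finset (V × V)) (h : V → V → V),
      (∀ u w w', (u, w) ∈ E → (u, w') ∈ E → h u w = h u w' → w = w') →
      (∀ u u' w, (u, w) ∈ E → (u', w) ∈ E → h u w = h u' w → u = u') →
      ρ * N ^ 2 ≤ #E →
      Ex univ (ε / √N) (fun R => Pr univ (ε / √N) fun S => (#(cov E h R S) : ℝ) < δ * N) ≤
        2 * Real.exp (-(c * √N)) := by
  have hL1 : 0 ≤ Real.log (ρ / 8)⁻¹ :=
    Real.log_nonneg ((one_le_inv₀ (by positivity)).2 (by linarith))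
  have hL2 : 0 ≤ Real.log (ρ / 16)⁻¹ :=
    Real.log_nonneg ((one_le_inv₀ (by positivity)).2 (by linarith))
  set L1 := Real.log (ρ / 8)⁻¹ with hL1d
  set L2 := Real.log (ρ / 16)⁻¹ with hL2d
  obtain ⟨σ, hσ, hσL⟩ : ∃ σ > 0, 2 * σ * L1 ≤ ρ * ε / 16 := by
    refine ⟨ρ * ε / 32 / (L1 + 1), by positivity, ?_⟩
    have : ρ * ε / 32 / (L1 + 1) * (L1 + 1) = ρ * ε / 32 := div_mul_cancel₀ _ (by positivity)
    have h2 : 0 < ρ * ε / 32 / (L1 + 1) := by positivity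
    nlinarith
  obtain ⟨δ, hδ, hδρ, hδL⟩ : ∃ δ > 0, δ ≤ ρ / 4 ∧ 8 * δ / (σ * ρ) * L2 ≤ ρ * ε / 32 := by
    refine ⟨min (ρ / 4) (ρ * ε / 32 * (σ * ρ) / 8 / (L2 + 1)), by positivity, min_le_left _ _, ?_⟩
    have h1 := min_le_right (ρ / 4) (ρ * ε / 32 * (σ * ρ) / 8 / (L2 + 1))
    set δ := min (ρ / 4) (ρ * ε / 32 * (σ * ρ) / 8 / (L2 + 1))
    have hδ : 0 < δ := by positivity
    rw [le_div_iff₀ (by positivity)] at h1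
    rw [div_mul_eq_mul_div, div_le_iff₀ (by positivity)]
    nlinarith
  obtain ⟨N₁, hN₁⟩ := exists_nat_ge (max (max (1 / σ ^ 2) (ε ^ 2)) ((8 * σ / ρ) ^ 2))
  refine ⟨δ, hδ, ρ * ε / 32, by positivity, N₁ + 1, ?_⟩
  intro V _ _ N hN hN₀ E h h1 h2 hE
  have hNpos : (0 : ℝ) < N := by exact_mod_cast (show 0 < N by omega)
  have hN₁N : ((N₁ : ℕ) : ℝ) ≤ N := by exact_mod_cast (show N₁ ≤ N by omega)
  have hs := Real.sqrt_pos.2 hNpos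
  have hsq : √(N : ℝ) * √N = N := Real.mul_self_sqrt hNpos.le
  have hb := max_le_iff.1 (hN₁.trans hN₁N)
  have hσN : 1 ≤ σ * √N := by
    have := (max_le_iff.1 hb.1).1
    rw [div_le_iff₀ (by positivity)] at this
    refine (one_le_sq_iff₀ (by positivity)).1 ?_
    rw [mul_pow, Real.sq_sqrt hNpos.le]
    linarith
  have hεN : ε ≤ √N := Real.le_sqrt_of_sq_le (max_le_iff.1 hb.1).2
  have hσρ : 8 * σ / ρ ≤ √N := Real.le_sqrt_of_sq_le hb.2
  rw [div_le_iff₀ hρ] at hσρ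
  set q := ε / √N with hq
  have hq0 : 0 ≤ q := by positivity
  have hq1 : q ≤ 1 := (div_le_one hs).2 hεN
  have hqN : q * N = ε * √N := by
    rw [hq, div_mul_eq_mul_div, div_eq_iff hs.ne', mul_assoc, hsq]
  set s := ⌈σ * √N⌉₊ with hsd
  have hs1 : σ * √N ≤ s := Nat.le_ceil _
  have hs2 : (s : ℝ) ≤ 2 * (σ * √N) := by
    have := (Nat.ceil_lt_add_one (show 0 ≤ σ * √N by positivity)).le
    linarith
  have hs3 : (s : ℝ) ≤ ρ / 4 * N := by nlinarith
  set U : Finset V := {u | ρ * Fintype.card V / 2 ≤ #{w | (u, w) ∈ E}} with hU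
  have hUcard : ρ / 2 * N ≤ #U := by
    have hEs : #E = ∑ u, #{w | (u, w) ∈ E} := by
      rw [← card_sigma]
      refine card_nbij' (fun e => ⟨e.1, e.2⟩) (fun e => (e.1, e.2)) ?_ ?_ ?_ ?_ <;>
        · intro e; simp
    have hw : ∀ u, (#{w | (u, w) ∈ E} : ℝ) ≤ (if u ∈ U then (N : ℝ) else 0) + ρ * N / 2 := by
      intro u
      by_cases hu : u ∈ U
      · rw [if_pos hu]
        have : (#{w | (u, w) ∈ E} : ℝ) ≤ N := by
          rw [← hN]; exact_mod_cast card_le_univ _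
        have : 0 ≤ ρ * N / 2 := by positivity
        linarith
      · rw [if_neg hu]
        have : ¬ ρ * Fintype.card V / 2 ≤ (#{w | (u, w) ∈ E} : ℝ) := by simpa [hU] using hu
        rw [hN] at this
        linarith
    have hle : (#E : ℝ) ≤ #U * N + N * (ρ * N / 2) := by
      rw [hEs]
      push_cast
      refine (sum_le_sum fun u _ => hw u).trans (le_of_eq ?_)
      rw [sum_add_distrib, ← sum_filter, sum_const, sum_const, nsmul_eq_mul, nsmul_eq_mul,
        card_univ, hN]
      simp
    have : (ρ / 2 * N) * N ≤ #U * N := by nlinarith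
    exact le_of_mul_le_mul_right this hNpos
  set bad : Finset V → Prop := fun R => ∀ T ⊆ R, (#(T ∩ U) : ℝ) < s with hbad
  have hround1 : Pr univ q bad ≤ Real.exp (-(ρ * ε / 32 * √N)) := by
    refine (Pr_greedy_le (l := ρ / 8) (g := 1) (Λ := s) (m := ρ / 4 * N) hq0 hq1 (by positivity)
      (by linarith) one_pos (by positivity) (fun T => (#(T ∩ U) : ℝ)) (by positivity) ?_).trans ?_
    · intro T hT
      have e1 : #U ≤ #(U \ T) + #(T ∩ U) := by
        have := card_sdiff_add_card_inter U T
        rw [inter_comm] at this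
        omega
      have e2 : (#U : ℝ) ≤ #(U \ T) + #(T ∩ U) := by exact_mod_cast e1
      have e3 : #(U \ T) ≤ #{w | (#(T ∩ U) : ℝ) + 1 ≤ #(insert w T ∩ U)} := by
        refine card_le_card fun w hw => ?_
        rw [Finset.mem_sdiff] at hw
        refine mem_filter.2 ⟨mem_univ _, ?_⟩
        rw [insert_inter_of_mem hw.1, card_insert_of_notMem (fun h => hw.2 (mem_inter.1 h).1)]
        push_cast
        exact le_rfl
      have e4 : (#(U \ T) : ℝ) ≤ #{w | (#(T ∩ U) : ℝ) + 1 ≤ #(insert w T ∩ U)} := by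
        exact_mod_cast e3
      linarith
    · rw [hN]
      refine Real.exp_le_exp.2 ?_
      rw [← hL1d, div_one]
      have e1 : (s : ℝ) * L1 ≤ ρ * ε / 16 * √N := by
        have := mul_le_mul_of_nonneg_right hs2 hL1
        nlinarith
      have e2 : ρ / 8 * q * N = ρ / 8 * (ε * √N) := by rw [mul_assoc, hqN]
      have e3 : q * (ρ / 4 * N) = ρ / 4 * (ε * √N) := by rw [← hqN]; ring
      have : 0 < ρ * ε * √N := by positivity
      rw [e2, e3]
      nlinarith
  have hround2 : ∀ R, ¬ bad R → Pr univ q (fun S => (#(cov E h R S) : ℝ) < δ * N) ≤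
      Real.exp (-(ρ * ε / 32 * √N)) := by
    intro R hR
    simp only [hbad, not_forall, not_lt] at hR
    obtain ⟨T₀, hT₀, hs4⟩ := hR
    set R₁ := T₀ ∩ U with hR₁
    have hR₁R : R₁ ⊆ R := inter_subset_left.trans hT₀
    have hR₁pos : (0 : ℝ) < #R₁ := (mul_pos hσ hs).trans_le (hs1.trans hs4)
    have hcovle : ∀ T S, T ⊆ S → (#(cov E h R₁ T) : ℝ) ≤ #(cov E h R S) := fun T S hTS => by
      exact_mod_cast card_le_card (cov_mono hR₁R hTS)
    refine (Pr_mono hq0 hq1 (Q := fun S => ∀ T ⊆ S, (#(cov E h R₁ T) : ℝ) < δ * N)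
      fun S _ hS T hT => (hcovle T S hT).trans_lt hS).trans ?_
    refine (Pr_greedy_le (l := ρ / 16) (g := ρ / 8 * s) (Λ := δ * N) (m := ρ / 8 * N) hq0 hq1
      (by positivity) (by linarith) (by
        have : 0 < σ * √N := by positivity
        have : (0 : ℝ) < s := by linarith
        positivity) (by positivity) (fun T => (#(cov E h R₁ T) : ℝ)) (by positivity) ?_).trans ?_
    · intro T hT
      have hu := card_useful_ge hρ E h h1 h2 R₁
        (fun u hu => (mem_filter.1 (mem_inter.1 hu).2).2) (card_pos.1 (by exact_mod_cast hR₁pos)) T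
        (by rw [hN]; nlinarith)
      rw [hN] at hu
      refine hu.trans ?_
      have : #{w | (#(cov E h R₁ T) : ℝ) + ρ / 8 * #R₁ ≤ #(cov E h R₁ (insert w T))} ≤
          #{w | (#(cov E h R₁ T) : ℝ) + ρ / 8 * s ≤ #(cov E h R₁ (insert w T))} := by
        refine card_le_card fun w hw => ?_
        rw [mem_filter] at hw ⊢
        refine ⟨hw.1, ?_⟩
        nlinarith [hw.2]
      exact_mod_cast this
    · rw [hN]
      refine Real.exp_le_exp.2 ?_
      rw [← hL2d]
      have e1 : δ * N / (ρ / 8 * s) ≤ 8 * δ / (σ * ρ) * √N := by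
        have : 0 < σ * √N := by positivity
        rw [div_le_iff₀ (mul_pos (by positivity) (by linarith))]
        have e : δ * N = 8 * δ / (σ * ρ) * √N * (ρ / 8 * (σ * √N)) := by
          have : 8 * δ / (σ * ρ) * √N * (ρ / 8 * (σ * √N)) = δ * (√N * √N) := by field_simp
          rw [this, hsq]
        rw [e]
        gcongr
      have e1' : δ * N / (ρ / 8 * s) * L2 ≤ ρ * ε / 32 * √N := by
        refine (mul_le_mul_of_nonneg_right e1 hL2).trans ?_
        have := mul_le_mul_of_nonneg_right hδL hs.le
        linarith
      have e2 : ρ / 16 * q * N = ρ / 16 * (ε * √N) := by rw [mul_assoc, hqN]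
      have e3 : q * (ρ / 8 * N) = ρ / 8 * (ε * √N) := by rw [← hqN]; ring
      rw [e2, e3]
      linarith
  calc Ex univ q (fun R => Pr univ q fun S => (#(cov E h R S) : ℝ) < δ * N)
      ≤ Ex univ q (fun R => ind (bad R) + Real.exp (-(ρ * ε / 32 * √N))) := by
        refine Ex_mono hq0 hq1 fun R _ => ?_
        by_cases hR : bad R
        · rw [ind_pos hR]
          have := Pr_le_one (X := univ) hq0 hq1 (P := fun S => (#(cov E h R S) : ℝ) < δ * N)
          have := Real.exp_pos (-(ρ * ε / 32 * √N))
          linarith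
        · rw [ind_neg hR, zero_add]
          exact hround2 R hR
    _ = Pr univ q bad + Real.exp (-(ρ * ε / 32 * √N)) := by
        rw [Ex_add, Ex_const]; rfl
    _ ≤ _ := by linarith

end Cover

section Extension
open Finset

lemma Pr_le_three_rounds {α : Type*} [DecidableEq α] (X : Finset α) {P : Finset α → Prop}
    (hP : ∀ S T, S ⊆ T → P T → P S) {q s : ℝ} (hs : 0 ≤ s) (hsq : 3 * s ≤ q) (hq : q ≤ 1) :
    Pr X q P ≤ Ex X s fun R => Ex X s fun S => Pr X s fun T => P (R ∪ S ∪ T) := by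
  have hs1 : s ≤ 1 / 3 := by linarith
  have h1 : 0 ≤ s + s - s * s := by nlinarith
  have h2 : s + s - s * s ≤ 2 * s := by nlinarith
  have h3 : 0 ≤ (s + s - s * s) + s - (s + s - s * s) * s := by nlinarith
  have h4 : (s + s - s * s) + s - (s + s - s * s) * s ≤ q := by nlinarith
  have := Pr_mono_density (X := X) (P := fun S => ¬ P S)
    (fun S T hST hS hT => hS (hP S T hST hT)) h3 h4 hq
  rw [Pr_not, Pr_not] at this
  have h5 : Pr X ((s + s - s * s) + s - (s + s - s * s) * s) P =
      Ex X s fun R => Ex X s fun S => Pr X s fun T => P (R ∪ S ∪ T) := by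
    unfold Pr
    rw [Ex_union, Ex_union]
  linarith

instance Tri.instDecidable {F : Type*} [Add F] [DecidableEq F] (a b c : F) :
    Decidable (Tri a b c) := by
  unfold Tri
  infer_instance

variable {F : Type*} [Field F]

lemma exists_tri_of_mem_edge [Fintype F] [DecidableEq F] {e : Finset F} (he : e ∈ schurHyp F)
    {a b : F} (ha : a ∈ e) (hb : b ∈ e) (hab : a ≠ b) : ∃ c ∈ e, Tri a b c := by
  obtain ⟨x, y, z, ⟨h1, h2, h3, h⟩, rfl⟩ := exists_tri_of_mem_schurHyp he
  simp only [mem_insert, mem_singleton] at ha hb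
  rcases ha with rfl | rfl | rfl <;> rcases hb with rfl | rfl | rfl <;>
    first
    | exact absurd rfl hab
    | exact ⟨z, by simp, by unfold Tri; grind⟩
    | exact ⟨y, by simp, by unfold Tri; grind⟩
    | exact ⟨x, by simp, by unfold Tri; grind⟩

lemma Tri.exists_signs {a b c : F} (h : Tri a b c) : ∃ s t : F, s ≠ 0 ∧ t ≠ 0 ∧
    s * a + t * b = c ∧ ∀ u w, u ≠ w → u ≠ s * u + t * w → w ≠ s * u + t * w →
      Tri u w (s * u + t * w) := by
  obtain ⟨-, -, -, h | h | h⟩ := h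
  · exact ⟨1, 1, one_ne_zero, one_ne_zero, by simpa using h,
      fun u w h1 h2 h3 => ⟨h1, h2, h3, Or.inl (by ring)⟩⟩
  · exact ⟨-1, 1, neg_ne_zero.2 one_ne_zero, one_ne_zero, by rw [← h]; ring,
      fun u w h1 h2 h3 => ⟨h1, h2, h3, Or.inr (Or.inl (by ring))⟩⟩
  · exact ⟨1, -1, one_ne_zero, neg_ne_zero.2 one_ne_zero, by rw [← h]; ring,
      fun u w h1 h2 h3 => ⟨h1, h2, h3, Or.inr (Or.inr (by ring))⟩⟩

/-- A dense set contains many dilates of a given Schur triple. -/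
lemma exists_many_dilated_tri (δ : ℝ) (hδ : 0 < δ) : ∃ ρ > 0, ρ ≤ 1 ∧ ∃ N₀ : ℕ,
    ∀ (F : Type) [Field F] [Fintype F] [DecidableEq F] (X : Finset F) (a b c s t : F),
      N₀ ≤ Fintype.card F → δ * Fintype.card F ≤ #X →
      a ≠ 0 → b ≠ 0 → c ≠ 0 → s ≠ 0 → t ≠ 0 → s * a + t * b = c →
      (∀ u w, u ≠ w → u ≠ s * u + t * w → w ≠ s * u + t * w → Tri u w (s * u + t * w)) →
      ρ * (Fintype.card F : ℝ) ^ 2 ≤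
        #({e | e.1 / a ∈ X ∧ e.2 / b ∈ X ∧ (s * e.1 + t * e.2) / c ∈ X ∧
          Tri e.1 e.2 (s * e.1 + t * e.2)} : Finset (F × F)) := by
  obtain ⟨ρ, hρ, hroth⟩ := exists_many_solutions δ hδ
  obtain ⟨N₀, hN₀⟩ := exists_nat_ge (6 / ρ)
  refine ⟨min (ρ / 2) 1, by positivity, min_le_right _ _, N₀, ?_⟩
  intro F _ _ _ X a b c s t hN hX ha hb hc hs ht hsum htri
  have h1 := hroth F X (s * a) (t * b) c (mul_ne_zero hs ha) (mul_ne_zero ht hb) hc hsum hX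
  have hNr : 6 / ρ ≤ (Fintype.card F : ℝ) := hN₀.trans (by exact_mod_cast hN)
  rw [div_le_iff₀ hρ] at hNr
  set E : Finset (F × F) := {e | e.1 / a ∈ X ∧ e.2 / b ∈ X ∧ (s * e.1 + t * e.2) / c ∈ X ∧
    Tri e.1 e.2 (s * e.1 + t * e.2)} with hE
  set P₁ : Finset (F × F) := {e | e.1 = e.2}
  set P₂ : Finset (F × F) := {e | e.1 = s * e.1 + t * e.2}
  set P₃ : Finset (F × F) := {e | e.2 = s * e.1 + t * e.2}
  have hP₁ : #P₁ ≤ Fintype.card F := by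
    rw [← card_univ]
    exact card_filter_le_of_injOn _ _ Prod.fst univ (fun _ _ _ => mem_univ _)
      fun e _ he f _ hf hef => Prod.ext hef (by rw [← he, ← hf, hef])
  have hP₂ : #P₂ ≤ Fintype.card F := by
    rw [← card_univ]
    refine card_filter_le_of_injOn _ _ Prod.fst univ (fun _ _ _ => mem_univ _)
      fun e _ he f _ hf hef => Prod.ext hef ?_
    rw [hef] at he
    have : t * e.2 = t * f.2 := by linear_combination hf - he
    exact mul_left_cancel₀ ht this
  have hP₃ : #P₃ ≤ Fintype.card F := by
    rw [← card_univ]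
    refine card_filter_le_of_injOn _ _ Prod.snd univ (fun _ _ _ => mem_univ _)
      fun e _ he f _ hf hef => Prod.ext ?_ hef
    rw [hef] at he
    have : s * e.1 = s * f.1 := by linear_combination hf - he
    exact mul_left_cancel₀ hs this
  have h2 : #{t' ∈ X ×ˢ X ×ˢ X | s * a * t'.1 + t * b * t'.2.1 = c * t'.2.2} ≤
      #(E ∪ (P₁ ∪ (P₂ ∪ P₃))) := by
    refine card_filter_le_of_injOn _ _ (fun t' => (a * t'.1, b * t'.2.1)) _ ?_ ?_
    · rintro ⟨x, y, z⟩ hm h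
      simp only [mem_product] at hm h
      have e1 : s * (a * x) + t * (b * y) = c * z := by rw [← h]; ring
      by_cases g1 : a * x = b * y
      · simp [P₁, g1]
      by_cases g2 : a * x = s * (a * x) + t * (b * y)
      · exact mem_union_right _ (mem_union_right _ (mem_union_left _ (by simpa [P₂] using g2)))
      by_cases g3 : b * y = s * (a * x) + t * (b * y)
      · exact mem_union_right _ (mem_union_right _ (mem_union_right _ (by simpa [P₃] using g3)))
      refine mem_union_left _ (mem_filter.2 ⟨mem_univ _, ?_, ?_, ?_, htri _ _ g1 g2 g3⟩)
      · simpa [ha] using hm.1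
      · simpa [hb] using hm.2.1
      · rw [e1]; simpa [hc] using hm.2.2
    · rintro ⟨x, y, z⟩ - h ⟨x', y', z'⟩ - h' hxy
      simp only [Prod.mk.injEq] at hxy h h' ⊢
      have e1 := mul_left_cancel₀ ha hxy.1
      have e2 := mul_left_cancel₀ hb hxy.2
      subst e1 e2
      exact ⟨rfl, rfl, mul_left_cancel₀ hc (h.symm.trans h')⟩
  have h3 : #(E ∪ (P₁ ∪ (P₂ ∪ P₃))) ≤ #E + (#P₁ + (#P₂ + #P₃)) :=
    (card_union_le _ _).trans (Nat.add_le_add_left ((card_union_le _ _).trans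
      (Nat.add_le_add_left (card_union_le _ _) _)) _)
  have h4 : (#{t' ∈ X ×ˢ X ×ˢ X | s * a * t'.1 + t * b * t'.2.1 = c * t'.2.2} : ℝ) ≤
      #E + 3 * Fintype.card F := by
    exact_mod_cast (show _ ≤ #E + 3 * Fintype.card F by omega)
  have h5 : min (ρ / 2) 1 * (Fintype.card F : ℝ) ^ 2 ≤ ρ / 2 * (Fintype.card F : ℝ) ^ 2 :=
    mul_le_mul_of_nonneg_right (min_le_left _ _) (by positivity)
  have h6 : (0 : ℝ) ≤ Fintype.card F := by positivity
  nlinarith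

set_option maxHeartbeats 1000000 in
lemma extension_bound_aux (r : ℕ) (hr : 0 < r) (k : ℕ) : ∀ δ ε : ℝ, 0 < δ → 0 < ε →
    ∃ A > 0, ∃ c > 0, ∃ N₀ : ℕ, ∀ (N : ℕ) [Fact N.Prime], N₀ ≤ N →
    ∀ (B X Y : Finset (ZMod N)) (L : ZMod N → Finset (Fin r)) (𝓕 : (ZMod N → Fin r) → Prop),
      ∑ b ∈ B, #(L b) ≤ k → 0 ∉ B → (∀ U ⊆ B, 2 * srk U ≤ #U) →
      ¬ ListColourable (schurHyp (ZMod N)) L B → δ * N ≤ #X →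
      (∀ x ∈ X, ∀ b ∈ B, ∀ φ, 𝓕 φ → Proper φ (insert (x * b) Y) → φ (x * b) ∈ L b) →
      Pr univ (ε / √N) (fun R => ∃ φ, 𝓕 φ ∧ Proper φ (Y ∪ R)) ≤ A * Real.exp (-(c * √N)) := by
  have hne : Nonempty (Fin r) := ⟨⟨0, hr⟩⟩
  have hempty : ∀ δ ε : ℝ, 0 < δ → 0 < ε → ∀ (N : ℕ) [Fact N.Prime], ε ^ 2 ≤ N →
      ∀ (B X Y : Finset (ZMod N)) (L : ZMod N → Finset (Fin r)) (𝓕 : (ZMod N → Fin r) → Prop),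
      0 ∉ B → δ * N ≤ #X →
      (∀ x ∈ X, ∀ b ∈ B, ∀ φ, 𝓕 φ → Proper φ (insert (x * b) Y) → φ (x * b) ∈ L b) →
      (∃ b ∈ B, L b = ∅) →
      Pr univ (ε / √N) (fun R => ∃ φ, 𝓕 φ ∧ Proper φ (Y ∪ R)) ≤ Real.exp (-(ε * δ * √N)) := by
    intro δ ε hδ hε N _ hεN B X Y L 𝓕 h0 hX hL ⟨b, hb, hLb⟩
    have hNpos : (0 : ℝ) < N := by exact_mod_cast (Fact.out : N.Prime).pos
    have hs := Real.sqrt_pos.2 hNpos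
    have hq0 : 0 ≤ ε / √N := by positivity
    have hq1 : ε / √N ≤ 1 := (div_le_one hs).2 (Real.le_sqrt_of_sq_le hεN)
    have hb0 : b ≠ 0 := fun h => h0 (h ▸ hb)
    have hcard : #(X.image (· * b)) = #X := card_image_of_injective _ (mul_left_injective₀ hb0)
    refine (Pr_mono hq0 hq1 (Q := fun R => ∅ ⊆ R ∧ Disjoint R (X.image (· * b))) ?_).trans ?_
    · rintro R - ⟨φ, hφ, hpr⟩
      refine ⟨empty_subset _, disjoint_left.2 fun y hyR hy => ?_⟩
      obtain ⟨x, hx, rfl⟩ := mem_image.1 hy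
      have := hL x hx b hb φ hφ (hpr.mono (insert_subset (mem_union_right _ hyR) subset_union_left))
      simp [hLb] at this
    · rw [Pr_subset_disjoint _ (empty_subset _) (subset_univ _) (disjoint_empty_left _), hcard,
        card_empty, pow_zero, one_mul]
      have e1 : 1 - ε / √N ≤ Real.exp (-(ε / √N)) := by
        have := Real.add_one_le_exp (-(ε / √N)); linarith
      refine (pow_le_pow_left₀ (by linarith) e1 _).trans ?_
      rw [← Real.exp_nat_mul]
      refine Real.exp_le_exp.2 ?_
      have e2 : ε / √N * (δ * N) = ε * δ * √N := by
        rw [div_mul_eq_mul_div, div_eq_iff hs.ne', mul_assoc (ε * δ), Real.mul_self_sqrt hNpos.le]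
        ring
      have := mul_le_mul_of_nonneg_left hX hq0
      linarith
  induction k with
  | zero =>
    intro δ ε hδ hε
    obtain ⟨N₀, hN₀⟩ := exists_nat_ge (ε ^ 2)
    refine ⟨1, one_pos, ε * δ, by positivity, N₀, ?_⟩
    intro N _ hN B X Y L 𝓕 hk h0 hsp hcol hX hL
    rw [one_mul]
    refine hempty δ ε hδ hε N (hN₀.trans (by exact_mod_cast hN)) B X Y L 𝓕 h0 hX hL ?_
    by_contra hcon
    push Not at hcon
    refine hcol (listColourable_of_sparse card_of_mem_schurHyp schurVec_ne_zero_iff hsp hcon ?_)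
    have hB : B = ∅ := by
      by_contra hB
      obtain ⟨b, hb⟩ := nonempty_iff_ne_empty.2 hB
      have := (hcon b hb).card_pos
      have := (sum_eq_zero_iff.1 (Nat.le_zero.1 hk)) b hb
      omega
    intro e he heB i _ a ha
    rw [hB] at heB
    simpa using heB ha
  | succ k ih =>
    intro δ ε hδ hε
    obtain ⟨ρ, hρ, hρ1, N₁, hroth⟩ := exists_many_dilated_tri δ hδ
    obtain ⟨δ', hδ', c₁, hc₁, N₂, hcov⟩ := exists_cover ρ (ε / 3) hρ hρ1 (by positivity)
    obtain ⟨A, hA, c₂, hc₂, N₃, hih⟩ := ih δ' (ε / 3) hδ' (by positivity)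
    obtain ⟨N₄, hN₄⟩ := exists_nat_ge (ε ^ 2)
    refine ⟨A + 3, by positivity, min (ε * δ) (min c₁ c₂), by positivity,
      max (max N₁ N₂) (max N₃ N₄), ?_⟩
    intro N _ hN B X Y L 𝓕 hk h0 hsp hcol hX hL
    simp only [max_le_iff] at hN
    have hNpos : (0 : ℝ) < N := by exact_mod_cast (Fact.out : N.Prime).pos
    have hs := Real.sqrt_pos.2 hNpos
    have hεN : ε ^ 2 ≤ N := hN₄.trans (by exact_mod_cast hN.2.2)
    have hexp : ∀ c, min (ε * δ) (min c₁ c₂) ≤ c →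
        Real.exp (-(c * √N)) ≤ Real.exp (-(min (ε * δ) (min c₁ c₂) * √N)) := fun c hc =>
      Real.exp_le_exp.2 (neg_le_neg (mul_le_mul_of_nonneg_right hc hs.le))
    set x₀ := Real.exp (-(min (ε * δ) (min c₁ c₂) * √N)) with hx₀
    have hx₀pos : 0 < x₀ := Real.exp_pos _
    by_cases hcon : ∃ b ∈ B, L b = ∅
    · refine (hempty δ ε hδ hε N hεN B X Y L 𝓕 h0 hX hL hcon).trans ?_
      have := hexp _ (min_le_left _ _)
      nlinarith
    push Not at hcon
    have hun : ¬ Unstuck (schurHyp (ZMod N)) L B := fun h =>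
      hcol (listColourable_of_sparse card_of_mem_schurHyp schurVec_ne_zero_iff hsp hcon h)
    simp only [Unstuck, not_forall] at hun
    obtain ⟨e, he, heB, i, hi, a, ha, b, hb, hLa, hLb, hab⟩ := hun
    obtain ⟨c, hc, htri⟩ := exists_tri_of_mem_edge he ha hb hab
    have hne0 : ∀ y ∈ e, y ≠ 0 := fun y hy h => h0 (h ▸ heB hy)
    have hsing : ∀ y ∈ e, #(L y) = 1 → ∀ j ∈ L y, j = i := fun y hy h1 j hj =>
      card_le_one.1 h1.le _ hj _ (hi y hy)
    obtain ⟨s, t, hs0, ht0, hst, hsign⟩ := htri.exists_signs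
    have hE := hroth (ZMod N) X a b c s t (by rw [ZMod.card]; exact hN.1.1)
      (by rw [ZMod.card]; exact hX) (hne0 a ha) (hne0 b hb) (hne0 c hc) hs0 ht0 hst hsign
    rw [ZMod.card] at hE
    set E : Finset (ZMod N × ZMod N) := {e | e.1 / a ∈ X ∧ e.2 / b ∈ X ∧
      (s * e.1 + t * e.2) / c ∈ X ∧ Tri e.1 e.2 (s * e.1 + t * e.2)} with hEdef
    set h : ZMod N → ZMod N → ZMod N := fun u w => (s * u + t * w) / c with hh
    have hc0 := hne0 c hc
    have hcovN := hcov (ZMod N) N (ZMod.card N) hN.1.2 E h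
      (fun u w w' _ _ hww => by
        have : t * w = t * w' := by
          have := (div_left_inj' hc0).1 hww
          linear_combination this
        exact mul_left_cancel₀ ht0 this)
      (fun u u' w _ _ hww => by
        have : s * u = s * u' := by
          have := (div_left_inj' hc0).1 hww
          linear_combination this
        exact mul_left_cancel₀ hs0 this) hE
    set q := ε / 3 / √N with hq
    have hq0 : 0 ≤ q := by positivity
    have hqε : 3 * q = ε / √N := by rw [hq]; ring
    have hε1 : ε / √N ≤ 1 := (div_le_one hs).2 (Real.le_sqrt_of_sq_le hεN)
    have hq1 : q ≤ 1 := by linarith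
    refine (Pr_le_three_rounds univ (P := fun R => ∃ φ, 𝓕 φ ∧ Proper φ (Y ∪ R))
      (fun S T hST ⟨φ, h1, h2⟩ => ⟨φ, h1, h2.mono (union_subset_union_right hST)⟩) hq0 hqε.le
      hε1).trans ?_
    set L' := Function.update L c ((L c).erase i) with hL'
    have hL'L : ∀ y, L' y ⊆ L y := fun y => by
      by_cases hy : y = c
      · subst hy; rw [hL', Function.update_self]; exact erase_subset _ _
      · rw [hL', Function.update_of_ne hy]
    have hL'sum : ∑ b ∈ B, #(L' b) ≤ k := by
      have : ∑ b ∈ B, #(L' b) < ∑ b ∈ B, #(L b) := by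
        refine sum_lt_sum (fun y _ => card_le_card (hL'L y)) ⟨c, heB hc, ?_⟩
        rw [hL', Function.update_self]
        exact card_erase_lt_of_mem (hi c hc)
      omega
    have hL'col : ¬ ListColourable (schurHyp (ZMod N)) L' B := fun ⟨σ, h1, h2⟩ =>
      hcol ⟨σ, fun y hy => hL'L y (h1 y hy), h2⟩
    have key : ∀ R S, Pr univ q (fun T => ∃ φ, 𝓕 φ ∧ Proper φ (Y ∪ (R ∪ S ∪ T))) ≤
        ind ((#(cov E h R S) : ℝ) < δ' * N) + A * Real.exp (-(c₂ * √N)) := by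
      intro R S
      have hnn : 0 ≤ A * Real.exp (-(c₂ * √N)) := by positivity
      by_cases hRS : (#(cov E h R S) : ℝ) < δ' * N
      · rw [ind_pos hRS]
        exact (Pr_le_one hq0 hq1 _).trans (by linarith)
      rw [ind_neg hRS, zero_add]
      have hyp : ∀ x ∈ cov E h R S, ∀ b' ∈ B, ∀ φ, 𝓕 φ →
          Proper φ (insert (x * b') (Y ∪ (R ∪ S))) → φ (x * b') ∈ L' b' := by
        intro x hx b' hb' φ hφ hpr
        obtain ⟨u, w, huw, hu, hw, rfl⟩ := mem_cov.1 hx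
        rw [hEdef, mem_filter] at huw
        obtain ⟨-, h1, h2, h3, h4⟩ := huw
        have hb'L := hL _ h3 b' hb' φ hφ (hpr.mono (insert_subset_insert _ subset_union_left))
        by_cases hbc : b' = c
        · subst hbc
          rw [hL', Function.update_self]
          refine mem_erase.2 ⟨fun hcon => ?_, hb'L⟩
          have huv : u / a * a = u := div_mul_cancel₀ _ (hne0 a ha)
          have hwv : w / b * b = w := div_mul_cancel₀ _ (hne0 b hb)
          have hvv : h u w * b' = s * u + t * w := div_mul_cancel₀ _ hc0
          have h5 := hL _ h1 a (heB ha) φ hφ (hpr.mono (by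
            rw [huv]
            exact insert_subset (by simp [hu]) (subset_union_left.trans (subset_insert _ _))))
          have h6 := hL _ h2 b (heB hb) φ hφ (hpr.mono (by
            rw [hwv]
            exact insert_subset (by simp [hw]) (subset_union_left.trans (subset_insert _ _))))
          rw [huv] at h5
          rw [hwv] at h6
          have h7 := hsing a ha hLa _ h5
          have h8 := hsing b hb hLb _ h6
          refine hpr u (by simp [hu]) w (by simp [hw]) (h u w * b') (mem_insert_self _ _) ?_
            ⟨h7.trans h8.symm, h8.trans hcon.symm⟩
          rw [hvv]
          exact h4
        · rw [hL', Function.update_of_ne hbc]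
          exact hb'L
      have := hih N hN.2.1 B (cov E h R S) (Y ∪ (R ∪ S)) L' 𝓕 hL'sum h0 hsp hL'col (not_lt.1 hRS)
        hyp
      simpa only [union_assoc] using this
    calc Ex univ q (fun R => Ex univ q fun S => Pr univ q fun T =>
          ∃ φ, 𝓕 φ ∧ Proper φ (Y ∪ (R ∪ S ∪ T)))
        ≤ Ex univ q (fun R => Ex univ q fun S =>
          ind ((#(cov E h R S) : ℝ) < δ' * N) + A * Real.exp (-(c₂ * √N))) :=
          Ex_mono hq0 hq1 fun R _ => Ex_mono hq0 hq1 fun S _ => key R S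
      _ = Ex univ q (fun R => Pr univ q fun S => (#(cov E h R S) : ℝ) < δ' * N) +
          A * Real.exp (-(c₂ * √N)) := by
          simp only [Ex_add, Ex_const]
          rfl
      _ ≤ 2 * Real.exp (-(c₁ * √N)) + A * Real.exp (-(c₂ * √N)) := by linarith
      _ ≤ (A + 3) * x₀ := by
          have e1 := hexp c₁ ((min_le_right _ _).trans (min_le_left _ _))
          have e2 := hexp c₂ ((min_le_right _ _).trans (min_le_right _ _))
          have := mul_le_mul_of_nonneg_left e2 hA.le
          linarith

end Extension

section Extending
open Finset

lemma Tri.swap₁₂ {F : Type*} [AddCommGroup F] {a b c : F} (h : Tri a b c) : Tri b a c := by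
  obtain ⟨h1, h2, h3, h⟩ := h
  refine ⟨h1.symm, h3, h2, ?_⟩
  rw [add_comm b a]
  tauto

lemma Tri.swap₂₃ {F : Type*} [AddCommGroup F] {a b c : F} (h : Tri a b c) : Tri a c b := by
  obtain ⟨h1, h2, h3, h⟩ := h
  refine ⟨h2, h1, h3.symm, ?_⟩
  rw [add_comm c b]
  tauto

lemma Tri.of_mul {F : Type*} [Field F] {x a b c : F} (hx : x ≠ 0)
    (h : Tri (x * a) (x * b) (x * c)) : Tri a b c := by
  obtain ⟨h1, h2, h3, h⟩ := h
  refine ⟨fun h => h1 (h ▸ rfl), fun h => h2 (h ▸ rfl), fun h => h3 (h ▸ rfl), ?_⟩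
  simp only [← mul_add] at h
  rcases h with h | h | h
  · exact Or.inl (mul_left_cancel₀ hx h)
  · exact Or.inr (Or.inl (mul_left_cancel₀ hx h))
  · exact Or.inr (Or.inr (mul_left_cancel₀ hx h))

lemma Tri.mul {F : Type*} [Field F] {x a b c : F} (hx : x ≠ 0) (h : Tri a b c) :
    Tri (x * a) (x * b) (x * c) := by
  refine Tri.of_mul (inv_ne_zero hx) ?_
  simpa [inv_mul_cancel_left₀ hx] using h

variable {F : Type*} [Field F] [Fintype F] [DecidableEq F] {κ : Type*} [DecidableEq κ] [Fintype κ]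
  {B Z : Finset F} {x : F}

/-- `z` and `w` complete an element of `xB` to a Schur triple. -/
def Nbr (B : Finset F) (x z w : F) : Prop := ∃ b ∈ B, Tri z w (x * b)

lemma Nbr.symm {z w : F} (h : Nbr B x z w) : Nbr B x w z := by
  obtain ⟨b, hb, h⟩ := h
  exact ⟨b, hb, h.swap₁₂⟩

open Classical in
/-- The elements of `Z` that form a Schur triple with another element of `Z` and one of `xB`. -/
noncomputable def touched (B Z : Finset F) (x : F) : Finset F := {z ∈ Z | ∃ w ∈ Z, Nbr B x z w}

lemma mem_touched {z : F} : z ∈ touched B Z x ↔ z ∈ Z ∧ ∃ w ∈ Z, Nbr B x z w := by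
  simp [touched]

/-- The Schur triples with two elements in `Z` and one in `xB` form a matching on `Z`. -/
def Matched (B Z : Finset F) (x : F) : Prop :=
  ∀ z ∈ Z, ∀ w ∈ Z, ∀ w₂ ∈ Z, Nbr B x z w → Nbr B x z w₂ → w = w₂

/-- The dilate `xB` avoids `Z` and spans no Schur triple with a single element of `Z`. -/
def Clean (B Z : Finset F) (x : F) : Prop :=
  x ≠ 0 ∧ (∀ b ∈ B, x * b ∉ Z) ∧ ∀ b ∈ B, ∀ b' ∈ B, ∀ z ∈ Z, ¬ Tri z (x * b) (x * b')

open Classical in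
/-- The colours that remain available for `xb` when each `z ∈ Z` has its colour in `A z`. -/
noncomputable def lists (A : F → Finset κ) (Z : Finset F) (x b : F) : Finset κ :=
  {i | ¬ ∃ z ∈ Z, ∃ w ∈ Z, Tri z w (x * b) ∧ A z = {i} ∧ A w = {i}}

lemma mem_lists {A : F → Finset κ} {b : F} {i : κ} :
    i ∈ lists A Z x b ↔ ∀ z ∈ Z, ∀ w ∈ Z, Tri z w (x * b) → A z = {i} → A w ≠ {i} := by
  simp [lists]

lemma not_listColourable_of_isSchur {r N : ℕ} [Fact N.Prime] {B Z : Finset (ZMod N)} {x : ZMod N}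
    (hx : Clean B Z x) (hS : IsSchur r N (Z ∪ B.image (x * ·))) {φ : ZMod N → Fin r}
    (hφ : Proper φ Z) :
    ¬ ListColourable (schurHyp (ZMod N)) (lists (fun z => {φ z}) Z x) B := by
  rintro ⟨σ, hσ, hσe⟩
  obtain ⟨hx0, hxZ, hx1⟩ := hx
  rw [isSchur_iff] at hS
  refine hS ⟨fun y => if y ∈ Z then φ y else σ (y / x), ?_⟩
  have hB : ∀ b ∈ B, (if x * b ∈ Z then φ (x * b) else σ (x * b / x)) = σ b := fun b hb => by
    rw [if_neg (hxZ b hb), mul_div_cancel_left₀ _ hx0]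
  have h21 : ∀ z ∈ Z, ∀ w ∈ Z, ∀ b ∈ B, Tri z w (x * b) → φ z = φ w → φ w ≠ σ b := by
    intro z hz w hw b hb ht h1 h2
    have := mem_lists.1 (hσ b hb) z hz w hw ht (by rw [h1, h2])
    exact this (by rw [h2])
  intro a ha b hb c hc ht ⟨h1, h2⟩
  rw [mem_union, mem_image] at ha hb hc
  rcases ha with ha | ⟨a, ha, rfl⟩ <;> rcases hb with hb | ⟨b, hb, rfl⟩ <;>
    rcases hc with hc | ⟨c, hc, rfl⟩
  · simp only [if_pos ha, if_pos hb, if_pos hc] at h1 h2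
    exact hφ a ha b hb c hc ht ⟨h1, h2⟩
  · simp only [hB c hc] at h1 h2
    rw [if_pos ha, if_pos hb] at h1
    rw [if_pos hb] at h2
    exact h21 a ha b hb c hc ht h1 h2
  · simp only [hB b hb] at h1 h2
    rw [if_pos ha] at h1
    rw [if_pos hc] at h2
    exact h21 a ha c hc b hb ht.swap₂₃ (h1.trans h2) h2.symm
  · exact hx1 b hb c hc a ha ht
  · simp only [hB a ha] at h1 h2
    rw [if_pos hb] at h1
    rw [if_pos hb, if_pos hc] at h2
    exact h21 b hb c hc a ha ht.swap₁₂.swap₂₃ h2 (h2.symm.trans h1.symm)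
  · exact hx1 a ha c hc b hb ht.swap₁₂
  · exact hx1 a ha b hb c hc ht.swap₂₃.swap₁₂
  · simp only [hB a ha, hB b hb, hB c hc] at h1 h2
    refine hσe _ (tri_mem_schurHyp (ht.of_mul hx0)) ?_ (σ a) ?_
    · intro y hy
      simp only [mem_insert, mem_singleton] at hy
      rcases hy with rfl | rfl | rfl <;> assumption
    · intro y hy
      simp only [mem_insert, mem_singleton] at hy
      rcases hy with rfl | rfl | rfl
      · rfl
      · exact h1.symm
      · exact (h1.trans h2).symm

lemma lists_congr {A A' : F → Finset κ} (h : ∀ z ∈ touched B Z x, A z = A' z) {b : F}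
    (hb : b ∈ B) : lists A Z x b = lists A' Z x b := by
  ext i
  rw [mem_lists, mem_lists]
  have key : ∀ z ∈ Z, ∀ w ∈ Z, Tri z w (x * b) → A z = A' z ∧ A w = A' w := fun z hz w hw ht =>
    ⟨h z (mem_touched.2 ⟨hz, w, hw, b, hb, ht⟩), h w (mem_touched.2 ⟨hw, z, hz, b, hb, ht.swap₁₂⟩)⟩
  constructor <;> intro hi z hz w hw ht
  · rw [← (key z hz w hw ht).1, ← (key z hz w hw ht).2]
    exact hi z hz w hw ht
  · rw [(key z hz w hw ht).1, (key z hz w hw ht).2]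
    exact hi z hz w hw ht

lemma exists_pair_choice [Nonempty κ] (S S' : Finset κ) : ∃ c : κ × κ, S.Nonempty → S'.Nonempty →
    c.1 ∈ S ∧ c.2 ∈ S' ∧ ∀ i, c.1 = i → c.2 = i → S = {i} ∧ S' = {i} := by
  by_cases h : ∃ i ∈ S, ∃ j ∈ S', i ≠ j
  · obtain ⟨i, hi, j, hj, hij⟩ := h
    exact ⟨(i, j), fun _ _ => ⟨hi, hj, fun k h1 h2 => (hij (h1.trans h2.symm)).elim⟩⟩
  · push Not at h
    by_cases hS : S.Nonempty ∧ S'.Nonempty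
    · obtain ⟨⟨i, hi⟩, j, hj⟩ := hS
      refine ⟨(i, j), fun _ _ => ⟨hi, hj, ?_⟩⟩
      rintro k rfl -
      refine ⟨eq_singleton_iff_unique_mem.2 ⟨hi, fun y hy => ?_⟩,
        eq_singleton_iff_unique_mem.2 ⟨h i hi j hj ▸ hj, fun y hy => (h i hi y hy).symm⟩⟩
      rw [h y hy j hj, h i hi j hj]
    · exact ⟨Classical.arbitrary _, fun h1 h2 => (hS ⟨h1, h2⟩).elim⟩

/-- Along a matching the colours can be chosen distinct whenever this is possible at all. -/
lemma exists_colouring_of_lists [Nonempty κ] (hM : Matched B Z x) {A : F → Finset κ}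
    (hA : ∀ z ∈ touched B Z x, (A z).Nonempty) {𝓗 : Finset (Finset F)}
    (hcol : ListColourable 𝓗 (lists A Z x) B) :
    ∃ ψ : F → κ, (∀ z ∈ touched B Z x, ψ z ∈ A z) ∧
      ListColourable 𝓗 (lists (fun z => {ψ z}) Z x) B := by
  classical
  choose c hc using exists_pair_choice (κ := κ)
  set ν := Fintype.equivFin F
  set P : F → Prop := fun z => ∃ w ∈ Z, Nbr B x z w
  set ψ : F → κ := fun z => if h : P z then
    (if ν z < ν h.choose then (c (A z) (A h.choose)).1 else (c (A h.choose) (A z)).2)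
    else Classical.arbitrary κ with hψ
  have hpair : ∀ z ∈ Z, ∀ w ∈ Z, Nbr B x z w → ψ z =
      if ν z < ν w then (c (A z) (A w)).1 else (c (A w) (A z)).2 := by
    intro z hz w hw h
    have hP : P z := ⟨w, hw, h⟩
    have : hP.choose = w := hM z hz _ hP.choose_spec.1 w hw hP.choose_spec.2 h
    simp only [hψ]
    rw [dif_pos hP, this]
  have hne : ∀ z ∈ Z, ∀ w ∈ Z, Nbr B x z w → (A z).Nonempty ∧ (A w).Nonempty :=
    fun z hz w hw h => ⟨hA z (mem_touched.2 ⟨hz, w, hw, h⟩),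
      hA w (mem_touched.2 ⟨hw, z, hz, h.symm⟩)⟩
  refine ⟨ψ, fun z hz => ?_, ?_⟩
  · obtain ⟨hz, w, hw, h⟩ := mem_touched.1 hz
    have hn := hne z hz w hw h
    rw [hpair z hz w hw h]
    split_ifs
    · exact (hc _ _ hn.1 hn.2).1
    · exact (hc _ _ hn.2 hn.1).2.1
  · obtain ⟨σ, h1, h2⟩ := hcol
    refine ⟨σ, fun b hb => mem_lists.2 fun z hz w hw ht hψz hψw => ?_, h2⟩
    have hN : Nbr B x z w := ⟨b, hb, ht⟩
    have hn := hne z hz w hw hN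
    rw [singleton_inj, hpair z hz w hw hN] at hψz
    rw [singleton_inj, hpair w hw z hz hN.symm] at hψw
    have hνne : ν z ≠ ν w := fun h => ht.1 (ν.injective h)
    have hboth : A z = {σ b} ∧ A w = {σ b} := by
      rcases lt_or_gt_of_ne hνne with hlt | hlt
      · rw [if_pos hlt] at hψz
        rw [if_neg hlt.not_gt] at hψw
        exact (hc _ _ hn.1 hn.2).2.2 _ hψz hψw
      · rw [if_neg hlt.not_gt] at hψz
        rw [if_pos hlt] at hψw
        exact ((hc _ _ hn.2 hn.1).2.2 _ hψw hψz).symm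
    exact mem_lists.1 (h1 b hb) z hz w hw ht hboth.1 hboth.2

open Classical in
lemma card_touched_le (h0 : 0 ∉ B) (z : F) : #{x | z ∈ touched B Z x} ≤ 3 * #B * #Z := by
  have hsub : ({x | z ∈ touched B Z x} : Finset F) ⊆ (Z ×ˢ B).biUnion fun e =>
      {(z + e.1) / e.2, (e.1 - z) / e.2, (z - e.1) / e.2} := by
    intro x hx
    obtain ⟨-, w, hw, b, hb, -, -, -, h⟩ := mem_touched.1 (mem_filter.1 hx).2
    have hb0 : b ≠ 0 := fun h => h0 (h ▸ hb)
    refine mem_biUnion.2 ⟨(w, b), mem_product.2 ⟨hw, hb⟩, ?_⟩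
    simp only [mem_insert, mem_singleton, eq_div_iff hb0]
    rcases h with h | h | h
    · exact Or.inl h.symm
    · exact Or.inr (Or.inl (by rw [← h]; ring))
    · exact Or.inr (Or.inr (by rw [← h]; ring))
  refine (card_le_card hsub).trans ((card_biUnion_le_card_mul _ _ 3 fun e _ => card_le_three).trans ?_)
  rw [card_product]
  exact le_of_eq (by ring)

/-- The number of dilation factors placing two given affine images in `Z`. -/
def pairCount (Z : Finset F) (f g : F × F) : ℕ :=
  #{x | f.1 * x + f.2 ∈ Z ∧ g.1 * x + g.2 ∈ Z ∧ f.1 * x + f.2 ≠ g.1 * x + g.2}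

open Classical in
lemma card_touched_pair_le (h0 : 0 ∉ B) {D : ℕ}
    (hD : ∀ f g : F × F, f.1 ≠ 0 → g.1 ≠ 0 → pairCount Z f g ≤ D) {z z' : F} (hzz : z ≠ z') :
    #{x | Matched B Z x ∧ z ∈ touched B Z x ∧ z' ∈ touched B Z x} ≤ 9 * #B ^ 2 * D := by
  set S : F → Finset (F × F) := fun z => B.biUnion fun b => {(b, -z), (b, z), (-b, z)} with hS
  have hScard : ∀ z, #(S z) ≤ #B * 3 := fun z =>
    card_biUnion_le_card_mul _ _ 3 fun e _ => card_le_three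
  have hS0 : ∀ z, ∀ f ∈ S z, f.1 ≠ 0 := by
    intro z f hf
    obtain ⟨b, hb, hf⟩ := mem_biUnion.1 hf
    have hb0 : b ≠ 0 := fun h => h0 (h ▸ hb)
    simp only [mem_insert, mem_singleton] at hf
    rcases hf with rfl | rfl | rfl <;> simpa using hb0
  have hSmem : ∀ z w b x, b ∈ B → Tri z w (x * b) → ∃ f ∈ S z, f.1 * x + f.2 = w := by
    rintro z w b x hb ⟨-, -, -, h⟩
    rcases h with h | h | h
    · exact ⟨(b, -z), mem_biUnion.2 ⟨b, hb, by simp⟩, by linear_combination -h⟩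
    · exact ⟨(b, z), mem_biUnion.2 ⟨b, hb, by simp⟩, by linear_combination h⟩
    · exact ⟨(-b, z), mem_biUnion.2 ⟨b, hb, by simp⟩, by linear_combination -h⟩
  have hsub : ({x | Matched B Z x ∧ z ∈ touched B Z x ∧ z' ∈ touched B Z x} : Finset F) ⊆
      (S z ×ˢ S z').biUnion fun e => {x | e.1.1 * x + e.1.2 ∈ Z ∧ e.2.1 * x + e.2.2 ∈ Z ∧
        e.1.1 * x + e.1.2 ≠ e.2.1 * x + e.2.2} := by
    intro x hx
    obtain ⟨hM, h1, h2⟩ := (mem_filter.1 hx).2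
    obtain ⟨hz, w, hw, b, hb, ht⟩ := mem_touched.1 h1
    obtain ⟨hz', w', hw', b', hb', ht'⟩ := mem_touched.1 h2
    obtain ⟨f, hf, hfw⟩ := hSmem _ _ _ _ hb ht
    obtain ⟨g, hg, hgw⟩ := hSmem _ _ _ _ hb' ht'
    refine mem_biUnion.2 ⟨(f, g), mem_product.2 ⟨hf, hg⟩, mem_filter.2 ⟨mem_univ _, ?_⟩⟩
    simp only [hfw, hgw]
    refine ⟨hw, hw', ?_⟩
    rintro rfl
    exact hzz (hM w hw z hz z' hz' ⟨b, hb, ht.swap₁₂⟩ ⟨b', hb', ht'.swap₁₂⟩)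
  refine (card_le_card hsub).trans ((card_biUnion_le_card_mul _ _ D fun e he => ?_).trans ?_)
  · rw [mem_product] at he
    exact hD e.1 e.2 (hS0 _ _ he.1) (hS0 _ _ he.2)
  · rw [card_product]
    refine Nat.mul_le_mul_right _ ((Nat.mul_le_mul (hScard z) (hScard z')).trans (le_of_eq ?_))
    ring

open Classical in
lemma card_not_clean_le (h0 : 0 ∉ B) (hZ : 0 ∉ Z) :
    #{x | ¬ Clean B Z x} ≤ 1 + #Z * #B + 3 * #Z * #B ^ 2 := by
  have hsub : ({x | ¬ Clean B Z x} : Finset F) ⊆ {0} ∪ ((Z ×ˢ B).image (fun e => e.1 / e.2) ∪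
      (Z ×ˢ B ×ˢ B).biUnion fun e => {e.1 / (e.2.2 - e.2.1), e.1 / (e.2.1 - e.2.2),
        e.1 / (e.2.1 + e.2.2)}) := by
    intro x hx
    have hx := (mem_filter.1 hx).2
    simp only [mem_union, mem_singleton]
    by_contra hcon
    push Not at hcon
    obtain ⟨g1, g2, g3⟩ := hcon
    refine hx ⟨g1, fun b hb hxb => g2 (mem_image.2 ⟨(x * b, b), mem_product.2 ⟨hxb, hb⟩, ?_⟩), ?_⟩
    · exact mul_div_cancel_right₀ _ fun h => h0 (h ▸ hb)
    · rintro b hb b' hb' z hz ⟨-, -, -, h⟩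
      refine g3 (mem_biUnion.2 ⟨(z, b, b'), by simp [hz, hb, hb'], ?_⟩)
      have hz0 : z ≠ 0 := fun h => hZ (h ▸ hz)
      have hdiv : ∀ t, z = x * t → x = z / t := fun t ht => by
        have ht0 : t ≠ 0 := fun h => hz0 (by rw [ht, h, mul_zero])
        rw [ht, mul_div_cancel_right₀ _ ht0]
      simp only [mem_insert, mem_singleton]
      rcases h with h | h | h
      · exact Or.inl (hdiv _ (by linear_combination h))
      · exact Or.inr (Or.inl (hdiv _ (by linear_combination h)))
      · exact Or.inr (Or.inr (hdiv _ (by linear_combination -h)))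
  refine (card_le_card hsub).trans ((card_union_le _ _).trans ?_)
  have e1 : #((Z ×ˢ B).image fun e => e.1 / e.2) ≤ #Z * #B := by
    rw [← card_product]; exact card_image_le
  have e2 : #((Z ×ˢ B ×ˢ B).biUnion fun e => ({e.1 / (e.2.2 - e.2.1), e.1 / (e.2.1 - e.2.2),
        e.1 / (e.2.1 + e.2.2)} : Finset F)) ≤ #Z * (#B * #B) * 3 := by
    rw [← card_product, ← card_product]
    exact card_biUnion_le_card_mul _ _ 3 fun e _ => card_le_three
  have e3 := card_union_le ((Z ×ˢ B).image fun e => e.1 / e.2)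
    ((Z ×ˢ B ×ˢ B).biUnion fun e => ({e.1 / (e.2.2 - e.2.1), e.1 / (e.2.1 - e.2.2),
        e.1 / (e.2.1 + e.2.2)} : Finset F))
  rw [card_singleton]
  nlinarith

open Classical in
lemma card_many_touched_le (h0 : 0 ∉ B) (m : ℕ) :
    #{x | m ≤ #(touched B Z x)} * m ≤ 3 * #B * #Z ^ 2 := by
  have hsum : ∑ x, #(touched B Z x) = ∑ z ∈ Z, #{x | z ∈ touched B Z x} := by
    have := sum_card_bipartiteAbove_eq_sum_card_bipartiteBelow (s := (univ : Finset F)) (t := Z)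
      (fun x z => z ∈ touched B Z x)
    simp only [bipartiteAbove, bipartiteBelow] at this
    rw [← this]
    refine sum_congr rfl fun x _ => congrArg card ?_
    ext z
    rw [mem_filter]
    exact ⟨fun h => ⟨(mem_touched.1 h).1, h⟩, fun h => h.2⟩
  calc #{x | m ≤ #(touched B Z x)} * m
      ≤ ∑ x with m ≤ #(touched B Z x), #(touched B Z x) := by
        rw [← smul_eq_mul]
        exact card_nsmul_le_sum _ _ _ fun x hx => (mem_filter.1 hx).2
    _ ≤ ∑ x, #(touched B Z x) := sum_le_sum_of_subset (subset_univ _)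
    _ ≤ ∑ _z ∈ Z, 3 * #B * #Z := by rw [hsum]; exact sum_le_sum fun z _ => card_touched_le h0 z
    _ = 3 * #B * #Z ^ 2 := by rw [sum_const, smul_eq_mul]; ring

end Extending

section ContainerRound
open Finset

variable {F : Type} [Field F] [Fintype F] [DecidableEq F] {κ : Type} [DecidableEq κ] [Fintype κ]
  {B Z X : Finset F} {x : F} {𝓗 : Finset (Finset F)}

/-- The graph of a colouring on a finite set. -/
def graphOn (ψ : F → κ) (Y : Finset F) : Finset (F × κ) := Y.image fun z => (z, ψ z)

lemma mem_graphOn {ψ : F → κ} {Y : Finset F} {e : F × κ} :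
    e ∈ graphOn ψ Y ↔ e.1 ∈ Y ∧ ψ e.1 = e.2 := by
  obtain ⟨a, i⟩ := e
  simp only [graphOn, mem_image, Prod.mk.injEq]
  constructor
  · rintro ⟨z, hz, rfl, rfl⟩
    exact ⟨hz, rfl⟩
  · rintro ⟨hz, h⟩
    exact ⟨a, hz, rfl, h⟩

lemma graphOn_subset {ψ : F → κ} {Y : Finset F} {C : Finset (F × κ)} :
    graphOn ψ Y ⊆ C ↔ ∀ z ∈ Y, (z, ψ z) ∈ C := by
  simp [graphOn, image_subset_iff]

lemma card_graphOn (ψ : F → κ) (Y : Finset F) : #(graphOn ψ Y) = #Y :=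
  card_image_of_injective _ fun _ _ h => (Prod.mk.inj h).1

open Classical in
/-- Pairs of a dilation factor `x ∈ X` and the graph of a colouring of the touched elements which
extends to `xB`. -/
noncomputable def extGraphs (𝓗 : Finset (Finset F)) (κ : Type) [DecidableEq κ] [Fintype κ]
    (B Z X : Finset F) : Finset (F × Finset (F × κ)) :=
  {e | e.1 ∈ X ∧ ∃ ψ : F → κ, e.2 = graphOn ψ (touched B Z e.1) ∧
    ListColourable 𝓗 (lists (fun z => {ψ z}) Z e.1) B}

lemma mem_extGraphs {e : F × Finset (F × κ)} : e ∈ extGraphs 𝓗 κ B Z X ↔ e.1 ∈ X ∧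
    ∃ ψ : F → κ, e.2 = graphOn ψ (touched B Z e.1) ∧
      ListColourable 𝓗 (lists (fun z => {ψ z}) Z e.1) B := by
  simp [extGraphs]

open Classical in
lemma edgeDeg_extGraphs_le {l : ℕ} (hX : ∀ x ∈ X, #(touched B Z x) = l) (S : Finset (F × κ)) :
    edgeDeg (extGraphs 𝓗 κ B Z X) Prod.snd S ≤
      2 ^ (l * Fintype.card κ) * #{x ∈ X | ∀ e ∈ S, e.1 ∈ touched B Z x} := by
  unfold edgeDeg
  set I := {e ∈ extGraphs 𝓗 κ B Z X | S ⊆ e.2} with hI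
  have hIsub : ∀ e ∈ I, e.2 ⊆ touched B Z e.1 ×ˢ univ := by
    intro e he
    obtain ⟨-, ψ, hψ, -⟩ := mem_extGraphs.1 (mem_filter.1 he).1
    rw [hψ]
    intro a ha
    exact mem_product.2 ⟨(mem_graphOn.1 ha).1, mem_univ _⟩
  refine card_le_mul_card_image_of_maps_to (f := Prod.fst) ?_ _ ?_
  · intro e he
    obtain ⟨he, hS⟩ := mem_filter.1 he
    obtain ⟨hx, ψ, hψ, -⟩ := mem_extGraphs.1 he
    refine mem_filter.2 ⟨hx, fun a ha => ?_⟩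
    have := hS ha
    rw [hψ, mem_graphOn] at this
    exact this.1
  · intro x hx
    have hx := (mem_filter.1 hx).1
    have hinj : #{e ∈ I | e.1 = x} ≤ #((touched B Z x ×ˢ (univ : Finset κ)).powerset) := by
      refine card_le_card_of_injOn Prod.snd (fun e he => ?_) fun a ha b hb h => ?_
      · have he' := mem_filter.1 (mem_coe.1 he)
        have hsub : e.2 ⊆ touched B Z e.1 ×ˢ univ := hIsub e he'.1
        rw [he'.2] at hsub
        exact mem_coe.2 (mem_powerset.2 hsub)
      · have h1 := (mem_filter.1 (mem_coe.1 ha)).2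
        have h2 := (mem_filter.1 (mem_coe.1 hb)).2
        exact Prod.ext (h1.trans h2.symm) h
    rwa [card_powerset, card_product, hX x hx, card_univ] at hinj

lemma edgeDeg_extGraphs_le_pow {l D : ℕ} {Q κ' η τ s : ℝ} (h0 : 0 ∉ B) (hB : (#B : ℝ) ≤ Q)
    (hQ : 0 < Q)
    (hX : ∀ x ∈ X, Matched B Z x ∧ #(touched B Z x) = l) (hs : 0 ≤ s) (hZ : #Z ≤ κ' * s)
    (hD : ∀ f g : F × F, f.1 ≠ 0 → g.1 ≠ 0 → pairCount Z f g ≤ D) (hDs : D ≤ η * s)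
    (hτ : 0 ≤ τ) (hτ1 : τ ≤ 1) (hκ : 0 ≤ κ') (hη : 3 * Q * η ≤ κ' * τ ^ l) (S : Finset (F × κ))
    (hS : S.Nonempty) :
    (edgeDeg (extGraphs 𝓗 κ B Z X) Prod.snd S : ℝ) ≤
      (2 ^ (l * Fintype.card κ) * (3 * Q * κ')) * τ ^ (#S - 1) * s := by
  classical
  by_cases hne : edgeDeg (extGraphs 𝓗 κ B Z X) Prod.snd S = 0
  · rw [hne, Nat.cast_zero]
    positivity
  obtain ⟨e, he⟩ := card_pos.1 (Nat.pos_of_ne_zero hne)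
  obtain ⟨he, hSe⟩ := mem_filter.1 he
  obtain ⟨hex, ψ, hψ, -⟩ := mem_extGraphs.1 he
  have hSl : #S ≤ l := by
    rw [← (hX _ hex).2, ← card_graphOn ψ (touched B Z e.1), ← hψ]
    exact card_le_card hSe
  have hdeg : (edgeDeg (extGraphs 𝓗 κ B Z X) Prod.snd S : ℝ) ≤
      2 ^ (l * Fintype.card κ) * (#{x ∈ X | ∀ e ∈ S, e.1 ∈ touched B Z x} : ℕ) := by
    exact_mod_cast edgeDeg_extGraphs_le (fun x hx => (hX x hx).2) S
  refine hdeg.trans ?_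
  rw [mul_assoc, mul_assoc]
  refine mul_le_mul_of_nonneg_left ?_ (by positivity)
  have hS1 := hS.card_pos
  by_cases hS2 : #S = 1
  · obtain ⟨⟨z, i⟩, rfl⟩ := card_eq_one.1 hS2
    have h1 : #{x ∈ X | ∀ e ∈ ({(z, i)} : Finset (F × κ)), e.1 ∈ touched B Z x} ≤
        3 * #B * #Z := by
      refine (card_le_card fun x hx => ?_).trans (card_touched_le h0 z)
      exact mem_filter.2 ⟨mem_univ _, (mem_filter.1 hx).2 _ (mem_singleton_self _)⟩
    have h2 : (#{x ∈ X | ∀ e ∈ ({(z, i)} : Finset (F × κ)), e.1 ∈ touched B Z x} : ℝ) ≤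
        3 * #B * #Z := by exact_mod_cast h1
    rw [card_singleton, Nat.sub_self, pow_zero, one_mul]
    calc _ ≤ 3 * (#B : ℝ) * #Z := h2
      _ ≤ 3 * Q * (κ' * s) := by gcongr
      _ = _ := by ring
  · obtain ⟨a, ha, b, hb, hab⟩ := one_lt_card.1 (show 1 < #S by omega)
    have hab1 : a.1 ≠ b.1 := by
      intro h
      have h1 := hSe ha
      have h2 := hSe hb
      rw [hψ, mem_graphOn] at h1 h2
      exact hab (Prod.ext h (by rw [← h1.2, ← h2.2, h]))
    have h1 : #{x ∈ X | ∀ e ∈ S, e.1 ∈ touched B Z x} ≤ 9 * #B ^ 2 * D := by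
      refine (card_le_card fun x hx => ?_).trans (card_touched_pair_le h0 hD hab1)
      obtain ⟨hx, hxS⟩ := mem_filter.1 hx
      exact mem_filter.2 ⟨mem_univ _, (hX x hx).1, hxS a ha, hxS b hb⟩
    have h2 : (#{x ∈ X | ∀ e ∈ S, e.1 ∈ touched B Z x} : ℝ) ≤ 9 * #B ^ 2 * D := by
      exact_mod_cast h1
    calc _ ≤ 9 * (#B : ℝ) ^ 2 * D := h2
      _ ≤ 9 * Q ^ 2 * (η * s) := by gcongr
      _ = 3 * Q * (3 * Q * η) * s := by ring
      _ ≤ 3 * Q * (κ' * τ ^ l) * s := by gcongr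
      _ ≤ 3 * Q * (κ' * τ ^ (#S - 1)) * s := by
          have : τ ^ l ≤ τ ^ (#S - 1) := pow_le_pow_of_le_one hτ hτ1 (by omega)
          gcongr
      _ = _ := by ring

open Classical in
/-- The colours that `C` allows at `z`. -/
noncomputable def slice (C : Finset (F × κ)) (z : F) : Finset κ := {i | (z, i) ∈ C}

open Classical in
lemma card_listColourable_le [Nonempty κ] (hX : ∀ x ∈ X, Matched B Z x) {C : Finset (F × κ)}
    (hC : ∀ z ∈ Z, (slice C z).Nonempty) :
    #{x ∈ X | ListColourable 𝓗 (lists (slice C) Z x) B} ≤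
      #{e ∈ extGraphs 𝓗 κ B Z X | e.2 ⊆ C} := by
  have key : ∀ x, ∃ ψ : F → κ, x ∈ X → ListColourable 𝓗 (lists (slice C) Z x) B →
      graphOn ψ (touched B Z x) ⊆ C ∧ ListColourable 𝓗 (lists (fun z => {ψ z}) Z x) B := by
    intro x
    by_cases hx : x ∈ X ∧ ListColourable 𝓗 (lists (slice C) Z x) B
    · obtain ⟨ψ, h1, h2⟩ := exists_colouring_of_lists (hX x hx.1)
        (fun z hz => hC z (mem_touched.1 hz).1) hx.2
      refine ⟨ψ, fun _ _ => ⟨graphOn_subset.2 fun z hz => ?_, h2⟩⟩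
      simpa [slice] using h1 z hz
    · exact ⟨fun _ => Classical.arbitrary κ, fun h1 h2 => (hx ⟨h1, h2⟩).elim⟩
  choose ψ hψ using key
  refine card_le_card_of_injOn (fun x => (x, graphOn (ψ x) (touched B Z x))) ?_
    fun a _ b _ h => (Prod.mk.inj h).1
  intro x hx
  obtain ⟨hx, hcol⟩ := mem_filter.1 hx
  obtain ⟨h1, h2⟩ := hψ x hx hcol
  exact mem_filter.2 ⟨mem_extGraphs.2 ⟨hx, ψ x, rfl, h2⟩, h1⟩

open Classical in
lemma exists_common_lists (A : F → Finset κ) {m : ℝ} (hY : m * (2 ^ Fintype.card κ) ^ #B ≤ #X) :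
    ∃ L : F → Finset κ, m ≤ #{x ∈ X | ∀ b ∈ B, lists A Z x b = L b} := by
  set 𝒢 : Finset (∀ b ∈ B, Finset κ) := B.pi fun _ => univ with h𝒢
  have hcard : (#𝒢 : ℝ) = (2 ^ Fintype.card κ) ^ #B := by
    rw [h𝒢, card_pi, prod_const, card_univ, Fintype.card_finset]
    push_cast
    rfl
  have hne : 𝒢.Nonempty := by
    rw [← card_pos]
    have : (0 : ℝ) < #𝒢 := by rw [hcard]; positivity
    exact_mod_cast this
  obtain ⟨g, -, hg⟩ := exists_le_card_fiber_of_nsmul_le_card_of_maps_to (s := X) (t := 𝒢)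
    (f := fun x b _ => lists A Z x b) (b := m) (fun x _ => by simp [h𝒢]) hne
    (by rw [nsmul_eq_mul, hcard, mul_comm]; exact hY)
  refine ⟨fun b => if hb : b ∈ B then g b hb else ∅, hg.trans ?_⟩
  refine Nat.cast_le.2 (card_le_card fun x hx => ?_)
  obtain ⟨hx, h⟩ := mem_filter.1 hx
  refine mem_filter.2 ⟨hx, fun b hb => ?_⟩
  simp only [dif_pos hb, ← h]

end ContainerRound

section FixedTouched
open Finset

lemma lists_eq_univ_of_touched {F κ : Type} [Field F] [Fintype F] [DecidableEq F] [Fintype κ]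
    [DecidableEq κ] {A : F → Finset κ} {B Z : Finset F} {x b : F} (hb : b ∈ B)
    (h : touched B Z x = ∅) : lists A Z x b = univ := by
  ext i
  simp only [mem_univ, iff_true, mem_lists]
  intro z hz w hw ht
  have : z ∈ touched B Z x := mem_touched.2 ⟨hz, w, hw, b, hb, ht⟩
  rw [h] at this
  exact absurd this (notMem_empty z)

lemma listColourable_univ {r N : ℕ} [Fact N.Prime] (hr : 2 ≤ r) {B : Finset (ZMod N)}
    (hsp : ∀ U ⊆ B, 2 * srk U ≤ #U) {L : ZMod N → Finset (Fin r)} (hL : ∀ b ∈ B, L b = univ) :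
    ListColourable (schurHyp (ZMod N)) L B := by
  have : Nonempty (Fin r) := ⟨⟨0, by omega⟩⟩
  refine listColourable_of_sparse (v := schurVec) (fun e he => card_of_mem_schurHyp e he)
    (fun e he a => schurVec_ne_zero_iff e he a) hsp (fun a ha => by rw [hL a ha]; exact univ_nonempty)
    fun e _ heB i _ a ha b _ h1 _ => ?_
  rw [hL a (heB ha), card_univ, Fintype.card_fin] at h1
  omega

/-- The bound for one container. -/
lemma Pr_container_le {r N : ℕ} [Fact N.Prime] (hr : 2 ≤ r) {B Z X : Finset (ZMod N)} {K : ℕ}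
    (hBK : #B ≤ K) (hX : ∀ x ∈ X, Matched B Z x) {C : Finset (ZMod N × Fin r)} {δ ε b : ℝ}
    (hδ : 0 < δ) (hXδ : δ * N ≤ #X)
    (hC : #{e ∈ extGraphs (schurHyp (ZMod N)) (Fin r) B Z X | e.2 ⊆ C} ≤ δ / 2 * N)
    (hb : 0 ≤ b)
    (haux : ∀ (X Y : Finset (ZMod N)) (L : ZMod N → Finset (Fin r))
      (𝓕 : (ZMod N → Fin r) → Prop), ∑ b ∈ B, #(L b) ≤ K * r →
      ¬ ListColourable (schurHyp (ZMod N)) L B → δ / (2 * (2 ^ r) ^ K) * N ≤ #X →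
      (∀ x ∈ X, ∀ b ∈ B, ∀ φ, 𝓕 φ → Proper φ (insert (x * b) Y) → φ (x * b) ∈ L b) →
      Pr univ (ε / √N) (fun R => ∃ φ, 𝓕 φ ∧ Proper φ (Y ∪ R)) ≤ b) :
    Pr univ (ε / √N) (fun R => ∃ φ : ZMod N → Fin r, graphOn φ Z ⊆ C ∧ Proper φ (Z ∪ R)) ≤ b := by
  classical
  have hne : Nonempty (Fin r) := ⟨⟨0, by omega⟩⟩
  have hN : (0 : ℝ) < N := by exact_mod_cast (Fact.out : N.Prime).pos
  by_cases hφ : ∃ φ : ZMod N → Fin r, graphOn φ Z ⊆ C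
  swap
  · push Not at hφ
    refine le_of_eq_of_le ?_ hb
    unfold Pr
    have : ∀ R : Finset (ZMod N), ind (∃ φ : ZMod N → Fin r, graphOn φ Z ⊆ C ∧
        Proper φ (Z ∪ R)) = 0 := fun R => ind_neg fun ⟨φ, h, _⟩ => hφ φ h
    simp only [this]
    exact Ex_const _ _ 0
  obtain ⟨φ₀, hφ₀⟩ := hφ
  have hslice : ∀ z ∈ Z, (slice C z).Nonempty := fun z hz =>
    ⟨φ₀ z, by simpa [slice] using graphOn_subset.1 hφ₀ z hz⟩
  set X' := {x ∈ X | ¬ ListColourable (schurHyp (ZMod N)) (lists (slice C) Z x) B} with hX'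
  have hcardX : δ / 2 * N ≤ #X' := by
    have h1 := card_filter_add_card_filter_not (s := X)
      (fun x => ListColourable (schurHyp (ZMod N)) (lists (slice C) Z x) B)
    have h2 : (#{x ∈ X | ListColourable (schurHyp (ZMod N)) (lists (slice C) Z x) B} : ℝ) ≤
        δ / 2 * N := (Nat.cast_le.2 (card_listColourable_le hX hslice)).trans hC
    have h3 : (#{x ∈ X | ListColourable (schurHyp (ZMod N)) (lists (slice C) Z x) B} : ℝ) + #X' =
        #X := by
      rw [hX']
      exact_mod_cast h1
    linarith
  have hpow : (2 ^ r : ℝ) ^ #B ≤ (2 ^ r) ^ K := pow_le_pow_right₀ (one_le_pow₀ (by norm_num)) hBK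
  obtain ⟨L, hL⟩ := exists_common_lists (B := B) (Z := Z) (X := X') (slice C)
    (m := δ / (2 * (2 ^ r) ^ K) * N) (by
      rw [Fintype.card_fin]
      calc δ / (2 * (2 ^ r) ^ K) * N * (2 ^ r) ^ #B ≤ δ / (2 * (2 ^ r) ^ K) * N * (2 ^ r) ^ K := by
            gcongr
        _ = δ / 2 * N := by field_simp
        _ ≤ _ := hcardX)
  set X'' := {x ∈ X' | ∀ b ∈ B, lists (slice C) Z x b = L b} with hX''
  have hX''ne : X''.Nonempty := by
    rw [← card_pos]
    have : (0 : ℝ) < #X'' := lt_of_lt_of_le (by positivity) hL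
    exact_mod_cast this
  refine haux X'' Z L (fun φ => graphOn φ Z ⊆ C) ?_ ?_ hL ?_
  · calc ∑ b ∈ B, #(L b) ≤ ∑ b ∈ B, r := sum_le_sum fun b _ => by
          simpa using card_le_univ (L b)
      _ ≤ K * r := by
          rw [sum_const, smul_eq_mul]
          exact Nat.mul_le_mul_right r hBK
  · obtain ⟨x, hx⟩ := hX''ne
    obtain ⟨hx, hxL⟩ := mem_filter.1 hx
    rintro ⟨σ, h1, h2⟩
    exact (mem_filter.1 hx).2 ⟨σ, fun b hb => by rw [hxL b hb]; exact h1 b hb, h2⟩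
  · intro x hx b hb φ hφ hprop
    rw [← (mem_filter.1 hx).2 b hb, mem_lists]
    intro z hz w hw ht hz1 hw1
    have h1 : ∀ z ∈ Z, φ z ∈ slice C z := fun z hz => by
      simpa [slice] using graphOn_subset.1 hφ z hz
    have h2 := h1 z hz
    have h3 := h1 w hw
    rw [hz1, mem_singleton] at h2
    rw [hw1, mem_singleton] at h3
    exact hprop z (mem_insert_of_mem hz) w (mem_insert_of_mem hw) _ (mem_insert_self _ _) ht
      ⟨h2.trans h3.symm, h3⟩

/-- The number of codes. -/
lemma card_codes_le {α : Type*} [DecidableEq α] (G : Finset α) (k : ℕ) {l n τ : ℝ} (hl : 0 < l)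
    (hl1 : l ≤ 1) (hG : #G ≤ n) (hτ : 0 ≤ τ) :
    (#(Fintype.piFinset fun _ : Fin k => {T ∈ G.powerset | #T ≤ ⌊τ * n⌋₊}) : ℝ) ≤
      Real.exp (k * (τ * n * Real.log l⁻¹ + l * n)) := by
  have hn : 0 ≤ n := (Nat.cast_nonneg _).trans hG
  have hlog : 0 ≤ Real.log l⁻¹ := Real.log_nonneg ((one_le_inv₀ hl).2 hl1)
  have h1 := sum_pow_card_le G (q := 1) zero_le_one hl hl1 ⌊τ * n⌋₊
  simp only [one_pow, sum_const, nsmul_eq_mul, mul_one] at h1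
  have h2 : (l⁻¹) ^ ⌊τ * n⌋₊ * Real.exp (l * #G) ≤ Real.exp (τ * n * Real.log l⁻¹ + l * n) := by
    rw [Real.exp_add, ← Real.exp_log (pow_pos (inv_pos.2 hl) _), Real.log_pow]
    have := Nat.floor_le (mul_nonneg hτ hn)
    gcongr
  rw [Fintype.card_piFinset, prod_const, card_univ, Fintype.card_fin, Nat.cast_pow, Real.exp_nat_mul]
  exact pow_le_pow_left₀ (Nat.cast_nonneg _) (h1.trans h2) k

theorem extension_bound_touched (r : ℕ) (hr : 2 ≤ r) (K : ℕ) (κ δ ε : ℝ) (hκ : 0 < κ) (hδ : 0 < δ)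
    (hε : 0 < ε) (l : ℕ) : ∃ η > 0, ∃ N₀ : ℕ, ∀ (N : ℕ) [Fact N.Prime], N₀ ≤ N →
    ∀ B Z X : Finset (ZMod N), #B ≤ K → 0 ∉ B → (∀ U ⊆ B, 2 * srk U ≤ #U) → #Z ≤ κ * √N →
      (∀ f g : ZMod N × ZMod N, f.1 ≠ 0 → g.1 ≠ 0 → pairCount Z f g ≤ η * √N) →
      (∀ x ∈ X, Clean B Z x ∧ Matched B Z x ∧ #(touched B Z x) = l ∧
        IsSchur r N (Z ∪ B.image (x * ·))) → δ * N ≤ #X →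
      Pr univ (ε / √N) (fun R => ¬ IsSchur r N (Z ∪ R)) ≤ 1 / 2 := by
  have hr0 : (0 : ℝ) < r := by exact_mod_cast (by omega : 0 < r)
  have hne : Nonempty (Fin r) := ⟨⟨0, by omega⟩⟩
  rcases Nat.eq_zero_or_pos l with rfl | hl
  · refine ⟨1, one_pos, 1, fun N _ _ B Z X _ _ hsp _ _ hX hXδ => ?_⟩
    have hN : (0 : ℝ) < N := by exact_mod_cast (Fact.out : N.Prime).pos
    have hXne : X.Nonempty := by
      rw [← card_pos]
      have : (0 : ℝ) < #X := lt_of_lt_of_le (by positivity) hXδ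
      exact_mod_cast this
    obtain ⟨x, hx⟩ := hXne
    obtain ⟨hc, -, ht, hS⟩ := hX x hx
    have hZ : IsSchur r N Z := by
      rw [isSchur_iff]
      rintro ⟨φ, hφ⟩
      exact not_listColourable_of_isSchur hc hS hφ (listColourable_univ hr hsp fun b hb =>
        lists_eq_univ_of_touched hb (card_eq_zero.1 ht))
    have : ∀ R : Finset (ZMod N), ind (¬ IsSchur r N (Z ∪ R)) = 0 := fun R =>
      ind_neg (not_not.2 (IsSchur.mono hZ subset_union_left))
    unfold Pr
    simp only [this]
    rw [Ex_const]
    norm_num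
  obtain ⟨A, hA, c, hc, N₁, haux⟩ := extension_bound_aux r (by omega) (K * r)
    (δ / (2 * (2 ^ r) ^ K)) ε (by positivity) hε
  set Q : ℝ := K + 1 with hQ
  have hQ0 : 0 < Q := by positivity
  obtain ⟨k, τ₀, hτ₀, hcont⟩ := exists_containers l hl (2 ^ (l * r) * (3 * Q * κ))
    (δ / (2 * (r * κ))) (by positivity) (by positivity)
  set w : ℝ := r * κ with hw
  have hw0 : 0 < w := by positivity
  obtain ⟨lam, hlam, hlam1, hlamc⟩ : ∃ lam : ℝ, 0 < lam ∧ lam ≤ 1 ∧ k * (lam * w) ≤ c / 4 := by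
    refine ⟨min 1 (c / (4 * (k * w + 1))), lt_min one_pos (by positivity), min_le_left _ _, ?_⟩
    calc (k : ℝ) * (min 1 (c / (4 * (k * w + 1))) * w) = (k * w) * min 1 (c / (4 * (k * w + 1))) := by
          ring
      _ ≤ (k * w + 1) * (c / (4 * (k * w + 1))) := by
          gcongr
          · linarith
          · exact min_le_right _ _
      _ = c / 4 := by field_simp
  set Λ := Real.log lam⁻¹ with hΛ
  have hΛ0 : 0 ≤ Λ := Real.log_nonneg ((one_le_inv₀ hlam).2 hlam1)
  obtain ⟨τ, hτ, hτ1, hττ, hτc⟩ : ∃ τ : ℝ, 0 < τ ∧ τ ≤ 1 ∧ τ ≤ τ₀ ∧ k * (τ * w * Λ) ≤ c / 4 := by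
    refine ⟨min (min τ₀ 1) (c / (4 * (k * w * Λ + 1))), lt_min (lt_min hτ₀ one_pos) (by positivity),
      (min_le_left _ _).trans (min_le_right _ _), (min_le_left _ _).trans (min_le_left _ _), ?_⟩
    calc (k : ℝ) * (min (min τ₀ 1) (c / (4 * (k * w * Λ + 1))) * w * Λ) =
          (k * w * Λ) * min (min τ₀ 1) (c / (4 * (k * w * Λ + 1))) := by ring
      _ ≤ (k * w * Λ + 1) * (c / (4 * (k * w * Λ + 1))) := by
          gcongr
          · linarith
          · exact min_le_right _ _
      _ = c / 4 := by field_simp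
  obtain ⟨N₂, hN₂⟩ := exists_nat_ge (max (max ((1 / (τ * w)) ^ 2) ((4 * A / c) ^ 2)) (ε ^ 2))
  refine ⟨κ * τ ^ l / (3 * Q), by positivity, max N₁ N₂, ?_⟩
  intro N _ hN B Z X hBK h0B hsp hZ hD hX hXδ
  have hNpos : (0 : ℝ) < N := by exact_mod_cast (Fact.out : N.Prime).pos
  have hNN₁ : N₁ ≤ N := (le_max_left _ _).trans hN
  have hNN₂ : (N₂ : ℝ) ≤ N := by exact_mod_cast (le_max_right _ _).trans hN
  set s := √(N : ℝ) with hs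
  have hs0 : 0 < s := Real.sqrt_pos.2 hNpos
  have hss : s * s = N := Real.mul_self_sqrt hNpos.le
  have hsa : 1 / (τ * w) ≤ s := Real.le_sqrt_of_sq_le
    (((le_max_left _ _).trans (le_max_left _ _)).trans (hN₂.trans hNN₂))
  have hsb : 4 * A / c ≤ s := Real.le_sqrt_of_sq_le
    (((le_max_right _ _).trans (le_max_left _ _)).trans (hN₂.trans hNN₂))
  have hsε : ε ≤ s := Real.le_sqrt_of_sq_le ((le_max_right _ _).trans (hN₂.trans hNN₂))
  have hp0 : 0 ≤ ε / s := by positivity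
  have hp1 : ε / s ≤ 1 := (div_le_one hs0).2 hsε
  have hGn : (#(Z ×ˢ (univ : Finset (Fin r))) : ℝ) ≤ w * s := by
    rw [card_product, card_univ, Fintype.card_fin]
    push_cast
    calc (#Z : ℝ) * r ≤ κ * s * r := by gcongr
      _ = w * s := by rw [hw]; ring
  obtain ⟨cont, hcont⟩ := hcont (ZMod N × Fin r) (ZMod N × Finset (ZMod N × Fin r))
    (extGraphs (schurHyp (ZMod N)) (Fin r) B Z X) Prod.snd (Z ×ˢ univ) (w * s) s τ (by positivity)
    hs0 hτ hττ (by rw [div_le_iff₀ (by positivity)] at hsa; linarith) hGn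
    (fun e he => by
      obtain ⟨hx, ψ, hψ, -⟩ := mem_extGraphs.1 he
      refine ⟨?_, by rw [hψ, card_graphOn]; exact (hX _ hx).2.2.1⟩
      rw [hψ, graphOn_subset]
      exact fun z hz => mem_product.2 ⟨(mem_touched.1 hz).1, mem_univ _⟩)
    (fun S hS => by
      have := edgeDeg_extGraphs_le_pow (𝓗 := schurHyp (ZMod N)) (κ := Fin r) (Q := Q) (l := l)
        (D := ⌊κ * τ ^ l / (3 * Q) * s⌋₊) (κ' := κ) (η := κ * τ ^ l / (3 * Q)) (τ := τ) (s := s)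
        h0B (by rw [hQ]; have : (#B : ℝ) ≤ K := by exact_mod_cast hBK
                linarith) hQ0
        (fun x hx => ⟨(hX x hx).2.1, (hX x hx).2.2.1⟩) hs0.le hZ
        (fun f g hf hg => Nat.le_floor (hD f g hf hg)) (Nat.floor_le (by positivity)) hτ.le hτ1 hκ.le
        (by field_simp; exact le_rfl) S hS
      rwa [Fintype.card_fin] at this)
  set 𝒞 := Fintype.piFinset fun _ : Fin k =>
    {T ∈ (Z ×ˢ (univ : Finset (Fin r))).powerset | #T ≤ ⌊τ * (w * s)⌋₊} with h𝒞
  have hstep : Pr univ (ε / s) (fun R : Finset (ZMod N) => ¬ IsSchur r N (Z ∪ R)) ≤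
      ∑ T ∈ 𝒞, A * Real.exp (-(c * s)) := by
    refine (Pr_mono hp0 hp1 (Q := fun R => ∃ T ∈ 𝒞,
      (#{e ∈ extGraphs (schurHyp (ZMod N)) (Fin r) B Z X | e.2 ⊆ cont T} : ℝ) ≤ δ / 2 * N ∧
      ∃ φ : ZMod N → Fin r, graphOn φ Z ⊆ cont T ∧ Proper φ (Z ∪ R)) ?_).trans
      ((Pr_exists_le hp0 hp1 𝒞 _).trans (sum_le_sum fun T _ => ?_))
    · intro R _ hR
      rw [isSchur_iff, not_not] at hR
      obtain ⟨φ, hφ⟩ := hR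
      have hφZ : Proper φ Z := hφ.mono subset_union_left
      obtain ⟨T, hT1, hT2, hT3⟩ := hcont (graphOn φ Z)
        (graphOn_subset.2 fun z hz => mem_product.2 ⟨hz, mem_univ _⟩) (fun e he hsub => by
          obtain ⟨hx, ψ, hψ, hcol⟩ := mem_extGraphs.1 he
          obtain ⟨hcl, -, -, hS⟩ := hX _ hx
          refine not_listColourable_of_isSchur hcl hS hφZ ?_
          rw [hψ, graphOn_subset] at hsub
          obtain ⟨σ, h1, h2⟩ := hcol
          refine ⟨σ, fun b hb => ?_, h2⟩
          rw [lists_congr (A' := fun z => {ψ z}) (fun z hz => ?_) hb]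
          · exact h1 b hb
          · exact congrArg _ (mem_graphOn.1 (hsub z hz)).2)
      refine ⟨T, ?_, ?_, φ, hT2, hφ⟩
      · rw [h𝒞, Fintype.mem_piFinset]
        intro j
        refine mem_filter.2 ⟨mem_powerset.2 ((hT1 j).1.trans ?_), Nat.le_floor (hT1 j).2⟩
        exact graphOn_subset.2 fun z hz => mem_product.2 ⟨hz, mem_univ _⟩
      · refine hT3.trans_eq ?_
        rw [← hss]
        field_simp
    · by_cases hT : (#{e ∈ extGraphs (schurHyp (ZMod N)) (Fin r) B Z X | e.2 ⊆ cont T} : ℝ) ≤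
          δ / 2 * N
      · simp only [hT, true_and]
        exact Pr_container_le hr hBK (fun x hx => (hX x hx).2.1) hδ hXδ hT (by positivity)
          fun X' Y L 𝓕 h1 h2 h3 h4 => haux N hNN₁ B X' Y L 𝓕 h1 h0B hsp h2 h3 h4
      · unfold Pr
        simp only [hT, false_and, ind_neg not_false]
        rw [Ex_const]
        positivity
  refine hstep.trans ?_
  rw [sum_const, nsmul_eq_mul]
  have hcount := card_codes_le (Z ×ˢ (univ : Finset (Fin r))) k hlam hlam1 hGn hτ.le
  have hexp : (k : ℝ) * (τ * (w * s) * Λ + lam * (w * s)) ≤ c / 2 * s := by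
    have := mul_le_mul_of_nonneg_right (add_le_add hτc hlamc) hs0.le
    calc _ = (k * (τ * w * Λ) + k * (lam * w)) * s := by ring
      _ ≤ _ := this
      _ = _ := by ring
  calc (#𝒞 : ℝ) * (A * Real.exp (-(c * s))) ≤ Real.exp (c / 2 * s) * (A * Real.exp (-(c * s))) := by
        gcongr
        exact hcount.trans (Real.exp_le_exp.2 hexp)
    _ = A * Real.exp (-(c / 2 * s)) := by
        rw [mul_left_comm, ← Real.exp_add]
        congr 2
        ring
    _ ≤ 1 / 2 := by
        rw [Real.exp_neg, ← div_eq_mul_inv, div_le_iff₀ (Real.exp_pos _)]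
        rw [div_le_iff₀ hc] at hsb
        linarith [Real.add_one_le_exp (c / 2 * s)]

end FixedTouched

section Typical
open Finset

lemma exists_uniform_bounds (P : ℕ → ℝ → ℕ → Prop) (hP : ∀ l η η' N N', η' ≤ η → N ≤ N' → P l η N →
    P l η' N') (h : ∀ l, ∃ η > 0, ∃ N, P l η N) (m : ℕ) : ∃ η > 0, ∃ N, ∀ l ≤ m, P l η N := by
  induction m with
  | zero =>
    obtain ⟨η, hη, N, hN⟩ := h 0
    exact ⟨η, hη, N, fun l hl => by rwa [Nat.le_zero.1 hl]⟩
  | succ m ih =>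
    obtain ⟨η, hη, N, hN⟩ := ih
    obtain ⟨η', hη', N', hN'⟩ := h (m + 1)
    refine ⟨min η η', lt_min hη hη', max N N', fun l hl => ?_⟩
    rcases Nat.lt_or_ge m l with h | h
    · obtain rfl : l = m + 1 := by omega
      exact hP _ _ _ _ _ (min_le_right _ _) (le_max_right _ _) hN'
    · exact hP _ _ _ _ _ (min_le_left _ _) (le_max_left _ _) (hN l h)

theorem extension_bound (r : ℕ) (hr : 2 ≤ r) (K m : ℕ) (κ δ ε : ℝ) (hκ : 0 < κ) (hδ : 0 < δ)
    (hε : 0 < ε) : ∃ η > 0, ∃ N₀ : ℕ, ∀ (N : ℕ) [Fact N.Prime], N₀ ≤ N →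
    ∀ B Z X : Finset (ZMod N), #B ≤ K → 0 ∉ B → (∀ U ⊆ B, 2 * srk U ≤ #U) → #Z ≤ κ * √N →
      (∀ f g : ZMod N × ZMod N, f.1 ≠ 0 → g.1 ≠ 0 → pairCount Z f g ≤ η * √N) →
      (∀ x ∈ X, Clean B Z x ∧ Matched B Z x ∧ #(touched B Z x) ≤ m ∧
        IsSchur r N (Z ∪ B.image (x * ·))) → δ * N ≤ #X →
      Pr univ (ε / √N) (fun R => ¬ IsSchur r N (Z ∪ R)) ≤ 1 / 2 := by
  obtain ⟨η, hη, N₀, h⟩ := exists_uniform_bounds _ (by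
      intro l η η' N₀ N₀' hη hN h N _ hNN B Z X hB h0 hsp hZ hD hX hXδ
      exact h N (hN.trans hNN) B Z X hB h0 hsp hZ (fun f g hf hg => (hD f g hf hg).trans
        (mul_le_mul_of_nonneg_right hη (Real.sqrt_nonneg _))) hX hXδ)
    (extension_bound_touched r hr K κ (δ / (m + 1)) ε hκ (by positivity) hε) m
  refine ⟨η, hη, N₀, fun N _ hN B Z X hB h0 hsp hZ hD hX hXδ => ?_⟩
  obtain ⟨l, hl, hlX⟩ := exists_le_card_fiber_of_nsmul_le_card_of_maps_to (s := X)
    (t := range (m + 1)) (f := fun x => #(touched B Z x)) (b := (δ / (m + 1) * N))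
    (fun x hx => mem_range.2 (by have := (hX x hx).2.2.1; omega)) ⟨0, by simp⟩ (by
      rw [nsmul_eq_mul, card_range]
      push_cast
      calc _ = δ * N := by field_simp
        _ ≤ _ := hXδ)
  refine h l (by rw [mem_range] at hl; omega) N hN B Z {x ∈ X | #(touched B Z x) = l} hB h0 hsp hZ hD
    (fun x hx => ?_) hlX
  obtain ⟨hx, hxl⟩ := mem_filter.1 hx
  exact ⟨(hX x hx).1, (hX x hx).2.1, hxl, (hX x hx).2.2.2⟩

variable {F : Type} [Field F] [Fintype F] [DecidableEq F] {B Z : Finset F}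

/-- The values at `x` of two affine forms. -/
def affPair (f g : F × F) (x : F) : Finset F := {f.1 * x + f.2, g.1 * x + g.2}

lemma card_affine_preimage_le {f : F × F} (hf : f.1 ≠ 0) (P : Finset F) :
    #{x | f.1 * x + f.2 ∈ P} ≤ #P :=
  card_le_card_of_injOn (fun x => f.1 * x + f.2) (fun _ hx => (mem_filter.1 hx).2)
    fun _ _ _ _ h => mul_left_cancel₀ hf (add_right_cancel h)

lemma exists_disjoint_pairs {f g : F × F} (hf : f.1 ≠ 0) (hg : g.1 ≠ 0) {s : ℕ}
    (hs : 4 * s ≤ pairCount Z f g) : ∀ j ≤ s, ∃ T : Finset F, #T = j ∧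
      T.biUnion (affPair f g) ⊆ Z ∧ #(T.biUnion (affPair f g)) = 2 * j := by
  intro j
  induction j with
  | zero => exact fun _ => ⟨∅, by simp⟩
  | succ j ih =>
    intro hj
    obtain ⟨T, hT, hTZ, hTc⟩ := ih (by omega)
    set P := T.biUnion (affPair f g) with hP
    by_contra hcon
    have hsub : ({x | f.1 * x + f.2 ∈ Z ∧ g.1 * x + g.2 ∈ Z ∧ f.1 * x + f.2 ≠ g.1 * x + g.2} :
        Finset F) ⊆ ({x | f.1 * x + f.2 ∈ P} : Finset F) ∪ ({x | g.1 * x + g.2 ∈ P} : Finset F) := by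
      intro x hx
      obtain ⟨-, h1, h2, h3⟩ := mem_filter.1 hx
      by_contra hxP
      simp only [mem_union, mem_filter, mem_univ, true_and, not_or] at hxP
      have hxT : x ∉ T := fun h => hxP.1 (mem_biUnion.2 ⟨x, h, by simp [affPair]⟩)
      refine hcon ⟨insert x T, by rw [card_insert_of_notMem hxT, hT], ?_, ?_⟩
      · rw [biUnion_insert]
        refine union_subset ?_ hTZ
        simp [affPair, insert_subset_iff, h1, h2]
      · rw [biUnion_insert, card_union_of_disjoint, ← hP, hTc, affPair, card_pair h3]
        · ring
        · rw [affPair, disjoint_left]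
          intro a ha
          simp only [mem_insert, mem_singleton] at ha
          rcases ha with rfl | rfl
          · exact hxP.1
          · exact hxP.2
    have h1 := (card_le_card hsub).trans (card_union_le _ _)
    have h2 := card_affine_preimage_le hf P
    have h3 := card_affine_preimage_le hg P
    unfold pairCount at hs
    omega

lemma Pr_pairCount_le {f g : F × F} (hf : f.1 ≠ 0) (hg : g.1 ≠ 0) (s : ℕ) {p : ℝ} (h0 : 0 ≤ p)
    (h1 : p ≤ 1) : Pr univ p (fun Z => 4 * s ≤ pairCount Z f g) ≤
      (Fintype.card F * p ^ 2) ^ s / s.factorial := by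
  set 𝒯 := {T ∈ (univ : Finset F).powersetCard s | #(T.biUnion (affPair f g)) = 2 * s} with h𝒯
  refine (Pr_mono h0 h1 (Q := fun Z => ∃ T ∈ 𝒯, T.biUnion (affPair f g) ⊆ Z) ?_).trans
    ((Pr_exists_le h0 h1 𝒯 _).trans ?_)
  · intro Z _ hZ
    obtain ⟨T, h1, h2, h3⟩ := exists_disjoint_pairs hf hg hZ s le_rfl
    exact ⟨T, mem_filter.2 ⟨mem_powersetCard.2 ⟨subset_univ _, h1⟩, h3⟩, h2⟩
  · calc _ = ∑ T ∈ 𝒯, (p ^ 2) ^ s := sum_congr rfl fun T hT => by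
          rw [Pr_subset p (subset_univ _), (mem_filter.1 hT).2, pow_mul]
      _ ≤ (Fintype.card F).choose s * (p ^ 2) ^ s := by
          rw [sum_const, nsmul_eq_mul, ← card_univ, ← card_powersetCard]
          gcongr
          exact filter_subset _ _
      _ ≤ (Fintype.card F : ℝ) ^ s / s.factorial * (p ^ 2) ^ s := by
          gcongr
          exact Nat.choose_le_pow_div s _
      _ = _ := by rw [mul_pow]; ring

lemma exists_factorial_bound (κ η δ : ℝ) (hη : 0 < η) (hδ : 0 < δ) : ∃ N₀ : ℕ, ∀ N : ℕ,
    N₀ ≤ N → (N : ℝ) ^ 4 * ((κ ^ 2) ^ ⌊η * √N⌋₊ / (⌊η * √N⌋₊.factorial : ℝ)) ≤ δ := by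
  set C := (1 / η) ^ 8 * (Nat.factorial 8 * Real.exp 1) with hC
  have hC0 : 0 < C := by positivity
  have hlim := FloorSemiring.tendsto_pow_div_factorial_atTop (Real.exp 1 * κ ^ 2)
  have hs : Filter.Tendsto (fun N : ℕ => ⌊η * √N⌋₊) Filter.atTop Filter.atTop :=
    tendsto_nat_floor_atTop.comp ((Real.tendsto_sqrt_atTop.comp
      tendsto_natCast_atTop_atTop).const_mul_atTop hη)
  have h := ((hlim.comp hs).eventually (gt_mem_nhds (show 0 < δ / C by positivity)))
  obtain ⟨N₀, hN₀⟩ := Filter.eventually_atTop.1 h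
  refine ⟨N₀, fun N hN => ?_⟩
  have h1 := (hN₀ N hN).le
  simp only [Function.comp] at h1
  set s := ⌊η * √N⌋₊ with hs
  have h2 : η * √N ≤ s + 1 := (Nat.lt_floor_add_one _).le
  have h3 : (N : ℝ) ^ 4 = (1 / η) ^ 8 * (η * √N) ^ 8 := by
    rw [mul_pow, show (√(N : ℝ)) ^ 8 = ((√(N : ℝ)) ^ 2) ^ 4 by ring, Real.sq_sqrt (by positivity)]
    field_simp
  have h4 : ((s : ℝ) + 1) ^ 8 ≤ Nat.factorial 8 * Real.exp (s + 1) := by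
    have := Real.pow_div_factorial_le_exp ((s : ℝ) + 1) (by positivity) 8
    rwa [div_le_iff₀ (by positivity), mul_comm] at this
  have h5 : (N : ℝ) ^ 4 ≤ C * Real.exp 1 ^ s := by
    rw [h3, ← Real.exp_nat_mul, mul_one, hC, mul_assoc, mul_assoc, ← Real.exp_add, add_comm 1]
    gcongr
    exact (pow_le_pow_left₀ (by positivity) h2 8).trans h4
  calc _ ≤ (C * Real.exp 1 ^ s) * ((κ ^ 2) ^ s / s.factorial) := by gcongr
    _ = C * ((Real.exp 1 * κ ^ 2) ^ s / s.factorial) := by rw [mul_pow]; ring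
    _ ≤ C * (δ / C) := by gcongr
    _ = δ := by field_simp

/-- The possible third elements of a Schur triple with `z` and an element of `xB`. -/
def partners (B : Finset F) (x z : F) : Finset F :=
  B.biUnion fun b => {x * b - z, z - x * b, z + x * b}

lemma Nbr.mem_partners {x z w : F} (h : Nbr B x z w) : w ∈ partners B x z := by
  obtain ⟨b, hb, -, -, -, h⟩ := h
  refine mem_biUnion.2 ⟨b, hb, ?_⟩
  simp only [mem_insert, mem_singleton]
  rcases h with h | h | h
  · exact Or.inl (by linear_combination h)
  · exact Or.inr (Or.inr h.symm)
  · exact Or.inr (Or.inl (by linear_combination h))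

lemma card_partners_le (B : Finset F) (x z : F) : #(partners B x z) ≤ #B * 3 :=
  card_biUnion_le_card_mul _ _ 3 fun _ _ => card_le_three

open Classical in
lemma Pr_not_matched_le (B : Finset F) (x : F) {p : ℝ} (h0 : 0 ≤ p) (h1 : p ≤ 1) :
    Pr univ p (fun Z => ¬ Matched B Z x) ≤ 9 * #B ^ 2 * Fintype.card F * p ^ 3 := by
  set 𝒯 := (univ : Finset F).biUnion fun z => {e ∈ ({z} : Finset F) ×ˢ partners B x z ×ˢ
    partners B x z | #({e.1, e.2.1, e.2.2} : Finset F) = 3} with h𝒯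
  have hcard : #𝒯 ≤ Fintype.card F * (#B * 3 * (#B * 3)) := by
    refine (card_biUnion_le_card_mul _ _ _ fun z _ => ?_).trans_eq (by rw [card_univ])
    refine (card_filter_le _ _).trans ?_
    rw [card_product, card_product, card_singleton, one_mul]
    exact Nat.mul_le_mul (card_partners_le B x z) (card_partners_le B x z)
  refine (Pr_mono h0 h1 (Q := fun Z => ∃ e ∈ 𝒯, ({e.1, e.2.1, e.2.2} : Finset F) ⊆ Z) ?_).trans
    ((Pr_exists_le h0 h1 𝒯 _).trans ?_)
  · intro Z _ hZ
    unfold Matched at hZ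
    push Not at hZ
    obtain ⟨z, hz, w, hw, w', hw', hn, hn', hne⟩ := hZ
    refine ⟨(z, w, w'), ?_, by simp [insert_subset_iff, hz, hw, hw']⟩
    refine mem_biUnion.2 ⟨z, mem_univ _, mem_filter.2 ⟨?_, ?_⟩⟩
    · simp [hn.mem_partners, hn'.mem_partners]
    · obtain ⟨_, _, h, -⟩ := hn
      obtain ⟨_, _, h', -⟩ := hn'
      exact card_eq_three.2 ⟨z, w, w', h, h', hne, rfl⟩
  · calc _ = ∑ e ∈ 𝒯, p ^ 3 := sum_congr rfl fun e he => by
          obtain ⟨z, -, he⟩ := mem_biUnion.1 he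
          rw [Pr_subset p (subset_univ _), (mem_filter.1 he).2]
      _ ≤ (Fintype.card F * (#B * 3 * (#B * 3)) : ℕ) * p ^ 3 := by
          rw [sum_const, nsmul_eq_mul]
          gcongr
      _ = _ := by
          push_cast
          ring

lemma Ex_card_filter_eq (P : Finset F → F → Prop) [∀ Z x, Decidable (P Z x)] (p : ℝ) :
    Ex univ p (fun Z => (#{x | P Z x} : ℝ)) = ∑ x, Pr univ p (fun Z => P Z x) := by
  unfold Pr
  rw [← Ex_sum]
  refine Ex_congr fun Z _ => ?_
  rw [card_filter]
  push_cast
  refine sum_congr rfl fun x _ => ?_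
  by_cases h : P Z x
  · rw [if_pos h, ind_pos h]
  · rw [if_neg h, ind_neg h]

open Classical in
/-- The sets `Z` to which the extension bound applies for most dilation factors. -/
def Typical (B Z : Finset F) (a γ η : ℝ) : Prop :=
  0 ∉ Z ∧ #Z ≤ a ∧ #{x | ¬ Matched B Z x} ≤ γ ∧
    ∀ f g : F × F, f.1 ≠ 0 → g.1 ≠ 0 → pairCount Z f g ≤ η

theorem exists_typical (K : ℕ) (κ δ γ η : ℝ) (hκ : 0 < κ) (hδ : 0 < δ) (hγ : 0 < γ) (hη : 0 < η) :
    ∃ N₀ : ℕ, ∀ (N : ℕ) [Fact N.Prime], N₀ ≤ N → ∀ p : ℝ, 0 ≤ p → p ≤ 1 → p ≤ κ / √N →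
      ∀ B : Finset (ZMod N), #B ≤ K →
        Pr univ p (fun Z => ¬ Typical B Z (4 * κ / δ * √N) (γ * N) (η * √N)) ≤ δ := by
  classical
  obtain ⟨N₁, hN₁⟩ := exists_factorial_bound κ (η / 4) (δ / 4) (by positivity) (by positivity)
  obtain ⟨N₂, hN₂⟩ := exists_nat_ge (max ((4 * κ / δ) ^ 2) ((36 * K ^ 2 * κ ^ 3 / (γ * δ)) ^ 2))
  refine ⟨max N₁ N₂, fun N _ hN p h0 h1 hp B hB => ?_⟩
  have hNpos : (0 : ℝ) < N := by exact_mod_cast (Fact.out : N.Prime).pos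
  have hNN₁ : N₁ ≤ N := (le_max_left _ _).trans hN
  have hNN₂ : (N₂ : ℝ) ≤ N := by exact_mod_cast (le_max_right _ _).trans hN
  have hfac := hN₁ N hNN₁
  set s := √(N : ℝ) with hs
  have hs0 : 0 < s := Real.sqrt_pos.2 hNpos
  have hss : s * s = N := Real.mul_self_sqrt hNpos.le
  have hsa : 4 * κ / δ ≤ s := Real.le_sqrt_of_sq_le ((le_max_left _ _).trans (hN₂.trans hNN₂))
  have hsb : 36 * K ^ 2 * κ ^ 3 / (γ * δ) ≤ s :=
    Real.le_sqrt_of_sq_le ((le_max_right _ _).trans (hN₂.trans hNN₂))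
  rw [div_le_iff₀ (by positivity)] at hsa hsb
  have hps : p * s ≤ κ := by rwa [le_div_iff₀ hs0] at hp
  have hps0 : 0 ≤ p * s := by positivity
  have hcardF : Fintype.card (ZMod N) = N := ZMod.card N
  have ha : Pr univ p (fun Z : Finset (ZMod N) => 0 ∈ Z) ≤ δ / 4 := by
    have := Pr_subset (X := (univ : Finset (ZMod N))) p (T := {0}) (subset_univ _)
    simp only [singleton_subset_iff, card_singleton, pow_one] at this
    rw [this]
    refine hp.trans ?_
    rw [div_le_iff₀ hs0]
    linarith
  have hb : Pr univ p (fun Z : Finset (ZMod N) => ¬ (#Z : ℝ) ≤ 4 * κ / δ * s) ≤ δ / 4 := by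
    have h := Pr_mul_le_Ex (X := (univ : Finset (ZMod N))) h0 h1 (t := 4 * κ / δ * s)
      (F := fun Z => (#Z : ℝ)) (P := fun Z => ¬ (#Z : ℝ) ≤ 4 * κ / δ * s) (by positivity)
      (fun _ _ => Nat.cast_nonneg _) (fun Z _ hZ => (not_le.1 hZ).le)
    have h2 := Ex_card_inter (univ : Finset (ZMod N)) univ (subset_univ _) p
    simp only [inter_univ, card_univ, hcardF] at h2
    rw [h2] at h
    refine le_of_mul_le_mul_right (h.trans ?_) (show 0 < 4 * κ / δ * s by positivity)
    calc p * N = p * s * s := by rw [← hss]; ring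
      _ ≤ κ * s := by gcongr
      _ = _ := by field_simp
  have hc : Pr univ p (fun Z : Finset (ZMod N) => ¬ (#{x | ¬ Matched B Z x} : ℝ) ≤ γ * N) ≤
      δ / 4 := by
    have h := Pr_mul_le_Ex (X := (univ : Finset (ZMod N))) h0 h1 (t := γ * N)
      (F := fun Z => (#{x | ¬ Matched B Z x} : ℝ))
      (P := fun Z => ¬ (#{x | ¬ Matched B Z x} : ℝ) ≤ γ * N) (by positivity)
      (fun _ _ => Nat.cast_nonneg _) (fun Z _ hZ => (not_le.1 hZ).le)
    rw [Ex_card_filter_eq (fun Z x => ¬ Matched B Z x)] at h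
    have hBK : (#B : ℝ) ≤ K := by exact_mod_cast hB
    have h2 : ∑ x : ZMod N, Pr univ p (fun Z => ¬ Matched B Z x) ≤ 9 * K ^ 2 * κ ^ 3 * s := by
      refine (sum_le_sum fun x _ => Pr_not_matched_le B x h0 h1).trans ?_
      rw [sum_const, card_univ, hcardF, nsmul_eq_mul]
      calc (N : ℝ) * (9 * #B ^ 2 * N * p ^ 3) = 9 * (#B : ℝ) ^ 2 * (p * s) ^ 3 * s := by
            rw [← hss]; ring
        _ ≤ 9 * (K : ℝ) ^ 2 * κ ^ 3 * s := by gcongr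
    refine le_of_mul_le_mul_right ((h.trans h2).trans ?_) (show 0 < γ * N by positivity)
    rw [← hss]
    nlinarith [mul_le_mul_of_nonneg_right hsb hs0.le]
  have hd : Pr univ p (fun Z : Finset (ZMod N) => ¬ ∀ f g : ZMod N × ZMod N, f.1 ≠ 0 → g.1 ≠ 0 →
      (pairCount Z f g : ℝ) ≤ η * s) ≤ δ / 4 := by
    set t := ⌊η / 4 * s⌋₊ with ht
    have ht2 : (t : ℝ) ≤ η / 4 * s := Nat.floor_le (by positivity)
    set 𝒬 : Finset ((ZMod N × ZMod N) × (ZMod N × ZMod N)) := {e | e.1.1 ≠ 0 ∧ e.2.1 ≠ 0} with h𝒬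
    refine (Pr_mono h0 h1 (Q := fun Z => ∃ e ∈ 𝒬, 4 * t ≤ pairCount Z e.1 e.2) ?_).trans
      ((Pr_exists_le h0 h1 𝒬 _).trans ?_)
    · intro Z _ hZ
      push Not at hZ
      obtain ⟨f, g, hf, hg, hfg⟩ := hZ
      refine ⟨(f, g), mem_filter.2 ⟨mem_univ _, hf, hg⟩, ?_⟩
      have : ((4 * t : ℕ) : ℝ) ≤ pairCount Z f g := by
        push_cast
        linarith
      exact_mod_cast this
    · have hnp : (N : ℝ) * p ^ 2 ≤ κ ^ 2 := by
        calc (N : ℝ) * p ^ 2 = (p * s) ^ 2 := by rw [← hss]; ring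
          _ ≤ κ ^ 2 := by gcongr
      calc _ ≤ ∑ e ∈ 𝒬, (κ ^ 2) ^ t / (t.factorial : ℝ) := sum_le_sum fun e he => by
            have he := (mem_filter.1 he).2
            refine (Pr_pairCount_le he.1 he.2 t h0 h1).trans ?_
            rw [hcardF]
            gcongr
        _ ≤ (N : ℝ) ^ 4 * ((κ ^ 2) ^ t / (t.factorial : ℝ)) := by
            rw [sum_const, nsmul_eq_mul]
            gcongr
            have : #𝒬 ≤ N ^ 4 := by
              refine (card_le_univ _).trans_eq ?_
              simp only [Fintype.card_prod, hcardF]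
              ring
            exact_mod_cast this
        _ ≤ _ := hfac
  have hor : Pr univ p (fun Z => ¬ Typical B Z (4 * κ / δ * s) (γ * N) (η * s)) ≤
      Pr univ p (fun Z : Finset (ZMod N) => 0 ∈ Z ∨ ¬ (#Z : ℝ) ≤ 4 * κ / δ * s ∨
        ¬ (#{x | ¬ Matched B Z x} : ℝ) ≤ γ * N ∨ ¬ ∀ f g : ZMod N × ZMod N, f.1 ≠ 0 → g.1 ≠ 0 →
        (pairCount Z f g : ℝ) ≤ η * s) := by
    refine Pr_mono h0 h1 fun Z _ hZ => ?_
    by_contra hcon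
    rw [not_or, not_or, not_or, not_not, not_not, not_not] at hcon
    exact hZ hcon
  have o1 := hor.trans (Pr_or_le h0 h1 _ _)
  have o2 := o1.trans (add_le_add_right (Pr_or_le h0 h1 _ _) _)
  have o3 := o2.trans (add_le_add_right (add_le_add_right (Pr_or_le h0 h1 _ _) _) _)
  refine o3.trans ?_
  linarith

end Typical

section Contradiction
open Finset

lemma isSchur_image {r N : ℕ} [Fact N.Prime] {x : ZMod N} (hx : x ≠ 0) (Y : Finset (ZMod N)) :
    IsSchur r N (Y.image (x * ·)) ↔ IsSchur r N Y := by
  have key : ∀ {x : ZMod N}, x ≠ 0 → ∀ Y : Finset (ZMod N), IsSchur r N Y →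
      IsSchur r N (Y.image (x * ·)) := by
    intro x hx Y hY c
    obtain ⟨a, b, d, ha, hb, hd, h1, h2, h3, h4, h5⟩ := hY fun y => c (x * y)
    refine ⟨x * a, x * b, x * d, mem_image_of_mem _ ha, mem_image_of_mem _ hb,
      mem_image_of_mem _ hd, ?_, ?_, ?_, ?_, h5⟩
    · exact fun h => h1 (mul_left_cancel₀ hx h)
    · exact fun h => h2 (mul_left_cancel₀ hx h)
    · exact fun h => h3 (mul_left_cancel₀ hx h)
    · rw [← mul_add, h4]
  refine ⟨fun h => ?_, key hx Y⟩
  have := key (inv_ne_zero hx) _ h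
  rwa [image_image, show ((x⁻¹ * ·) ∘ (x * ·)) = id from funext fun y => inv_mul_cancel_left₀ hx y,
    image_id] at this

lemma Pr_dilate {r N : ℕ} [Fact N.Prime] {x : ZMod N} (hx : x ≠ 0) (B : Finset (ZMod N)) (p : ℝ) :
    Pr univ p (fun Z => ¬ IsSchur r N Z ∧ IsSchur r N (Z ∪ B.image (x * ·))) =
      Pr univ p (fun Z => ¬ IsSchur r N Z ∧ IsSchur r N (Z ∪ B)) := by
  unfold Pr
  rw [← Ex_map_equiv (Equiv.mulLeft₀ x hx)]
  refine Ex_congr fun Z _ => ?_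
  have h1 : Z.map (Equiv.mulLeft₀ x hx).toEmbedding = Z.image (x * ·) := map_eq_image _ _
  simp only [h1, ← image_union, isSchur_image hx]

lemma reverse_markov {α : Type*} [DecidableEq α] {X : Finset α} {p : ℝ} (h0 : 0 ≤ p) (h1 : p ≤ 1)
    {W : Finset α → ℝ} {n t : ℝ} (ht : 0 ≤ t) (hW : ∀ S ⊆ X, W S ≤ n) :
    Ex X p W - t ≤ n * Pr X p (fun S => t ≤ W S) := by
  unfold Pr
  have h : Ex X p W ≤ Ex X p (fun S => n * ind (t ≤ W S) + t) := by
    refine Ex_mono h0 h1 fun S hS => ?_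
    by_cases h : t ≤ W S
    · rw [ind_pos h]
      linarith [hW S hS]
    · rw [ind_neg h]
      linarith
  rw [Ex_add, Ex_const_mul, Ex_const] at h
  linarith

lemma card_filter_and_ge {α : Type*} [DecidableEq α] (s : Finset α) (P Q R T : α → Prop)
    [DecidablePred P] [DecidablePred Q] [DecidablePred R] [DecidablePred T] :
    #{x ∈ s | P x} ≤ #{x ∈ s | Q x ∧ R x ∧ T x ∧ P x} + #{x ∈ s | ¬ Q x} + #{x ∈ s | ¬ R x} +
      #{x ∈ s | ¬ T x} := by
  have hsub : {x ∈ s | P x} ⊆ {x ∈ s | Q x ∧ R x ∧ T x ∧ P x} ∪ {x ∈ s | ¬ Q x} ∪ {x ∈ s | ¬ R x} ∪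
      {x ∈ s | ¬ T x} := by
    intro x
    simp only [mem_union, mem_filter]
    tauto
  refine (card_le_card hsub).trans ((card_union_le _ _).trans ?_)
  gcongr
  refine (card_union_le _ _).trans ?_
  gcongr
  exact card_union_le _ _

theorem booster_bound (r : ℕ) (hr : 2 ≤ r) (K : ℕ) (δ κ ε : ℝ) (hδ : 0 < δ) (hκ : 0 < κ)
    (hε : 0 < ε) : ∃ N₀ : ℕ, ∀ (N : ℕ) [Fact N.Prime], N₀ ≤ N → ∀ p : ℝ, 0 ≤ p → p ≤ 1 →
      p ≤ κ / √N → ∀ B : Finset (ZMod N), #B ≤ K → 0 ∉ B → (∀ U ⊆ B, 2 * srk U ≤ #U) →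
      δ ≤ Pr univ p (fun Z => ¬ IsSchur r N Z ∧ IsSchur r N (Z ∪ B)) →
      δ / 8 ≤ Ex univ p (fun Z => ind (¬ IsSchur r N Z) *
        Pr univ (ε / √N) (fun R => IsSchur r N (Z ∪ R))) := by
  classical
  set κ' := 4 * κ / (δ / 4) with hκ'
  have hκ'0 : 0 < κ' := by positivity
  obtain ⟨m, hm⟩ := exists_nat_ge (48 * K * κ' ^ 2 / δ)
  obtain ⟨η, hη, N₁, hext⟩ := extension_bound r hr K m κ' (δ / 16) ε hκ'0 (by positivity) hε
  obtain ⟨N₂, htyp⟩ := exists_typical K κ (δ / 4) (δ / 16) η hκ (by positivity) (by positivity) hη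
  obtain ⟨N₃, hN₃⟩ := exists_nat_ge (max (max 4 (ε ^ 2)) ((16 * (1 + 4 * K ^ 2 * κ') / δ) ^ 2))
  refine ⟨max (max N₁ N₂) N₃, fun N _ hN p h0 h1 hp B hB h0B hsp hδB => ?_⟩
  have hNN₁ : N₁ ≤ N := ((le_max_left _ _).trans (le_max_left _ _)).trans hN
  have hNN₂ : N₂ ≤ N := ((le_max_right _ _).trans (le_max_left _ _)).trans hN
  have hNN₃ : (N₃ : ℝ) ≤ N := by exact_mod_cast (le_max_right _ _).trans hN
  have hN4 : (4 : ℝ) ≤ N := ((le_max_left _ _).trans (le_max_left _ _)).trans (hN₃.trans hNN₃)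
  have hNpos : (0 : ℝ) < N := by linarith
  have htyp := htyp N hNN₂ p h0 h1 hp B hB
  rw [← hκ'] at htyp
  have hext := hext N hNN₁ B
  set s := √(N : ℝ) with hs
  have hs0 : 0 < s := Real.sqrt_pos.2 hNpos
  have hss : s * s = N := Real.mul_self_sqrt hNpos.le
  have hs1 : 1 ≤ s := Real.one_le_sqrt.2 (by linarith)
  have hsε : ε ≤ s := Real.le_sqrt_of_sq_le
    (((le_max_right _ _).trans (le_max_left _ _)).trans (hN₃.trans hNN₃))
  have hsa : 16 * (1 + 4 * K ^ 2 * κ') / δ ≤ s :=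
    Real.le_sqrt_of_sq_le ((le_max_right _ _).trans (hN₃.trans hNN₃))
  rw [div_le_iff₀ hδ] at hsa
  have hq0 : 0 ≤ ε / s := by positivity
  have hq1 : ε / s ≤ 1 := (div_le_one hs0).2 hsε
  set W : Finset (ZMod N) → ℝ := fun Z =>
    #{x | ¬ IsSchur r N Z ∧ IsSchur r N (Z ∪ B.image (x * ·))} with hW
  have hWN : ∀ Z ⊆ (univ : Finset (ZMod N)), W Z ≤ N := fun Z _ => by
    have := card_le_univ ({x | ¬ IsSchur r N Z ∧ IsSchur r N (Z ∪ B.image (x * ·))} :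
      Finset (ZMod N))
    rw [ZMod.card] at this
    simp only [hW]
    exact_mod_cast this
  have hEW : 3 / 4 * N * δ ≤ Ex univ p W := by
    rw [hW, Ex_card_filter_eq (fun Z x => ¬ IsSchur r N Z ∧ IsSchur r N (Z ∪ B.image (x * ·))) p]
    calc 3 / 4 * N * δ ≤ (N - 1) * δ := by
          gcongr
          linarith
      _ = ∑ x ∈ univ.erase (0 : ZMod N), δ := by
          rw [sum_const, card_erase_of_mem (mem_univ _), card_univ, ZMod.card, nsmul_eq_mul,
            Nat.cast_sub (Fact.out : N.Prime).one_lt.le, Nat.cast_one]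
      _ ≤ ∑ x ∈ univ.erase (0 : ZMod N), Pr univ p (fun Z => ¬ IsSchur r N Z ∧
            IsSchur r N (Z ∪ B.image (x * ·))) := sum_le_sum fun x hx => by
          rw [Pr_dilate (ne_of_mem_erase hx)]
          exact hδB
      _ ≤ _ := sum_le_sum_of_subset_of_nonneg (erase_subset _ _) fun x _ _ => Pr_nonneg h0 h1 _
  have hmark := reverse_markov h0 h1 (t := δ / 4 * N) (by positivity) hWN
  have hbig : δ / 2 ≤ Pr univ p (fun Z => δ / 4 * N ≤ W Z) := by
    refine le_of_mul_le_mul_left ?_ hNpos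
    linarith
  have hpt : ∀ Z ⊆ (univ : Finset (ZMod N)), 1 / 2 * (ind (δ / 4 * N ≤ W Z) -
      ind (¬ Typical B Z (κ' * s) (δ / 16 * N) (η * s))) ≤ ind (¬ IsSchur r N Z) *
        Pr univ (ε / s) (fun R => IsSchur r N (Z ∪ R)) := by
    intro Z _
    have hnn : 0 ≤ ind (¬ IsSchur r N Z) * Pr univ (ε / s) (fun R => IsSchur r N (Z ∪ R)) :=
      mul_nonneg (ind_nonneg _) (Pr_nonneg hq0 hq1 _)
    by_cases hZW : δ / 4 * N ≤ W Z
    swap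
    · rw [ind_neg hZW]
      linarith [ind_nonneg (¬ Typical B Z (κ' * s) (δ / 16 * N) (η * s))]
    by_cases hZT : Typical B Z (κ' * s) (δ / 16 * N) (η * s)
    swap
    · rw [ind_pos hZT]
      linarith [ind_le_one (δ / 4 * N ≤ W Z)]
    obtain ⟨hZ0, hZc, hZM, hZp⟩ := hZT
    have hAZ : ¬ IsSchur r N Z := by
      intro hA
      have : W Z = 0 := by simp [hW, hA]
      rw [this] at hZW
      have : 0 < δ / 4 * N := by positivity
      linarith
    have hWeq : W Z = #{x | IsSchur r N (Z ∪ B.image (x * ·))} := by simp [hW, hAZ]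
    set X : Finset (ZMod N) := {x | Clean B Z x ∧ Matched B Z x ∧ #(touched B Z x) ≤ m ∧
      IsSchur r N (Z ∪ B.image (x * ·))} with hX
    have hBK : (#B : ℝ) ≤ K := by exact_mod_cast hB
    have hc1 : (#{x | ¬ Clean B Z x} : ℝ) ≤ δ / 16 * N := by
      have h1 : (#{x | ¬ Clean B Z x} : ℝ) ≤ 1 + #Z * #B + 3 * #Z * #B ^ 2 := by
        exact_mod_cast card_not_clean_le h0B hZ0
      have h2 : (#B : ℝ) ≤ K ^ 2 := by
        refine hBK.trans ?_
        exact_mod_cast Nat.le_self_pow two_ne_zero K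
      calc _ ≤ _ := h1
        _ ≤ 1 + κ' * s * K ^ 2 + 3 * (κ' * s) * K ^ 2 := by gcongr
        _ = 1 + 4 * K ^ 2 * κ' * s := by ring
        _ ≤ (1 + 4 * K ^ 2 * κ') * s := by linarith
        _ ≤ δ / 16 * s * s := by gcongr; linarith
        _ = _ := by rw [← hss]; ring
    have hc2 : (#{x | ¬ #(touched B Z x) ≤ m} : ℝ) ≤ δ / 16 * N := by
      have h1 := card_many_touched_le (Z := Z) h0B (m + 1)
      simp only [Nat.add_one_le_iff, ← not_le] at h1
      have h2 : (#{x | ¬ #(touched B Z x) ≤ m} : ℝ) * (m + 1) ≤ 3 * #B * #Z ^ 2 := by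
        exact_mod_cast h1
      rw [div_le_iff₀ hδ] at hm
      refine le_of_mul_le_mul_right (h2.trans ?_) (show (0 : ℝ) < m + 1 by positivity)
      calc (3 : ℝ) * #B * #Z ^ 2 ≤ 3 * K * (κ' * s) ^ 2 := by gcongr
        _ = (48 * K * κ' ^ 2) / 16 * N := by rw [← hss]; ring
        _ ≤ (m * δ) / 16 * N := by gcongr
        _ ≤ ((m + 1) * δ) / 16 * N := by gcongr; linarith
        _ = _ := by ring
    have hXc : δ / 16 * N ≤ #X := by
      have h1 := card_filter_and_ge (univ : Finset (ZMod N))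
        (fun x => IsSchur r N (Z ∪ B.image (x * ·))) (fun x => Clean B Z x)
        (fun x => Matched B Z x) (fun x => #(touched B Z x) ≤ m)
      have h2 : (#{x | IsSchur r N (Z ∪ B.image (x * ·))} : ℝ) ≤ #X + #{x | ¬ Clean B Z x} +
          #{x | ¬ Matched B Z x} + #{x | ¬ #(touched B Z x) ≤ m} := by
        exact_mod_cast h1
      rw [hWeq] at hZW
      linarith
    have hfin := hext Z X hB h0B hsp hZc hZp (fun x hx => (mem_filter.1 hx).2) hXc
    rw [Pr_not] at hfin
    rw [ind_pos hAZ, ind_pos hZW]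
    linarith [ind_nonneg (¬ Typical B Z (κ' * s) (δ / 16 * N) (η * s))]
  refine le_trans ?_ (Ex_mono h0 h1 hpt)
  rw [Ex_const_mul, Ex_sub]
  change δ / 8 ≤ 1 / 2 * (Pr univ p (fun Z => δ / 4 * N ≤ W Z) -
    Pr univ p (fun Z => ¬ Typical B Z (κ' * s) (δ / 16 * N) (η * s)))
  linarith

end Contradiction

section Boosters
open Finset

variable {α : Type*} [DecidableEq α]

lemma mul_Ex_erase {X : Finset α} {i : α} (hi : i ∈ X) (p : ℝ) (G : Finset α → ℝ) :
    p * Ex X p (fun x => G (x.erase i)) = Ex X p (fun x => ind (i ∈ x) * G (x.erase i)) := by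
  obtain ⟨Y, hiY, rfl⟩ : ∃ Y, i ∉ Y ∧ insert i Y = X :=
    ⟨X.erase i, notMem_erase i X, insert_erase hi⟩
  rw [Ex_insert hiY, Ex_insert hiY]
  have h1 : Ex Y p (fun S => G ((insert i S).erase i)) = Ex Y p G :=
    Ex_congr fun S hS => by rw [erase_insert fun h => hiY (hS h)]
  have h2 : Ex Y p (fun S => G (S.erase i)) = Ex Y p G :=
    Ex_congr fun S hS => by rw [erase_eq_of_notMem fun h => hiY (hS h)]
  have h3 : Ex Y p (fun S => ind (i ∈ insert i S) * G ((insert i S).erase i)) = Ex Y p G :=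
    Ex_congr fun S hS => by
      rw [erase_insert fun h => hiY (hS h), ind_pos (mem_insert_self _ _), one_mul]
  have h4 : Ex Y p (fun S => ind (i ∈ S) * G (S.erase i)) = 0 := by
    rw [← Ex_const Y p 0]
    exact Ex_congr fun S hS => by rw [ind_neg fun h => hiY (hS h), zero_mul]
  rw [h1, h2, h3, h4]
  ring

/-- The gain of a monotone property when sprinkling an independent random set of density `q`. -/
lemma Ex_ind_not_mul_Pr {X : Finset α} {A : Finset α → Prop} (hA : ∀ x y, x ⊆ y → A x → A y)
    (p q : ℝ) : Ex X p (fun Z => ind (¬ A Z) * Pr X q (fun R => A (Z ∪ R))) =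
      Pr X (p + q - p * q) A - Pr X p A := by
  unfold Pr
  rw [Ex_union, ← Ex_sub]
  refine Ex_congr fun Z _ => ?_
  by_cases hZ : A Z
  · have : Ex X q (fun R => ind (A (Z ∪ R))) = 1 := by
      rw [← Ex_const X q 1]
      exact Ex_congr fun R _ => ind_pos (hA _ _ subset_union_left hZ)
    rw [ind_neg (not_not.2 hZ), this, ind_pos hZ]
    ring
  · rw [ind_pos hZ, ind_neg hZ]
    ring

/-- If minimal witnesses of `D` have at most `K` elements, then the expected number of pivotal
elements is at most `K` times the probability of `D`. -/
lemma sum_pivotal_le {X : Finset α} {p : ℝ} (h0 : 0 ≤ p) (h1 : p ≤ 1) {D : Finset α → Prop} {K : ℕ}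
    (hD : ∀ x, D x → ∃ W ⊆ x, #W ≤ K ∧ ∀ y, W ⊆ y → D y) :
    ∑ i ∈ X, p * Ex X p (fun x => ind (¬ D (x.erase i) ∧ D (insert i x))) ≤ K * Pr X p D := by
  classical
  have h : ∀ i ∈ X, p * Ex X p (fun x => ind (¬ D (x.erase i) ∧ D (insert i x))) =
      Ex X p (fun x => ind (i ∈ x) * ind (¬ D (x.erase i) ∧ D (insert i (x.erase i)))) := by
    intro i hi
    rw [← mul_Ex_erase hi p (fun y => ind (¬ D y ∧ D (insert i y)))]
    congr 1
    refine Ex_congr fun x _ => ?_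
    congr 3
    ext j
    simp only [mem_insert, mem_erase]
    tauto
  rw [sum_congr rfl h, ← Ex_sum]
  unfold Pr
  rw [← Ex_const_mul]
  refine Ex_mono h0 h1 fun x _ => ?_
  simp only [← ind_and]
  by_cases hx : D x
  · obtain ⟨W, hWx, hWK, hW⟩ := hD x hx
    rw [ind_pos hx, mul_one]
    calc ∑ i ∈ X, ind (i ∈ x ∧ ¬ D (x.erase i) ∧ D (insert i (x.erase i)))
        ≤ ∑ i ∈ X, if i ∈ W then (1 : ℝ) else 0 := by
          refine sum_le_sum fun i _ => ?_
          split_ifs with hiW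
          · exact ind_le_one _
          · refine (ind_neg ?_).le
            rintro ⟨-, h2, -⟩
            exact h2 (hW _ (subset_erase.2 ⟨hWx, hiW⟩))
      _ = #(X ∩ W) := by rw [sum_ite_mem, sum_const, nsmul_eq_mul, mul_one]
      _ ≤ K := by exact_mod_cast (card_le_card inter_subset_right).trans hWK
  · rw [ind_neg hx, mul_zero]
    refine (sum_eq_zero fun i _ => ind_neg ?_).le
    rintro ⟨h1, -, h3⟩
    rw [insert_erase h1] at h3
    exact hx h3

/-- A monotone property with small average influence and non-negligible variance admits a bounded
set which boosts its probability, even after discarding a sparse monotone property `D`. -/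
theorem exists_booster {C v : ℝ} (hC : 0 < C) (hv : 0 < v) : ∃ d : ℕ, ∃ δ > 0, ∃ η > 0,
    ∀ {α : Type} [DecidableEq α] (X : Finset α) (p : ℝ) (A D : Finset α → Prop) (K : ℕ),
      0 < p → p ≤ 1 / 2 → p ≤ δ / 2 → (∀ x y, x ⊆ y → A x → A y) →
      (∀ x, D x → ∃ W ⊆ x, #W ≤ K ∧ ∀ y, W ⊆ y → D y) → K * Pr X p D ≤ η →
      ∑ i ∈ X, p * Ex X p (fun x => ind (A (insert i x) ∨ D (insert i x)) -
        ind (A (x.erase i) ∨ D (x.erase i))) ≤ C →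
      v ≤ Pr X p (fun x => A x ∨ D x) * (1 - Pr X p (fun x => A x ∨ D x)) →
      ∃ B : Finset α, #B ≤ d + 1 ∧ ¬ D B ∧ δ / 2 ≤ Pr X p (fun x => ¬ A x ∧ A (x ∪ B)) := by
  obtain ⟨d, hd⟩ := exists_nat_ge (4 * C / v)
  refine ⟨d, (v / (16 * C)) ^ 3 / 2 ^ (8 * d), by positivity, v / 16, by positivity, ?_⟩
  set δ := (v / (16 * C)) ^ 3 / 2 ^ (8 * d) with hδ
  have hδ0 : 0 < δ := by positivity
  intro α _ X p A D K h0 h1 hpδ hA hD hη hsum hvar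
  have hDm : ∀ x y, x ⊆ y → D x → D y := fun x y hxy hx => by
    obtain ⟨W, hWx, -, hW⟩ := hD x hx
    exact hW y (hWx.trans hxy)
  have hF : ∀ x y, x ⊆ y → A x ∨ D x → A y ∨ D y := fun x y hxy => Or.imp (hA x y hxy) (hDm x y hxy)
  have hei : ∀ (i : α) (x : Finset α), x.erase i ⊆ insert i x := fun i x =>
    (erase_subset i x).trans (subset_insert i x)
  have hp1 : p ≤ 1 := by linarith
  by_contra! hcon
  have hsp : ∀ (i : α) (x : Finset α), ind (A (insert i x) ∨ D (insert i x)) -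
      ind (A (x.erase i) ∨ D (x.erase i)) =
      ind (¬ (A (x.erase i) ∨ D (x.erase i)) ∧ A (insert i x) ∧ ¬ D (insert i x)) +
      ind (¬ (A (x.erase i) ∨ D (x.erase i)) ∧ D (insert i x)) := by
    intro i x
    have := hF _ _ (hei i x)
    by_cases h2 : A (x.erase i) ∨ D (x.erase i)
    · rw [ind_pos h2, ind_pos (this h2), ind_neg (fun h => h.1 h2), ind_neg (fun h => h.1 h2)]
      norm_num
    · by_cases h3 : D (insert i x) <;> by_cases h4 : A (insert i x) <;> simp [ind, h2, h3, h4]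
  have hind : ∀ P : Prop, ind P = 0 ∨ ind P = 1 := fun P => by
    by_cases h : P <;> simp [ind, h]
  have key := variance_le_of_no_booster h0 h1 X d (δ := δ) (θ := v / (16 * C)) (C := C)
    (η := v / 16) (by positivity) (by rw [hδ]; field_simp; exact le_rfl)
    (fun x => ind (A x ∨ D x))
    (fun i x => ind (¬ (A (x.erase i) ∨ D (x.erase i)) ∧ A (insert i x) ∧ ¬ D (insert i x)))
    (fun i x => ind (¬ (A (x.erase i) ∨ D (x.erase i)) ∧ D (insert i x)))
    (fun i _ x _ => hsp i x) ?_ (fun i x => hind _) (fun i x => hind _) hsum ?_ ?_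
  · have hsq : ∀ P : Prop, ind P ^ 2 = ind P := fun P => by
      rcases hind P with h | h <;> rw [h] <;> norm_num
    simp only [hsq] at key
    unfold Pr at hvar
    have h2 : C / (d + 2) ≤ v / 4 := by
      rw [div_le_iff₀ hv] at hd
      rw [div_le_iff₀ (by positivity)]
      linarith
    have h3 : 2 * (v / (16 * C)) * C = v / 8 := by
      field_simp
      norm_num
    rw [h3] at key
    nlinarith
  · intro i _ x _
    rw [← hsp]
    have := ind_mono (hF _ _ (hei i x))
    rcases hind (A (insert i x) ∨ D (insert i x)) with h | h <;>
      rcases hind (A (x.erase i) ∨ D (x.erase i)) with h' | h' <;> rw [h, h'] at this ⊢ <;>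
      first | (exfalso; linarith) | simp
  · refine le_trans (sum_le_sum fun i _ => mul_le_mul_of_nonneg_left ?_ h0.le)
      ((sum_pivotal_le h0.le hp1 hD).trans hη)
    exact Ex_mono h0.le hp1 fun x _ => ind_mono fun ⟨h, h'⟩ => ⟨fun h'' => h (Or.inr h''), h'⟩
  · intro i hi U _ hU
    by_contra hδE
    rw [not_le] at hδE
    set P : Finset α → Prop := fun x => ¬ (A ((x ∪ U).erase i) ∨ D ((x ∪ U).erase i)) ∧
      A (insert i (x ∪ U)) ∧ ¬ D (insert i (x ∪ U)) with hP
    have hins : ∀ x : Finset α, insert i (x ∪ U) = x ∪ insert i U := fun x => by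
      rw [union_insert]
    change δ < Pr X p P at hδE
    have hex : ∃ x, P x := by
      by_contra! hno
      have : Pr X p P = 0 := by
        unfold Pr
        rw [← Ex_const X p 0]
        exact Ex_congr fun x _ => ind_neg (hno x)
      linarith
    have hnD : ¬ D (insert i U) := by
      obtain ⟨x, -, -, hx⟩ := hex
      rw [hins] at hx
      exact fun h => hx (hDm _ _ subset_union_right h)
    have hcB : #(insert i U) ≤ d + 1 := (card_insert_le _ _).trans (by omega)
    have hlt := hcon _ hcB hnD
    have hle : Pr X p P ≤ Pr X p (fun x => ¬ A x ∧ A (x ∪ insert i U)) + p := by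
      have hpi : Pr X p (fun x => {i} ⊆ x) = p := by
        rw [Pr_subset p (singleton_subset_iff.2 hi)]
        simp
      calc Pr X p P ≤ Pr X p (fun x => (¬ A x ∧ A (x ∪ insert i U)) ∨ {i} ⊆ x) := by
            refine Pr_mono h0.le hp1 fun x _ hx => ?_
            by_cases hix : i ∈ x
            · exact Or.inr (singleton_subset_iff.2 hix)
            · refine Or.inl ⟨fun hAx => hx.1 (Or.inl (hA x _ ?_ hAx)), ?_⟩
              · exact subset_erase.2 ⟨subset_union_left, hix⟩
              · rw [← hins]
                exact hx.2.1
        _ ≤ _ := (Pr_or_le h0.le hp1 _ _).trans (by rw [hpi])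
    linarith

end Boosters

section Main
open Finset

/-- A monotone function with values in `[0, 1]` has a point in any window `[a, (1 + ε) a]` where its
logarithmic derivative is bounded and after which it increases slowly. -/
lemma exists_small_increment {f f' : ℝ → ℝ} {a ε : ℝ} (ha : 0 < a) (hε : 0 < ε)
    (hf : ∀ x, HasDerivAt f (f' x) x) (hmono : MonotoneOn f (Set.Icc a ((1 + ε) * a)))
    (h0 : 0 ≤ f a) (h1 : f ((1 + ε) * a) ≤ 1) {m : ℕ} (hm : 0 < m) :
    ∃ u, a ≤ u ∧ u + a * ε / (2 * m) ≤ (1 + ε) * a ∧ f (u + a * ε / (2 * m)) - f u ≤ 1 / m ∧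
      u * f' u ≤ 2 * (1 + ε) / ε := by
  have hm0 : (0 : ℝ) < m := by exact_mod_cast hm
  set t := a * ε / (2 * m) with ht
  have ht0 : 0 < t := by positivity
  have htm : 2 * t * m = a * ε := by
    rw [ht]
    field_simp
  obtain ⟨j, hj, hjm⟩ : ∃ j ∈ range m,
      f (a + 2 * t * (j + 1 : ℕ)) - f (a + 2 * t * (j : ℕ)) ≤ 1 / m := by
    refine exists_le_of_sum_le (nonempty_range_iff.2 hm.ne') ?_
    rw [sum_range_sub fun j : ℕ => f (a + 2 * t * j), sum_const, card_range, nsmul_eq_mul,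
      mul_one_div_cancel hm0.ne', htm]
    have : a + a * ε = (1 + ε) * a := by ring
    rw [this]
    simp only [Nat.cast_zero, mul_zero, add_zero]
    linarith
  rw [mem_range] at hj
  have hj1 : ((j : ℝ) + 1) ≤ m := by exact_mod_cast hj
  push_cast at hjm
  set b := a + 2 * t * j with hb
  have hab : a ≤ b := by
    rw [hb]
    have : 0 ≤ 2 * t * j := by positivity
    linarith
  have hb2 : a + 2 * t * (j + 1) = b + 2 * t := by rw [hb]; ring
  have hbt : b + 2 * t ≤ (1 + ε) * a := by
    rw [← hb2]
    have : 2 * t * (j + 1) ≤ 2 * t * m := by gcongr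
    linarith
  rw [hb2] at hjm
  have hIcc : ∀ x, b ≤ x → x ≤ b + 2 * t → x ∈ Set.Icc a ((1 + ε) * a) := fun x h h' =>
    ⟨hab.trans h, h'.trans hbt⟩
  obtain ⟨u, ⟨hu1, hu2⟩, hu⟩ := exists_hasDerivAt_eq_slope f f' (show b < b + t by linarith)
    (fun x _ => (hf x).continuousAt.continuousWithinAt) fun x _ => hf x
  refine ⟨u, hab.trans hu1.le, by linarith, ?_, ?_⟩
  · have h2 := hmono (hIcc (u + t) (by linarith) (by linarith))
      (hIcc (b + 2 * t) (by linarith) le_rfl) (by linarith)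
    have h3 := hmono (hIcc b le_rfl (by linarith)) (hIcc u hu1.le (by linarith)) hu1.le
    linarith
  · have h2 := hmono (hIcc (b + t) (by linarith) (by linarith))
      (hIcc (b + 2 * t) (by linarith) le_rfl) (by linarith)
    have h3 := hmono (hIcc b le_rfl (by linarith)) (hIcc (b + t) (by linarith) (by linarith))
      (by linarith)
    rw [hu, add_sub_cancel_left]
    calc u * ((f (b + t) - f b) / t) ≤ ((1 + ε) * a) * ((1 / m) / t) := by
          exact mul_le_mul (by linarith) (div_le_div_of_nonneg_right (by linarith) ht0.le)
            (div_nonneg (by linarith) ht0.le) (by positivity)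
      _ = 2 * (1 + ε) / ε := by
          rw [ht]
          field_simp

set_option maxHeartbeats 1000000 in
/-- Once the probability of being `r`-Schur is bounded away from `0`, increasing the density by a
constant factor brings it close to `1`. -/
theorem Pr_isSchur_jump (r : ℕ) (hr : 2 ≤ r) {κ₀ κ₁ a ε : ℝ} (hκ₀ : 0 < κ₀) (hκ : κ₀ ≤ κ₁)
    (ha : 0 < a) (hε : 0 < ε) : ∃ N₀ : ℕ, ∀ (N : ℕ) [Fact N.Prime], N₀ ≤ N → ∀ q : ℝ,
      κ₀ / √N ≤ q → q ≤ κ₁ / √N → a ≤ Pr univ q (IsSchur r N) →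
      1 - a ≤ Pr univ ((1 + ε) * q) (IsSchur r N) := by
  have hκ₁ : 0 < κ₁ := hκ₀.trans_le hκ
  obtain ⟨d, δ, hδ, η, hη, hboost⟩ := exists_booster (C := 2 * (1 + ε) / ε) (v := a * (a / 2))
    (by positivity) (by positivity)
  set K := d + 1 with hK
  set κ := (1 + ε) * κ₁ with hκdef
  have hκpos : 0 < κ := by positivity
  obtain ⟨m, hm⟩ := exists_nat_ge (64 / δ)
  have hm0 : (0 : ℝ) < m := (show 0 < 64 / δ by positivity).trans_le hm
  have hm1 : 0 < m := by exact_mod_cast hm0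
  have hmδ : 1 / (m : ℝ) ≤ δ / 64 := by
    rw [div_le_iff₀ hδ] at hm
    rw [div_le_iff₀ hm0]
    linarith
  obtain ⟨N₁, hbb⟩ := booster_bound r hr K (δ / 2) κ (κ₀ * ε / (2 * m)) (by positivity) hκpos
    (by positivity)
  obtain ⟨C, hC0, hC⟩ := exists_Pr_dense_le K κ hκpos.le
  set M := max (2 * κ) (max (2 * κ / δ) (max (64 * C / δ) (max ((K + 1) * C / η) (2 * C / a))))
    with hM
  obtain ⟨N₂, hN₂⟩ := exists_nat_ge (M ^ 2)
  refine ⟨max N₁ N₂, fun N _ hN q hq0 hq1 haq => ?_⟩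
  have hNpos : (0 : ℝ) < N := by exact_mod_cast (Fact.out : N.Prime).pos
  set s := √(N : ℝ) with hs
  have hs0 : 0 < s := Real.sqrt_pos.2 hNpos
  have hMs : M ≤ s := Real.le_sqrt_of_sq_le
    (hN₂.trans (by exact_mod_cast (le_max_right _ _).trans hN))
  simp only [hM, max_le_iff] at hMs
  obtain ⟨hs1, hs2, hs3, hs4, hs5⟩ := hMs
  have hκ2 : κ / s ≤ 1 / 2 := by
    rw [div_le_iff₀ hs0]
    linarith
  have hκδ : κ / s ≤ δ / 2 := by
    rw [div_le_iff₀ hδ] at hs2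
    rw [div_le_iff₀ hs0]
    linarith
  have hCδ : C / s ≤ δ / 64 := by
    rw [div_le_iff₀ hδ] at hs3
    rw [div_le_iff₀ hs0]
    linarith
  have hCη : (K + 1) * (C / s) ≤ η := by
    rw [div_le_iff₀ hη] at hs4
    rw [← mul_div_assoc, div_le_iff₀ hs0]
    linarith
  have hCa : C / s ≤ a / 2 := by
    rw [div_le_iff₀ ha] at hs5
    rw [div_le_iff₀ hs0]
    linarith
  by_contra! hcon
  have hq : 0 < q := (div_pos hκ₀ hs0).trans_le hq0
  have hqκ : (1 + ε) * q ≤ κ / s := by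
    rw [hκdef, mul_div_assoc]
    gcongr
  have hqq : q ≤ (1 + ε) * q := by nlinarith
  set A : Finset (ZMod N) → Prop := IsSchur r N with hA
  set D : Finset (ZMod N) → Prop := HasDense K with hD
  have hAm : ∀ x y, x ⊆ y → A x → A y := fun x y hxy hx => IsSchur.mono hx hxy
  have hDW : ∀ x, D x → ∃ W ⊆ x, #W ≤ K + 1 ∧ ∀ y, W ⊆ y → D y := by
    rintro x (hx | ⟨W, hWx, hW⟩)
    · exact ⟨{0}, singleton_subset_iff.2 hx, by simp, fun y hy =>
        Or.inl (singleton_subset_iff.1 hy)⟩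
    · exact ⟨W, hWx, hW.1.trans (Nat.le_succ K), fun y hy => Or.inr ⟨W, hy, hW⟩⟩
  have hAD : ∀ x y, x ⊆ y → A x ∨ D x → A y ∨ D y := fun x y hxy =>
    Or.imp (hAm x y hxy) fun h => HasDense.mono h hxy
  set f : ℝ → ℝ := fun p => Pr univ p (fun x => A x ∨ D x) with hf
  have hmono : ∀ x y, 0 ≤ x → x ≤ y → y ≤ 1 → f x ≤ f y := fun x y h0 hxy h1 =>
    Pr_mono_density hAD h0 hxy h1
  obtain ⟨u, hu0, hu1, hinc, hder⟩ := exists_small_increment hq hε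
    (fun x => hasDerivAt_Ex univ (fun x => ind (A x ∨ D x)) x)
    (fun x hx y hy hxy => hmono x y (hq.le.trans hx.1) hxy (by linarith [hy.2]))
    (Pr_nonneg hq.le (by linarith) _) (Pr_le_one (by positivity) (by linarith) _) hm1
  have hstep : 0 < q * ε / (2 * m) := by positivity
  have huκ : u ≤ κ / s := by linarith
  have hu : 0 < u := hq.trans_le hu0
  have hu1' : u ≤ 1 := by linarith
  have hDu : Pr univ u D ≤ C / s := hC N u hu.le hu1' huκ
  have hfl : a ≤ f u := haq.trans ((Pr_mono_density hAm hq.le hu0 hu1').trans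
    (Pr_mono hu.le hu1' fun x _ hx => Or.inl hx))
  have hfD : f u ≤ Pr univ u A + Pr univ u D := Pr_or_le hu.le hu1' _ _
  have hfu : f u ≤ 1 - a / 2 := by
    have := Pr_mono_density (X := univ) hAm hu.le (show u ≤ (1 + ε) * q by linarith) (by linarith)
    linarith
  obtain ⟨B, hB, hBD, hδB⟩ := hboost univ u A D (K + 1) hu (by linarith) (by linarith) hAm hDW
    (by
      push_cast
      exact (mul_le_mul_of_nonneg_left hDu (by positivity)).trans hCη)
    (by
      rw [← mul_sum]
      exact hder)
    (mul_le_mul hfl (by linarith) (by positivity) (by linarith))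
  simp only [hD, HasDense, not_or, not_exists, not_and, not_lt] at hBD
  have hε1 : κ₀ * ε / (2 * m) / s ≤ q * ε / (2 * m) := by
    calc κ₀ * ε / (2 * m) / s = κ₀ / s * ε / (2 * m) := by ring
      _ ≤ _ := by gcongr
  have hbound := hbb N ((le_max_left _ _).trans hN) u hu.le hu1' huκ B hB hBD.1
    (fun U hU => hBD.2 U hU ((card_le_card hU).trans hB)) hδB
  set q' := κ₀ * ε / (2 * m) / s with hq'
  have hq'0 : 0 ≤ q' := by positivity
  have hq'1 : q' ≤ 1 := by linarith
  have hsplit := Ex_ind_not_mul_Pr (X := univ) hAm u q'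
  have huq : 0 ≤ u * q' := by positivity
  have hup : Pr univ (u + q' - u * q') A ≤ f (u + q * ε / (2 * m)) :=
    (Pr_mono_density (X := univ) hAm (show 0 ≤ u + q' - u * q' by nlinarith)
      (show u + q' - u * q' ≤ u + q * ε / (2 * m) by linarith) (by linarith)).trans
      (Pr_mono (by positivity) (by linarith) fun x _ hx => Or.inl hx)
  change f (u + q * ε / (2 * m)) - f u ≤ 1 / m at hinc
  linarith

end Main

section Threshold
open Finset

/-- Densities at which a random set is `r`-Schur with probability `1 / 2`. -/
lemma exists_median (r : ℕ) (hr : 2 ≤ r) : ∃ c₀ c₁ : ℝ, 0 < c₀ ∧ c₀ ≤ c₁ ∧ ∃ N₀ : ℕ, ∃ c : ℕ → ℝ,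
    (∀ N, c₀ ≤ c N ∧ c N ≤ c₁) ∧ ∀ (N : ℕ) [Fact N.Prime], N₀ ≤ N →
      Pr univ (c N / √N) (IsSchur r N) = 1 / 2 := by
  obtain ⟨a, ha, -, hlow⟩ := exists_lower_density r hr
  obtain ⟨b, hb, N₀, hup⟩ := exists_upper_density r
  have hab : min a b ≤ max a b := min_le_max
  refine ⟨min a b, max a b, lt_min ha hb, hab, N₀, ?_⟩
  have h : ∀ N : ℕ, ∃ t, (min a b ≤ t ∧ t ≤ max a b) ∧ ∀ [Fact N.Prime], N₀ ≤ N →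
      Pr univ (t / √N) (IsSchur r N) = 1 / 2 := by
    intro N
    by_cases hN : N.Prime ∧ N₀ ≤ N
    · have := Fact.mk hN.1
      have hcont : Continuous fun t : ℝ => Pr univ (t / √N) (IsSchur r N) :=
        (continuous_Ex univ _).comp (continuous_id.div_const _)
      obtain ⟨t, ht, h⟩ := intermediate_value_uIcc (a := a) (b := b) hcont.continuousOn
        (Set.mem_uIcc_of_le ((hlow N).trans (by norm_num))
          (le_trans (by norm_num) (hup N hN.2).2) : (1 / 2 : ℝ) ∈ _)
      exact ⟨t, ht, fun _ => h⟩
    · exact ⟨min a b, ⟨le_rfl, hab⟩, fun {h1} h2 => (hN ⟨h1.out, h2⟩).elim⟩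
  choose c hc hc' using h
  exact ⟨c, hc, fun N _ => hc' N⟩

lemma zmodAll_eq_univ (N : ℕ) [NeZero N] : zmodAll N = univ := by
  refine eq_univ_of_forall fun x => ?_
  exact mem_image.2 ⟨x.val, mem_range.2 x.val_lt, ZMod.natCast_zmod_val x⟩

end Threshold

end SchurThreshold

open SchurThreshold

/-- **Sharp threshold for Schur's theorem.** For `r ≥ 2` there are constants
`0 < c₀ ≤ c₁` and a function `c` with `c₀ ≤ c(N) ≤ c₁` for all primes `N`,
such that for every `ε > 0`, as `N → ∞ through the primes`: if
`p(N) ≥ (1+ε)·c(N)·N^{−1/2}` for all primes `N` then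
`Pr((ℤ_N)_{p(N)} ∈ 𝒮_r) → 1`, and if `p(N) ≤ (1−ε)·c(N)·N^{−1/2}` for all
primes `N` then the probability tends to 0. -/
theorem sharp_threshold_schur (r : ℕ) (hr : 2 ≤ r) :
    ∃ c₀ c₁ : ℝ, 0 < c₀ ∧ c₀ ≤ c₁ ∧ ∃ c : ℕ → ℝ,
      (∀ N : ℕ, N.Prime → c₀ ≤ c N ∧ c N ≤ c₁) ∧
      ∀ ε : ℝ, 0 < ε → ∀ p : ℕ → ℝ, (∀ N, p N ∈ Set.Icc (0 : ℝ) 1) →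
        ((∀ N : ℕ, N.Prime → (1 + ε) * c N * (N : ℝ) ^ (-(1 / 2 : ℝ)) ≤ p N) →
          Tendsto (fun N => probSub (zmodAll N) (p N) (IsSchur r N))
            (atTop ⊓ Filter.principal {N : ℕ | N.Prime}) (nhds 1)) ∧
        ((∀ N : ℕ, N.Prime → p N ≤ (1 - ε) * c N * (N : ℝ) ^ (-(1 / 2 : ℝ))) →
          Tendsto (fun N => probSub (zmodAll N) (p N) (IsSchur r N))
            (atTop ⊓ Filter.principal {N : ℕ | N.Prime}) (nhds 0)) := by
  obtain ⟨c₀, c₁, hc₀, hc₁, N₀, c, hc, hmed⟩ := exists_median r hr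
  have hrpow : ∀ (N : ℕ) (t : ℝ), t * (N : ℝ) ^ (-(1 / 2 : ℝ)) = t / √N := fun N t => by
    rw [Real.rpow_neg (Nat.cast_nonneg N), ← Real.sqrt_eq_rpow, div_eq_mul_inv]
  have hprob : ∀ (N : ℕ) [Fact N.Prime] (q : ℝ),
      probSub (zmodAll N) q (IsSchur r N) = Pr Finset.univ q (IsSchur r N) := fun N _ q => by
    rw [probSub_eq_Pr, zmodAll_eq_univ]
  have hmono : ∀ (N : ℕ) [Fact N.Prime] {q q' : ℝ}, 0 ≤ q → q ≤ q' → q' ≤ 1 →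
      Pr Finset.univ q (IsSchur r N) ≤ Pr Finset.univ q' (IsSchur r N) := fun N _ q q' =>
    Pr_mono_density fun S T h hS => IsSchur.mono hS h
  refine ⟨c₀, c₁, hc₀, hc₁, c, fun N _ => hc N, fun ε hε p hp => ⟨fun h => ?_, fun h => ?_⟩⟩
  · rw [Metric.tendsto_nhds]
    intro a ha
    obtain ⟨N₁, hN₁⟩ := Pr_isSchur_jump r hr hc₀ hc₁ (a := min (a / 2) (1 / 4)) (by positivity) hε
    rw [eventually_inf_principal]
    filter_upwards [eventually_ge_atTop (max N₀ N₁)] with N hN hNp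
    have := Fact.mk (show N.Prime from hNp)
    rw [hprob, Real.dist_eq, abs_sub_comm,
      abs_of_nonneg (sub_nonneg.2 (Pr_le_one (hp N).1 (hp N).2 _))]
    have hpos : 0 ≤ c N / √N := div_nonneg (hc₀.le.trans (hc N).1) (Real.sqrt_nonneg _)
    have h1 := hN₁ N ((le_max_right _ _).trans hN) (c N / √N)
      (div_le_div_of_nonneg_right (hc N).1 (Real.sqrt_nonneg _))
      (div_le_div_of_nonneg_right (hc N).2 (Real.sqrt_nonneg _))
      (by
        rw [hmed N ((le_max_left _ _).trans hN)]
        exact (min_le_right _ _).trans (by norm_num))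
    have h2 := h N hNp
    rw [hrpow, mul_div_assoc] at h2
    have h3 := hmono N (by positivity) h2 (hp N).2
    have h4 := min_le_left (a / 2) (1 / 4 : ℝ)
    linarith
  · rw [Metric.tendsto_nhds]
    intro a ha
    set ε' := min ε (1 / 2) with hε'
    have hε'0 : 0 < ε' := by positivity
    have hε'1 : ε' ≤ 1 / 2 := min_le_right _ _
    obtain ⟨N₁, hN₁⟩ := Pr_isSchur_jump r hr (κ₀ := c₀ / 2) (κ₁ := c₁) (by positivity)
      (by linarith) (a := min (a / 2) (1 / 4)) (by positivity) hε'0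
    obtain ⟨N₂, hN₂⟩ := exists_nat_ge (c₁ ^ 2)
    rw [eventually_inf_principal]
    filter_upwards [eventually_ge_atTop (max (max N₀ N₁) N₂)] with N hN hNp
    have := Fact.mk (show N.Prime from hNp)
    have hs0 : 0 < √(N : ℝ) := Real.sqrt_pos.2 (by exact_mod_cast hNp.pos)
    have hcs : c₁ ≤ √(N : ℝ) := Real.le_sqrt_of_sq_le
      (hN₂.trans (by exact_mod_cast (le_max_right _ _).trans hN))
    rw [hprob, Real.dist_eq, sub_zero, abs_of_nonneg (Pr_nonneg (hp N).1 (hp N).2 _)]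
    by_contra! hcon
    set t := c N / √N with ht
    have ht0 : c₀ / √N ≤ t := div_le_div_of_nonneg_right (hc N).1 hs0.le
    have ht1 : t ≤ c₁ / √N := div_le_div_of_nonneg_right (hc N).2 hs0.le
    have htpos : 0 < t := (div_pos hc₀ hs0).trans_le ht0
    have htle : t ≤ 1 := ht1.trans ((div_le_one hs0).2 hcs)
    have h2 := h N hNp
    rw [hrpow, mul_div_assoc, ← ht] at h2
    have h3 : p N ≤ (1 - ε') * t := h2.trans (by gcongr; exact min_le_left _ _)
    have h4 : (1 - ε') * t ≤ t := by nlinarith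
    have h5 := hmono N (hp N).1 h3 (h4.trans htle)
    have h6 := hN₁ N (((le_max_right _ _).trans (le_max_left _ _)).trans hN) ((1 - ε') * t)
      (by
        rw [div_right_comm]
        nlinarith)
      (h4.trans ht1) ((min_le_left _ _).trans (by linarith))
    have h7 := hmono N (q := (1 + ε') * ((1 - ε') * t)) (q' := t)
      (mul_nonneg (by positivity) (mul_nonneg (by linarith) htpos.le))
      (by nlinarith [mul_pos (mul_pos hε'0 hε'0) htpos]) htle
    rw [hmed N (((le_max_left _ _).trans (le_max_left _ _)).trans hN)] at h7
    have h8 := min_le_right (a / 2) (1 / 4 : ℝ)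
    linarith
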